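/- Let k and s be natural numbers with s ≥ k²(2·log k + log log k + 5). Then there exists a positive real number C(s,k) such that J_{s,k}(X) / X^{2s − k(k+1)/2} → C(s,k) as X → ∞. -/

import Mathlib

/-- `J s k X` counts the 2s-tuples of integers `(x₁,…,x_s,y₁,…,y_s)` with
`1 ≤ xᵢ, yᵢ ≤ X` satisfying `x₁^j + … + x_s^j = y₁^j + … + y_s^j` for `1 ≤ j ≤ k`. -/
noncomputable def J (s k : ℕ) (X : ℝ) : ℕ :=
  Set.ncard {p : (Fin s → ℤ) × (Fin s → ℤ) |
    (∀ i, 1 ≤ p.1 i ∧ (p.1 i : ℝ) ≤ X) ∧ (∀ i, 1 ≤ p.2 i ∧ (p.2 i : ℝ) ≤ X) ∧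
    ∀ j ∈ Finset.Icc 1 k, ∑ i, p.1 i ^ j = ∑ i, p.2 i ^ j}

namespace Vino
open Finset MeasureTheory

noncomputable def e (x : ℝ) : ℂ := Complex.exp ((2 * Real.pi * x : ℝ) * Complex.I)

lemma norm_e (x : ℝ) : ‖e x‖ = 1 := Complex.norm_exp_ofReal_mul_I _
lemma e_add (x y : ℝ) : e (x + y) = e x * e y := by
  unfold e; rw [← Complex.exp_add]; congr 1; push_cast; ring
lemma e_neg (x : ℝ) : e (-x) = (starRingEnd ℂ) (e x) := by
  unfold e; rw [← Complex.exp_conj]; congr 1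
  rw [map_mul, Complex.conj_ofReal, Complex.conj_I]; push_cast; ring
lemma e_int (n : ℤ) : e n = 1 := by
  unfold e; rw [Complex.exp_eq_one_iff]; exact ⟨n, by push_cast; ring⟩
lemma e_zero : e 0 = 1 := by simp [e]
lemma e_add_int (x : ℝ) (n : ℤ) : e (x + n) = e x := by rw [e_add, e_int, mul_one]
@[fun_prop] lemma continuous_e : Continuous e := by unfold e; fun_prop
lemma e_sum {ι : Type*} (s : Finset ι) (g : ι → ℝ) : e (∑ i ∈ s, g i) = ∏ i ∈ s, e (g i) := by
  classical
  induction s using Finset.induction_on with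
  | empty => simp [e_zero]
  | insert a s ha ih => rw [sum_insert ha, prod_insert ha, e_add, ih]
lemma e_sub_le (x y : ℝ) : ‖e x - e y‖ ≤ 2 * Real.pi * |x - y| := by
  have h1 : e x - e y = e y * (e (x - y) - 1) := by
    rw [mul_sub, ← e_add]; simp
  rw [h1, norm_mul, norm_e, one_mul]
  unfold e
  have := Real.norm_exp_I_mul_ofReal_sub_one_le (x := 2 * Real.pi * (x - y))
  rw [mul_comm Complex.I] at this
  refine this.trans ?_
  rw [Real.norm_eq_abs, abs_mul, abs_of_pos (by positivity : (0:ℝ) < 2 * Real.pi)]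

/-- the linear phase -/
noncomputable def ph {k : ℕ} (α : Fin k → ℝ) (v : Fin k → ℤ) : ℝ := ∑ i, α i * v i

lemma ph_add {k : ℕ} (α : Fin k → ℝ) (v w : Fin k → ℤ) : ph α (v + w) = ph α v + ph α w := by
  simp [ph, mul_add, sum_add_distrib]
lemma ph_sum {k : ℕ} {ι : Type*} (s : Finset ι) (α : Fin k → ℝ) (v : ι → Fin k → ℤ) :
    ph α (∑ i ∈ s, v i) = ∑ i ∈ s, ph α (v i) := by
  simp [ph, mul_sum]; rw [sum_comm]

noncomputable def S {k : ℕ} {ι : Type*} (Ω : Finset ι) (φ : ι → Fin k → ℤ) (α : Fin k → ℝ) : ℂ :=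
  ∑ x ∈ Ω, e (ph α (φ x))

@[fun_prop] lemma continuous_S {k : ℕ} {ι : Type*} (Ω : Finset ι) (φ : ι → Fin k → ℤ) :
    Continuous (S Ω φ) := by
  unfold S ph; fun_prop

lemma norm_S_le {k : ℕ} {ι : Type*} (Ω : Finset ι) (φ : ι → Fin k → ℤ) (α : Fin k → ℝ) :
    ‖S Ω φ α‖ ≤ #Ω := by
  unfold S
  refine (norm_sum_le _ _).trans ?_
  simp [norm_e]

open Classical in
noncomputable def cnt {k : ℕ} {ι : Type*} (Ω : Finset ι) (φ : ι → Fin k → ℤ) : ℕ :=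
  #{z ∈ Ω ×ˢ Ω | φ z.1 = φ z.2}

/-- unit cube measure -/
noncomputable def μ (k : ℕ) (c : ℝ) : Measure (Fin k → ℝ) :=
  volume.restrict (Set.Icc (fun _ => c) (fun _ => c + 1))

lemma μ_eq (k : ℕ) (c : ℝ) : μ k c = Measure.pi (fun _ : Fin k => volume.restrict (Set.Icc c (c+1))) := by
  unfold μ
  rw [← Set.pi_univ_Icc, volume_pi, Measure.restrict_pi_pi]

lemma integrable_of_cont {k : ℕ} (c : ℝ) {E : Type*} [NormedAddCommGroup E] {g : (Fin k → ℝ) → E}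
    (hg : Continuous g) : Integrable g (μ k c) :=
  (hg.continuousOn).integrableOn_compact isCompact_Icc

lemma int_e (c : ℝ) (n : ℤ) : ∫ x in Set.Icc c (c+1), e (x * n) = if n = 0 then 1 else 0 := by
  rw [integral_Icc_eq_integral_Ioc, ← intervalIntegral.integral_of_le (by linarith)]
  split_ifs with h
  · subst h; simp [e_zero]
  · have hn : (n : ℂ) ≠ 0 := by exact_mod_cast h
    have h2 : ∀ x : ℝ, e (x * n) = Complex.exp ((2 * Real.pi * Complex.I * n) * x) := by
      intro x; unfold e; congr 1; push_cast; ring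
    simp_rw [h2]
    rw [integral_exp_mul_complex (by simp [hn, Real.pi_ne_zero])]
    have : Complex.exp ((2 * Real.pi * Complex.I * n) * ((c + 1 : ℝ) : ℂ))
      = Complex.exp ((2 * Real.pi * Complex.I * n) * (c : ℂ)) := by
      rw [Complex.exp_eq_exp_iff_exists_int]
      exact ⟨n, by push_cast; ring⟩
    rw [this]; simp

lemma int_ph {k : ℕ} (c : ℝ) (v : Fin k → ℤ) : ∫ α, e (ph α v) ∂(μ k c) = if v = 0 then 1 else 0 := by
  rw [μ_eq]
  unfold ph
  simp_rw [e_sum]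
  rw [integral_fintype_prod_eq_prod (f := fun i x => e (x * (v i : ℝ)))]
  simp_rw [int_e]
  split_ifs with h
  · subst h; simp
  · obtain ⟨i, hi⟩ := Function.ne_iff.mp h
    exact prod_eq_zero (mem_univ i) (by simpa using hi)

lemma norm_sq_S {k : ℕ} {ι : Type*} (Ω : Finset ι) (φ : ι → Fin k → ℤ) (α : Fin k → ℝ) :
    ((‖S Ω φ α‖ ^ 2 : ℝ) : ℂ) = ∑ z ∈ Ω ×ˢ Ω, e (ph α (φ z.1 - φ z.2)) := by
  rw [← Complex.normSq_eq_norm_sq, ← Complex.mul_conj]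
  unfold S
  rw [map_sum, sum_mul_sum, sum_product]
  refine sum_congr rfl fun x _ => sum_congr rfl fun y _ => ?_
  rw [← e_neg, ← e_add]; congr 1
  simp [ph, mul_sub]; ring

lemma orth {k : ℕ} {ι : Type*} (c : ℝ) (Ω : Finset ι) (φ : ι → Fin k → ℤ) :
    ∫ α, ‖S Ω φ α‖ ^ 2 ∂(μ k c) = cnt Ω φ := by
  have h : ((∫ α, ‖S Ω φ α‖ ^ 2 ∂(μ k c) : ℝ) : ℂ) = cnt Ω φ := by
    rw [← integral_complex_ofReal]
    simp_rw [norm_sq_S]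
    rw [integral_finsetSum]
    · simp_rw [int_ph]
      simp [cnt, sub_eq_zero]
    · intro z _
      apply integrable_of_cont
      unfold ph; fun_prop
  exact_mod_cast h

lemma cnt_le_of_inj {k k' : ℕ} {ι ι' : Type*} {Ω : Finset ι} {Ω' : Finset ι'} {φ : ι → Fin k → ℤ}
    {φ' : ι' → Fin k' → ℤ} (g : ι → ι') (hg : ∀ x ∈ Ω, g x ∈ Ω') (hi : Set.InjOn g Ω)
    (h : ∀ x ∈ Ω, ∀ y ∈ Ω, φ x = φ y → φ' (g x) = φ' (g y)) : cnt Ω φ ≤ cnt Ω' φ' := by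
  classical
  unfold cnt
  refine card_le_card_of_injOn (fun z => (g z.1, g z.2)) ?_ ?_
  · intro z hz
    simp only [coe_filter, mem_product, Set.mem_ofPred_eq] at hz ⊢
    exact ⟨⟨hg _ hz.1.1, hg _ hz.1.2⟩, h _ hz.1.1 _ hz.1.2 hz.2⟩
  · intro z hz w hw hzw
    simp only [coe_filter, mem_product, Set.mem_ofPred_eq] at hz hw
    simp only [Prod.mk.injEq] at hzw
    exact Prod.ext (hi hz.1.1 hw.1.1 hzw.1) (hi hz.1.2 hw.1.2 hzw.2)

lemma cnt_mono {k : ℕ} {ι : Type*} {Ω Ω' : Finset ι} {φ : ι → Fin k → ℤ} (h : Ω ⊆ Ω') :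
    cnt Ω φ ≤ cnt Ω' φ :=
  cnt_le_of_inj id (fun _ hx => h hx) (Set.injOn_id _) (fun _ _ _ _ h => h)

lemma cnt_eq_sum {k : ℕ} {ι : Type*} (Ω : Finset ι) (φ : ι → Fin k → ℤ) (W : Finset (Fin k → ℤ))
    (hW : ∀ x ∈ Ω, φ x ∈ W) : cnt Ω φ = ∑ v ∈ W, #{x ∈ Ω | φ x = v} ^ 2 := by
  unfold cnt
  rw [filter_congr_decidable]
  rw [card_eq_sum_card_fiberwise (f := fun z => φ z.1) (t := W)]
  · refine sum_congr rfl fun v _ => ?_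
    rw [sq, ← card_product]
    congr 1
    ext z; simp only [mem_filter, mem_product]
    constructor
    · rintro ⟨⟨⟨a, b⟩, c⟩, d⟩; exact ⟨⟨a, d⟩, b, c ▸ d⟩
    · rintro ⟨⟨a, d⟩, b, c⟩; exact ⟨⟨⟨a, b⟩, d.trans c.symm⟩, d⟩
  · intro z hz
    simp only [coe_filter, mem_product, Set.mem_ofPred_eq] at hz
    exact hW _ hz.1.1

lemma cnt_class {k : ℕ} {ι κ : Type*} [DecidableEq κ] (Ω : Finset ι) (φ : ι → Fin k → ℤ) (ρ : ι → κ) (B : ℕ)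
    (hB : ∀ v, #(image ρ {x ∈ Ω | φ x = v}) ≤ B) :
    cnt Ω φ ≤ B * ∑ c ∈ image ρ Ω, cnt {x ∈ Ω | ρ x = c} φ := by
  have h1 := cnt_eq_sum Ω φ (image φ Ω) (fun x hx => mem_image_of_mem _ hx)
  have h2 : ∀ c, cnt {x ∈ Ω | ρ x = c} φ = ∑ v ∈ image φ Ω, #{x ∈ {x ∈ Ω | ρ x = c} | φ x = v} ^ 2 :=
    fun c => cnt_eq_sum _ φ (image φ Ω) (fun x hx => mem_image_of_mem _ (mem_filter.mp hx).1)
  rw [h1]; simp_rw [h2]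
  rw [sum_comm, mul_sum]
  refine sum_le_sum fun v _ => ?_
  have h3 : #{x ∈ Ω | φ x = v} = ∑ c ∈ image ρ {x ∈ Ω | φ x = v}, #{x ∈ {x ∈ Ω | ρ x = c} | φ x = v} := by
    rw [card_eq_sum_card_fiberwise (f := ρ) (t := image ρ {x ∈ Ω | φ x = v})]
    · refine sum_congr rfl fun c _ => ?_
      congr 1; ext x; simp only [mem_filter]; tauto
    · intro x hx; exact mem_coe.mpr (mem_image_of_mem _ hx)
  rw [h3]
  calc _ ≤ #(image ρ {x ∈ Ω | φ x = v}) * ∑ c ∈ image ρ {x ∈ Ω | φ x = v}, #{x ∈ {x ∈ Ω | ρ x = c} | φ x = v} ^ 2 :=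
        sq_sum_le_card_mul_sum_sq
    _ ≤ B * ∑ c ∈ image ρ Ω, #{x ∈ {x ∈ Ω | ρ x = c} | φ x = v} ^ 2 := by
        refine Nat.mul_le_mul (hB v) (sum_le_sum_of_subset ?_)
        exact image_subset_image (filter_subset _ _)

/-- product structure -/
lemma S_prod {k : ℕ} {ι ι' : Type*} (Ω : Finset ι) (Ω' : Finset ι') (φ : ι → Fin k → ℤ)
    (φ' : ι' → Fin k → ℤ) (α : Fin k → ℝ) :
    S (Ω ×ˢ Ω') (fun z => φ z.1 + φ' z.2) α = S Ω φ α * S Ω' φ' α := by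
  unfold S; rw [sum_mul_sum, sum_product]
  simp [ph_add, e_add]

lemma S_pi {k u : ℕ} {ι : Type*} (A : Fin u → Finset ι) (φ : ι → Fin k → ℤ) (α : Fin k → ℝ) :
    S (Fintype.piFinset A) (fun x => ∑ i, φ (x i)) α = ∏ i, S (A i) φ α := by
  unfold S; rw [prod_univ_sum]
  simp [ph_sum, e_sum]

lemma S_pow {k u : ℕ} {ι : Type*} (A : Finset ι) (φ : ι → Fin k → ℤ) (α : Fin k → ℝ) :
    S (Fintype.piFinset fun _ : Fin u => A) (fun x => ∑ i, φ (x i)) α = S A φ α ^ u := by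
  rw [S_pi]; simp

/-- Hölder with given upper bounds -/
lemma holder {k : ℕ} (c : ℝ) {A B : (Fin k → ℝ) → ℝ} (hA : Continuous A) (hB : Continuous B)
    (hA0 : ∀ x, 0 ≤ A x) (hB0 : ∀ x, 0 ≤ B x) {a b θ : ℝ} (ha : 0 < a) (hb : 0 < b)
    (h0 : 0 ≤ θ) (h1 : θ ≤ 1) (hIA : ∫ x, A x ∂(μ k c) ≤ a) (hIB : ∫ x, B x ∂(μ k c) ≤ b) :
    ∫ x, A x ^ θ * B x ^ (1 - θ) ∂(μ k c) ≤ a ^ θ * b ^ (1 - θ) := by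
  have hθ : 0 ≤ 1 - θ := by linarith
  have key : ∀ x, A x ^ θ * B x ^ (1 - θ) ≤
      a ^ θ * b ^ (1 - θ) * (θ / a * A x + (1 - θ) / b * B x) := by
    intro x
    have := Real.geom_mean_le_arith_mean2_weighted h0 hθ (div_nonneg (hA0 x) ha.le)
      (div_nonneg (hB0 x) hb.le) (by ring)
    rw [Real.div_rpow (hA0 x) ha.le, Real.div_rpow (hB0 x) hb.le] at this
    have ha' : 0 < a ^ θ := Real.rpow_pos_of_pos ha _
    have hb' : 0 < b ^ (1 - θ) := Real.rpow_pos_of_pos hb _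
    calc A x ^ θ * B x ^ (1 - θ) = a ^ θ * b ^ (1 - θ) * (A x ^ θ / a ^ θ * (B x ^ (1 - θ) / b ^ (1 - θ))) := by
          field_simp
      _ ≤ a ^ θ * b ^ (1 - θ) * (θ * (A x / a) + (1 - θ) * (B x / b)) := by gcongr
      _ = _ := by ring
  calc _ ≤ ∫ x, a ^ θ * b ^ (1 - θ) * (θ / a * A x + (1 - θ) / b * B x) ∂(μ k c) := by
        refine integral_mono (integrable_of_cont c ?_) (integrable_of_cont c (by fun_prop)) key
        exact (hA.rpow_const (fun x => Or.inr h0)).mul (hB.rpow_const (fun x => Or.inr hθ))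
    _ = a ^ θ * b ^ (1 - θ) * (θ / a * ∫ x, A x ∂(μ k c) + (1 - θ) / b * ∫ x, B x ∂(μ k c)) := by
        rw [integral_const_mul, integral_add ((integrable_of_cont c hA).const_mul _) ((integrable_of_cont c hB).const_mul _),
          integral_const_mul, integral_const_mul]
    _ ≤ a ^ θ * b ^ (1 - θ) * (θ / a * a + (1 - θ) / b * b) := by gcongr
    _ = _ := by field_simp; ring

/-- the moment curve -/
def pv (k : ℕ) (n : ℤ) : Fin k → ℤ := fun i => n ^ ((i : ℕ) + 1)

/-- the count -/
noncomputable def Jn (s k N : ℕ) : ℕ :=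
  cnt (Fintype.piFinset fun _ : Fin s => Icc (1:ℤ) N) (fun x => ∑ i, pv k (x i))

lemma Jn_eq (s k N : ℕ) (c : ℝ) :
    ∫ α, ‖S (Icc (1:ℤ) N) (pv k) α‖ ^ (2 * s) ∂(μ k c) = Jn s k N := by
  unfold Jn
  rw [← orth c]
  simp_rw [S_pow, norm_pow, ← pow_mul, mul_comm s 2]

end Vino

namespace Vino
open Finset MeasureTheory

noncomputable def es {σ : Type*} [Fintype σ] (z : σ → ℂ) (j : ℕ) : ℂ :=
  ∑ t ∈ powersetCard j (univ : Finset σ), ∏ i ∈ t, z i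

lemma newton {σ : Type*} [Fintype σ] (z : σ → ℂ) (k : ℕ) :
    (k : ℂ) * es z k = (-1) ^ (k + 1) *
      ∑ a ∈ antidiagonal k with a.1 < k, (-1) ^ a.1 * es z a.1 * ∑ i, z i ^ a.2 := by
  classical
  have h := congrArg (MvPolynomial.aeval z) (MvPolynomial.mul_esymm_eq_sum σ ℂ k)
  simpa [MvPolynomial.esymm, MvPolynomial.psum, es] using h

lemma es_zero {σ : Type*} [Fintype σ] (z : σ → ℂ) : es z 0 = 1 := by simp [es]

lemma psum_bound {σ : Type*} [Fintype σ] (z : σ → ℂ) (δ : ℝ) (hδ1 : δ ≤ 1)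
    (h : ∑ i, ‖z i‖ ^ 2 ≤ δ * ‖∑ i, z i‖ ^ 2) (b : ℕ) (hb : 2 ≤ b) :
    ‖∑ i, z i ^ b‖ ≤ δ * ‖∑ i, z i‖ ^ b := by
  obtain ⟨d, rfl⟩ := Nat.exists_eq_add_of_le hb
  set Z := ‖∑ i, z i‖
  have hz : ∀ i, ‖z i‖ ≤ Z := by
    intro i
    have h1 : ‖z i‖ ^ 2 ≤ ∑ i, ‖z i‖ ^ 2 :=
      single_le_sum (f := fun i => ‖z i‖ ^ 2) (fun i _ => by positivity) (mem_univ i)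
    have h2 : ‖z i‖ ^ 2 ≤ Z ^ 2 := by nlinarith [sq_nonneg Z]
    exact le_of_sq_le_sq h2 (norm_nonneg _)
  calc ‖∑ i, z i ^ (2 + d)‖ ≤ ∑ i, ‖z i ^ (2 + d)‖ := norm_sum_le _ _
    _ ≤ ∑ i, ‖z i‖ ^ 2 * Z ^ d := by
        refine sum_le_sum fun i _ => ?_
        rw [norm_pow, pow_add]
        gcongr
        exact hz i
    _ = (∑ i, ‖z i‖ ^ 2) * Z ^ d := by rw [sum_mul]
    _ ≤ δ * Z ^ 2 * Z ^ d := by gcongr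
    _ = _ := by ring

lemma es_approx (k : ℕ) : ∃ C : ℝ, 0 ≤ C ∧ ∀ j ≤ k, ∀ (σ : Type) [Fintype σ] (z : σ → ℂ) (δ : ℝ),
    0 ≤ δ → δ ≤ 1 → ∑ i, ‖z i‖ ^ 2 ≤ δ * ‖∑ i, z i‖ ^ 2 →
    ‖(j.factorial : ℂ) * es z j - (∑ i, z i) ^ j‖ ≤ C * δ * ‖∑ i, z i‖ ^ j := by
  induction k with
  | zero =>
    refine ⟨0, le_rfl, ?_⟩
    intro j hj σ _ z δ h0 h1 h
    obtain rfl : j = 0 := by omega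
    simp [es_zero]
  | succ k ih =>
    obtain ⟨C, hC, ih⟩ := ih
    refine ⟨C + k * (k.factorial * (1 + C)), by positivity, ?_⟩
    intro j hj σ _ z δ h0 h1 h
    set Z := ∑ i, z i with hZ
    rcases Nat.lt_or_ge j (k+1) with hj' | hj'
    · refine (ih j (by omega) σ z δ h0 h1 h).trans ?_
      gcongr
      have : 0 ≤ (k:ℝ) * (k.factorial * (1 + C)) := by positivity
      linarith
    · obtain rfl : j = k + 1 := by omega
      have hn := newton z (k+1)
      have hset : {a ∈ antidiagonal (k+1) | a.1 < k + 1} =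
          insert (k, 1) ((range k).image fun a => (a, k + 1 - a)) := by
        ext ⟨a, b⟩
        simp only [mem_filter, HasAntidiagonal.mem_antidiagonal, mem_insert, mem_image, mem_range, Prod.mk.injEq]
        constructor
        · rintro ⟨h1, h2⟩
          by_cases hk : a = k
          · left; omega
          · right; exact ⟨a, by omega, rfl, by omega⟩
        · rintro (⟨rfl, rfl⟩ | ⟨c, h1, rfl, rfl⟩) <;> omega
      rw [hset, sum_insert (by simp), sum_image (by intro a _ b _ hab; simpa using (Prod.ext_iff.mp hab).1)] at hn
      simp only [pow_one] at hn
      have hsgn : ((-1:ℂ)) ^ (k + 1 + 1) * (-1) ^ k = 1 := by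
        rw [← pow_add]; exact Even.neg_one_pow ⟨k+1, by ring⟩
      have e1 : ((k+1).factorial : ℂ) * es z (k+1) - Z ^ (k+1) =
          ((k.factorial : ℂ) * es z k - Z ^ k) * Z +
          (-1) ^ (k+1+1) * ∑ a ∈ range k, (k.factorial : ℂ) * ((-1) ^ a * es z a * ∑ i, z i ^ (k + 1 - a)) := by
        rw [Nat.factorial_succ, ← mul_sum]
        push_cast at hn ⊢
        rw [mul_comm ((k:ℂ)+1), mul_assoc, hn, mul_add]
        rw [show (-1:ℂ) ^ (k + 1 + 1) * ((-1) ^ k * es z k * ∑ i, z i) = ((-1:ℂ) ^ (k + 1 + 1) * (-1) ^ k) * (es z k * Z) by ring, hsgn]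
        ring
      rw [e1]
      refine (norm_add_le _ _).trans ?_
      rw [norm_mul, norm_mul, norm_pow, norm_neg, norm_one, one_pow, one_mul]
      have t1 : ‖(k.factorial : ℂ) * es z k - Z ^ k‖ * ‖Z‖ ≤ C * δ * ‖Z‖ ^ (k+1) := by
        rw [pow_succ, ← mul_assoc]
        gcongr
        exact ih k le_rfl σ z δ h0 h1 h
      have t2 : ∀ a ∈ range k, ‖(k.factorial : ℂ) * ((-1) ^ a * es z a * ∑ i, z i ^ (k + 1 - a))‖ ≤
          (k.factorial * (1 + C)) * δ * ‖Z‖ ^ (k+1) := by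
        intro a ha
        rw [mem_range] at ha
        have b1 : ‖es z a‖ ≤ (1 + C) * ‖Z‖ ^ a := by
          have := ih a ha.le σ z δ h0 h1 h
          have b2 : ‖(a.factorial : ℂ) * es z a‖ ≤ C * δ * ‖Z‖ ^ a + ‖Z‖ ^ a := by
            calc _ = ‖((a.factorial : ℂ) * es z a - Z ^ a) + Z ^ a‖ := by ring_nf
              _ ≤ _ := (norm_add_le _ _).trans (by rw [norm_pow]; gcongr)
          have b3 : ‖es z a‖ ≤ ‖(a.factorial : ℂ) * es z a‖ := by
            rw [norm_mul, Complex.norm_natCast]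
            refine le_mul_of_one_le_left (norm_nonneg _) ?_
            exact_mod_cast Nat.factorial_pos a
          refine b3.trans (b2.trans ?_)
          have : C * δ * ‖Z‖ ^ a ≤ C * 1 * ‖Z‖ ^ a := by gcongr
          linarith
        have b4 := psum_bound z δ h1 h (k+1-a) (by omega)
        rw [norm_mul, norm_mul, norm_mul, norm_pow, norm_neg, norm_one, one_pow, one_mul, Complex.norm_natCast]
        calc (k.factorial : ℝ) * (‖es z a‖ * ‖∑ i, z i ^ (k + 1 - a)‖) ≤
            k.factorial * (((1 + C) * ‖Z‖ ^ a) * (δ * ‖Z‖ ^ (k+1-a))) := by gcongr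
          _ = k.factorial * (1 + C) * δ * (‖Z‖ ^ a * ‖Z‖ ^ (k+1-a)) := by ring
          _ = _ := by rw [← pow_add]; congr 2; omega
      have t3 : ‖∑ a ∈ range k, (k.factorial : ℂ) * ((-1) ^ a * es z a * ∑ i, z i ^ (k + 1 - a))‖ ≤
          k * ((k.factorial * (1 + C)) * δ * ‖Z‖ ^ (k+1)) := by
        refine (norm_sum_le_of_le _ t2).trans ?_
        simp
      calc _ ≤ C * δ * ‖Z‖ ^ (k+1) + k * ((k.factorial * (1 + C)) * δ * ‖Z‖ ^ (k+1)) := add_le_add t1 t3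
        _ = _ := by ring

open Classical in
lemma inj_eq {σ : Type*} [Fintype σ] (z : σ → ℂ) (k : ℕ) :
    ∑ f : Fin k → σ with Function.Injective f, ∏ i, z (f i) = (k.factorial : ℂ) * es z k := by
  unfold es
  rw [mul_sum, ← sum_fiberwise_of_maps_to (g := fun f : Fin k → σ => image f univ) (t := powersetCard k univ)]
  · refine sum_congr rfl fun t ht => ?_
    rw [mem_powersetCard] at ht
    have : ∀ f ∈ ({f ∈ {f : Fin k → σ | Function.Injective f} | image f univ = t} : Finset _), ∏ i, z (f i) = ∏ i ∈ t, z i := by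
      intro f hf
      simp only [mem_filter, mem_univ, true_and] at hf
      rw [← hf.2, prod_image (fun a _ b _ h => hf.1 h)]
    rw [sum_congr rfl this, sum_const, nsmul_eq_mul]
    congr 2
    have hc : Fintype.card (Fin k ≃ t) = k.factorial := by
      rw [Fintype.card_equiv (Fintype.equivOfCardEq (by simp [ht.2]))]; simp
    rw [← hc, ← Finset.card_univ]
    symm
    refine card_bij (fun g _ => fun i => (g i : σ)) ?_ ?_ ?_
    · intro g _
      simp only [mem_filter, mem_univ, true_and]
      refine ⟨Subtype.val_injective.comp g.injective, ?_⟩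
      ext x; simp only [mem_image, mem_univ, true_and]
      constructor
      · rintro ⟨i, rfl⟩; exact (g i).2
      · intro hx; exact ⟨g.symm ⟨x, hx⟩, by simp⟩
    · intro g _ g' _ h
      ext i; exact congrFun h i
    · intro f hf
      simp only [mem_filter, mem_univ, true_and] at hf
      have hm : ∀ i, f i ∈ t := fun i => hf.2 ▸ mem_image_of_mem _ (mem_univ i)
      refine ⟨Equiv.ofBijective (fun i => ⟨f i, hm i⟩) ⟨?_, ?_⟩, mem_univ _, ?_⟩
      · intro a b hab; exact hf.1 (by simpa using hab)
      · rintro ⟨x, hx⟩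
        rw [← hf.2] at hx
        obtain ⟨i, _, rfl⟩ := mem_image.mp hx
        exact ⟨i, rfl⟩
      · rfl
  · intro f hf
    simp only [mem_filter, mem_univ, true_and] at hf
    rw [mem_powersetCard]
    exact ⟨subset_univ _, by rw [card_image_of_injective _ hf]; simp⟩

open Classical in
lemma dichotomy (k : ℕ) : ∃ C : ℝ, 1 ≤ C ∧ ∀ (σ : Type) [Fintype σ] (z : σ → ℂ),
    ‖∑ i, z i‖ ^ (2 * k) ≤ C * ‖∑ f : Fin k → σ with Function.Injective f, ∏ i, z (f i)‖ ^ 2 ∨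
    ‖∑ i, z i‖ ^ (2 * k) ≤ C * (∑ i, ‖z i‖ ^ 2) ^ k := by
  obtain ⟨C, hC, h⟩ := es_approx k
  refine ⟨4 + (2 * (C + 1)) ^ k, by have : 0 ≤ (2 * (C+1))^k := by positivity
                                    linarith, ?_⟩
  intro σ _ z
  have hp : 0 ≤ (2 * (C+1))^k := by positivity
  set Z := ∑ i, z i
  by_cases hs : ∑ i, ‖z i‖ ^ 2 ≤ 1 / (2 * (C + 1)) * ‖Z‖ ^ 2
  · left
    have h1 := h k le_rfl σ z (1 / (2 * (C + 1))) (by positivity)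
      (by rw [div_le_one (by positivity)]; linarith) hs
    rw [inj_eq]
    set E := (k.factorial : ℂ) * es z k
    have h2 : C * (1 / (2 * (C + 1))) ≤ 1 / 2 := by
      rw [mul_one_div, div_le_div_iff₀ (by positivity) (by norm_num)]; linarith
    have h3 : ‖E - Z ^ k‖ ≤ 1/2 * ‖Z‖ ^ k := h1.trans (by gcongr)
    have h4 : ‖Z‖ ^ k ≤ 2 * ‖E‖ := by
      have : ‖Z ^ k‖ ≤ ‖E‖ + ‖E - Z ^ k‖ := by
        calc ‖Z ^ k‖ = ‖E - (E - Z ^ k)‖ := by ring_nf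
          _ ≤ _ := norm_sub_le _ _
      rw [norm_pow] at this
      linarith
    calc ‖Z‖ ^ (2 * k) = (‖Z‖ ^ k) ^ 2 := by ring
      _ ≤ (2 * ‖E‖) ^ 2 := by gcongr
      _ = 4 * ‖E‖ ^ 2 := by ring
      _ ≤ _ := by gcongr; linarith
  · right
    push Not at hs
    have h5 : ‖Z‖ ^ 2 ≤ 2 * (C + 1) * ∑ i, ‖z i‖ ^ 2 := by
      rw [one_div, inv_mul_lt_iff₀ (by positivity)] at hs
      exact hs.le
    calc ‖Z‖ ^ (2 * k) = (‖Z‖ ^ 2) ^ k := by ring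
      _ ≤ (2 * (C + 1) * ∑ i, ‖z i‖ ^ 2) ^ k := by gcongr
      _ = (2 * (C + 1)) ^ k * (∑ i, ‖z i‖ ^ 2) ^ k := mul_pow _ _ _
      _ ≤ _ := by gcongr; linarith
end Vino

namespace Vino
open Finset MeasureTheory

lemma esymm_eq_of_psum {R : Type*} [CommRing R] {k : ℕ} (Y Z : Fin k → R)
    (hu : ∀ j, 1 ≤ j → j ≤ k → IsUnit (j : R))
    (h : ∀ j, 1 ≤ j → j ≤ k → ∑ i, Y i ^ j = ∑ i, Z i ^ j) (j : ℕ) (hj : j ≤ k) :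
    MvPolynomial.aeval Y (MvPolynomial.esymm (Fin k) R j) =
      MvPolynomial.aeval Z (MvPolynomial.esymm (Fin k) R j) := by
  induction j using Nat.strong_induction_on with
  | _ j ih =>
    rcases Nat.eq_zero_or_pos j with rfl | hj0
    · simp [MvPolynomial.esymm]
    · have hn := MvPolynomial.mul_esymm_eq_sum (Fin k) R j
      have h1 := congrArg (MvPolynomial.aeval Y) hn
      have h2 := congrArg (MvPolynomial.aeval Z) hn
      refine (hu j hj0 hj).mul_left_cancel ?_
      simp only [map_mul, map_natCast, map_sum, map_pow, map_neg, map_one, MvPolynomial.psum, MvPolynomial.aeval_X] at h1 h2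
      rw [h1, h2]
      congr 1
      refine sum_congr rfl fun a ha => ?_
      rw [mem_filter, HasAntidiagonal.mem_antidiagonal] at ha
      rw [ih a.1 ha.2 (by omega), h a.2 (by omega) (by omega)]

lemma prod_sub_eq_zero {R : Type*} [CommRing R] {k : ℕ} (Y Z : Fin k → R)
    (hu : ∀ j, 1 ≤ j → j ≤ k → IsUnit (j : R))
    (h : ∀ j, 1 ≤ j → j ≤ k → ∑ i, Y i ^ j = ∑ i, Z i ^ j) (i : Fin k) :
    ∏ j, (Z i - Y j) = 0 := by
  have key : ∀ W : Fin k → R, ∏ j, (Z i - W j) = ∑ j ∈ range (k + 1), (-1) ^ j *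
      (MvPolynomial.aeval W (MvPolynomial.esymm (Fin k) R j) * Z i ^ (k - j)) := by
    intro W
    have := congrArg (Polynomial.eval (Z i)) (Multiset.prod_X_sub_X_eq_sum_esymm (univ.val.map W))
    simp only [Multiset.map_map, Function.comp_def, Multiset.card_map, card_val, Finset.card_univ, Fintype.card_fin] at this
    rw [Polynomial.eval_finsetSum] at this
    simp only [Polynomial.eval_mul, Polynomial.eval_pow, Polynomial.eval_neg, Polynomial.eval_one,
      Polynomial.eval_C, Polynomial.eval_X, ← MvPolynomial.aeval_esymm_eq_multiset_esymm (Fin k) R] at this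
    rw [← this]
    change _ = Polynomial.eval (Z i) (∏ j, (Polynomial.X - Polynomial.C (W j)))
    rw [Polynomial.eval_prod]; simp
  rw [key Y]
  rw [sum_congr rfl (fun j hj => by rw [esymm_eq_of_psum Y Z hu h j (by rw [mem_range] at hj; omega)]), ← key Z]
  exact prod_eq_zero (mem_univ i) (sub_self _)

lemma uniq {p k m : ℕ} (hp : p.Prime) (hk : k < p) (y z : Fin k → ℤ)
    (hy : ∀ i j, i ≠ j → ¬ (p : ℤ) ∣ y i - y j)
    (h : ∀ j, 1 ≤ j → j ≤ k → ∑ i, y i ^ j ≡ ∑ i, z i ^ j [ZMOD (p ^ m : ℕ)]) (i : Fin k) :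
    ∃ j, ((p : ℤ) ^ m) ∣ z i - y j := by
  rcases Nat.eq_zero_or_pos m with rfl | hm
  · exact ⟨i, by simp⟩
  have h0 := prod_sub_eq_zero (R := ZMod (p ^ m)) (fun i => (y i : ZMod (p^m))) (fun i => (z i : ZMod (p^m)))
    (fun j h1 h2 => by
      rw [ZMod.isUnit_iff_coprime]
      refine Nat.Coprime.pow_right _ ?_
      rw [Nat.coprime_comm, Nat.Prime.coprime_iff_not_dvd hp]
      exact fun hd => by have := Nat.le_of_dvd (by omega) hd; omega)
    (fun j h1 h2 => by
      have := (ZMod.intCast_eq_intCast_iff _ _ _).mpr (h j h1 h2)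
      push_cast at this
      exact this) i
  have h1 : ((p ^ m : ℕ) : ℤ) ∣ ∏ j, (z i - y j) := by
    rw [← ZMod.intCast_zmod_eq_zero_iff_dvd]
    push_cast; exact h0
  push_cast at h1
  have hpi : Prime (p : ℤ) := Nat.prime_iff_prime_int.mp hp
  obtain ⟨j0, -, hj0⟩ := (hpi.dvd_finsetProd_iff _).mp ((dvd_pow_self (p:ℤ) (by omega)).trans h1)
  refine ⟨j0, ?_⟩
  rw [← mul_prod_erase univ _ (mem_univ j0)] at h1
  refine IsCoprime.dvd_of_dvd_mul_right ?_ h1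
  refine IsCoprime.pow_left (IsCoprime.prod_right fun j hj => ?_)
  rw [Prime.coprime_iff_not_dvd hpi]
  intro hd
  refine hy j j0 (ne_of_mem_erase hj) ?_
  have := dvd_sub hj0 hd
  simpa using this

lemma shift_psum {R : Type*} [CommRing R] {n k : ℕ} (x y : Fin n → R) (c : R)
    (h : ∀ j, 1 ≤ j → j ≤ k → ∑ i, x i ^ j = ∑ i, y i ^ j) (j : ℕ) (hj : j ≤ k) :
    ∑ i, (x i + c) ^ j = ∑ i, (y i + c) ^ j := by
  have key : ∀ w : Fin n → R, ∑ i, (w i + c) ^ j = ∑ m ∈ range (j+1), (∑ i, w i ^ m) * (c ^ (j - m) * (j.choose m)) := by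
    intro w
    simp_rw [add_pow, sum_mul]
    rw [sum_comm]
    refine sum_congr rfl fun m _ => sum_congr rfl fun i _ => by ring
  rw [key, key]
  refine sum_congr rfl fun m hm => ?_
  rw [mem_range] at hm
  rcases Nat.eq_zero_or_pos m with rfl | h0
  · simp
  · rw [h m h0 (by omega)]

lemma shift_psum_mod {n k M : ℕ} (x y : Fin n → ℤ) (c d : ℤ)
    (h : ∀ j, 1 ≤ j → j ≤ k → ∑ i, (x i - c) ^ j ≡ ∑ i, (y i - c) ^ j [ZMOD M]) (j : ℕ) (hj : j ≤ k) :
    ∑ i, (x i - d) ^ j ≡ ∑ i, (y i - d) ^ j [ZMOD M] := by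
  rw [← ZMod.intCast_eq_intCast_iff]
  push_cast
  have := shift_psum (R := ZMod M) (k := k) (fun i => (x i : ZMod M) - c) (fun i => (y i : ZMod M) - c) (c - d)
    (fun j h1 h2 => by
      have := (ZMod.intCast_eq_intCast_iff _ _ _).mpr (h j h1 h2)
      push_cast at this; exact this) j hj
  simpa using this

lemma image_two {ι κ τ : Type*} [DecidableEq κ] [DecidableEq τ] (X : Finset ι) (ρ : ι → κ) (f : ι → τ) (A B : ℕ)
    (hA : #(image f X) ≤ A) (hB : ∀ t, #(image ρ {x ∈ X | f x = t}) ≤ B) : #(image ρ X) ≤ A * B := by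
  have : image ρ X ⊆ (image f X).biUnion fun t => image ρ {x ∈ X | f x = t} := by
    intro c hc
    obtain ⟨x, hx, rfl⟩ := mem_image.mp hc
    exact mem_biUnion.mpr ⟨f x, mem_image_of_mem _ hx, mem_image_of_mem _ (mem_filter.mpr ⟨hx, rfl⟩)⟩
  refine (card_le_card this).trans ((card_biUnion_le_card_mul _ _ B fun t _ => hB t).trans ?_)
  gcongr

lemma res_card (Y : Finset ℤ) (r q : ℕ) (hr : 0 < r) (h1 : ∀ y ∈ Y, 0 ≤ y ∧ y < r * q)
    (h2 : ∀ y ∈ Y, ∀ y' ∈ Y, y ≡ y' [ZMOD r]) : #Y ≤ q := by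
  have : #Y ≤ #(Ico (0:ℤ) q) := by
    refine card_le_card_of_injOn (fun y => y / r) ?_ ?_
    · intro y hy
      obtain ⟨h3, h4⟩ := h1 y hy
      simp only [coe_Ico, Set.mem_Ico]
      exact ⟨by positivity, Int.ediv_lt_of_lt_mul (by exact_mod_cast hr) (by linarith)⟩
    · intro y hy y' hy' h
      have h3 := h2 y hy y' hy'
      rw [← Int.mul_ediv_add_emod y r, ← Int.mul_ediv_add_emod y' r]
      rw [show y / (r:ℤ) = y' / r from h, show y % (r:ℤ) = y' % r from h3]
  simpa using this

lemma vec_card {k : ℕ} (G : Finset (Fin k → ℤ)) (r q : Fin k → ℕ) (hr : ∀ j, 0 < r j)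
    (h1 : ∀ y ∈ G, ∀ j, 0 ≤ y j ∧ y j < r j * q j)
    (h2 : ∀ y ∈ G, ∀ y' ∈ G, ∀ j, y j ≡ y' j [ZMOD r j]) : #G ≤ ∏ j, q j := by
  have : G ⊆ Fintype.piFinset fun j => image (fun y => y j) G := by
    intro y hy
    rw [Fintype.mem_piFinset]
    exact fun j => mem_image_of_mem (fun y : Fin k → ℤ => y j) hy
  refine (card_le_card this).trans ?_
  rw [Fintype.card_piFinset]
  refine prod_le_prod' fun j _ => res_card _ (r j) (q j) (hr j) ?_ ?_
  · intro y hy; obtain ⟨w, hw, rfl⟩ := mem_image.mp hy; exact h1 w hw j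
  · intro y hy y' hy'
    obtain ⟨w, hw, rfl⟩ := mem_image.mp hy
    obtain ⟨w', hw', rfl⟩ := mem_image.mp hy'
    exact h2 w hw w' hw' j

lemma sum_fin_id (k : ℕ) : ∑ j : Fin k, (j : ℕ) = k * (k - 1) / 2 := by
  rw [Fin.sum_univ_eq_sum_range (fun j => j), sum_range_id]

lemma linnik {p k a b : ℕ} (hp : p.Prime) (hk : k < p) (hab : a ≤ b) (ξ η : ℤ)
    (X : Finset (Fin k → ℤ)) (h1 : ∀ x ∈ X, ∀ i, (p:ℤ) ^ a ∣ x i - ξ)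
    (h2 : ∀ x ∈ X, ∀ i j, i ≠ j → ¬ (p:ℤ) ^ (a+1) ∣ x i - x j)
    (h3 : ∀ x ∈ X, ∀ y ∈ X, ∀ j, 1 ≤ j → j ≤ k →
      ∑ i, (x i - η) ^ j ≡ ∑ i, (y i - η) ^ j [ZMOD (p ^ (j * b) : ℕ)]) :
    #(image (fun x : Fin k → ℤ => fun i => x i % (p:ℤ) ^ (k * b)) X) ≤
      p ^ (k * (k - 1) / 2 * (a + b)) * k ^ k := by
  have hp0 : 0 < p := hp.pos
  have hpz : (0:ℤ) < p := by exact_mod_cast hp0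
  have e1 : p ^ (k * (k - 1) / 2 * (a + b)) * k ^ k =
      p ^ (k * (k - 1) / 2 * b) * (p ^ (k * (k - 1) / 2 * a) * k ^ k) := by
    rw [mul_add, pow_add]; ring
  rw [e1]
  -- first map
  refine image_two X _ (fun x => fun j : Fin k => (∑ i, (x i - η) ^ ((j:ℕ)+1)) % (p ^ (k * b) : ℕ)) _ _ ?_ ?_
  · refine (vec_card _ (fun j => p ^ (((j:ℕ)+1) * b)) (fun j => p ^ ((k - 1 - j) * b)) (fun j => by positivity) ?_ ?_).trans ?_
    · intro y hy j
      obtain ⟨x, hx, rfl⟩ := mem_image.mp hy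
      refine ⟨Int.emod_nonneg _ (by positivity), ?_⟩
      refine (Int.emod_lt_of_pos _ (by positivity)).trans_le (le_of_eq ?_)
      norm_cast
      rw [← pow_add, ← add_mul]
      congr 2; have := j.2; omega
    · intro y hy y' hy' j
      obtain ⟨x, hx, rfl⟩ := mem_image.mp hy
      obtain ⟨x', hx', rfl⟩ := mem_image.mp hy'
      have hd : ((p ^ (((j:ℕ)+1) * b) : ℕ) : ℤ) ∣ (p ^ (k * b) : ℕ) := by
        rw [Int.natCast_dvd_natCast]
        exact pow_dvd_pow _ (Nat.mul_le_mul_right _ j.2)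
      have g1 := (Int.mod_modEq (∑ i, (x i - η) ^ ((j:ℕ)+1)) (p ^ (k * b) : ℕ)).of_dvd hd
      have g2 := (Int.mod_modEq (∑ i, (x' i - η) ^ ((j:ℕ)+1)) (p ^ (k * b) : ℕ)).of_dvd hd
      exact (g1.trans (h3 x hx x' hx' _ (by omega) j.2)).trans g2.symm
    · rw [prod_pow_eq_pow_sum, ← sum_mul]
      refine Nat.pow_le_pow_right hp0 (Nat.mul_le_mul_right _ (le_of_eq ?_))
      rw [← sum_fin_id]
      rw [← Equiv.sum_comp Fin.revPerm]
      refine sum_congr rfl fun j _ => ?_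
      simp [Fin.val_rev]; omega
  · intro t
    -- second map
    set X' := ({x ∈ X | (fun j : Fin k => (∑ i, (x i - η) ^ ((j:ℕ)+1)) % (p ^ (k * b) : ℕ)) = t} : Finset _) with hX'
    have hX : ∀ x ∈ X', x ∈ X := fun x hx => (mem_filter.mp hx).1
    have h4 : ∀ x ∈ X', ∀ y ∈ X', ∀ j, 1 ≤ j → j ≤ k →
        ∑ i, (x i - ξ) ^ j ≡ ∑ i, (y i - ξ) ^ j [ZMOD (p ^ (k * b) : ℕ)] := by
      intro x hx y hy j hj1 hj2
      refine shift_psum_mod x y η ξ (k := k) ?_ j hj2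
      intro j hj1 hj2
      have g1 := congrFun ((mem_filter.mp hx).2.trans (mem_filter.mp hy).2.symm) ⟨j-1, by omega⟩
      simp only at g1
      rw [show j - 1 + 1 = j by omega] at g1
      exact g1
    have hak : ∀ j, j ≤ k → a * j ≤ k * b := fun j hj => by
      rw [mul_comm]; exact Nat.mul_le_mul hj hab
    have hy1 : ∀ x ∈ X', ∀ i, x i - ξ = p ^ a * ((x i - ξ) / p ^ a) := fun x hx i =>
      (Int.mul_ediv_cancel' (h1 x (hX x hx) i)).symm
    have h5 : ∀ x ∈ X', ∀ y ∈ X', ∀ j, 1 ≤ j → j ≤ k →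
        ∑ i, ((x i - ξ) / p ^ a) ^ j ≡ ∑ i, ((y i - ξ) / p ^ a) ^ j [ZMOD (p ^ (k * b - a * j) : ℕ)] := by
      intro x hx y hy j hj1 hj2
      have g := h4 x hx y hy j hj1 hj2
      have e3 : ∀ z ∈ X', ∑ i, (z i - ξ) ^ j = ((p:ℤ) ^ a) ^ j * ∑ i, ((z i - ξ) / p ^ a) ^ j := by
        intro z hz
        rw [mul_sum]
        refine sum_congr rfl fun i _ => ?_
        rw [← mul_pow, ← hy1 z hz i]
      rw [e3 x hx, e3 y hy] at g
      have e2 : ((p ^ (k * b) : ℕ) : ℤ) = ((p:ℤ) ^ a) ^ j * ((p ^ (k * b - a * j) : ℕ) : ℤ) := by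
        push_cast
        rw [← pow_mul, ← pow_add]; congr 1; have := hak j hj2; omega
      rw [e2] at g
      exact Int.ModEq.mul_left_cancel' (pow_ne_zero _ (pow_ne_zero _ hpz.ne')) g
    refine image_two X' _ (fun x => fun j : Fin k => (∑ i, ((x i - ξ) / p ^ a) ^ ((j:ℕ)+1)) % (p ^ (k * b - a) : ℕ)) _ _ ?_ ?_
    · refine (vec_card _ (fun j => p ^ (k * b - a * ((j:ℕ)+1))) (fun j => p ^ (a * j)) (fun j => by positivity) ?_ ?_).trans ?_
      · intro y hy j
        obtain ⟨x, hx, rfl⟩ := mem_image.mp hy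
        refine ⟨Int.emod_nonneg _ (by positivity), ?_⟩
        refine (Int.emod_lt_of_pos _ (by positivity)).trans_le (le_of_eq ?_)
        norm_cast
        rw [← pow_add]
        congr 1; have := hak (j+1) j.2; rw [mul_add] at *; omega
      · intro y hy y' hy' j
        obtain ⟨x, hx, rfl⟩ := mem_image.mp hy
        obtain ⟨x', hx', rfl⟩ := mem_image.mp hy'
        have hd : ((p ^ (k * b - a * ((j:ℕ)+1)) : ℕ) : ℤ) ∣ (p ^ (k * b - a) : ℕ) := by
          rw [Int.natCast_dvd_natCast]
          exact pow_dvd_pow _ (by rw [mul_add]; omega)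
        have g1 := (Int.mod_modEq (∑ i, ((x i - ξ) / p ^ a) ^ ((j:ℕ)+1)) (p ^ (k * b - a) : ℕ)).of_dvd hd
        have g2 := (Int.mod_modEq (∑ i, ((x' i - ξ) / p ^ a) ^ ((j:ℕ)+1)) (p ^ (k * b - a) : ℕ)).of_dvd hd
        exact (g1.trans (h5 x hx x' hx' _ (by omega) j.2)).trans g2.symm
      · rw [prod_pow_eq_pow_sum, ← mul_sum, sum_fin_id, mul_comm]
    · intro t'
      set X'' := ({x ∈ X' | (fun j : Fin k => (∑ i, ((x i - ξ) / p ^ a) ^ ((j:ℕ)+1)) % (p ^ (k * b - a) : ℕ)) = t'} : Finset _) with hX''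
      rcases X''.eq_empty_or_nonempty with he | ⟨x0, hx0⟩
      · rw [he]; simp
      have hx0' := (mem_filter.mp hx0).1
      have : image (fun x : Fin k → ℤ => fun i => x i % (p:ℤ) ^ (k * b)) X'' ⊆
          image (fun σ : Fin k → Fin k => fun i => x0 (σ i) % (p:ℤ) ^ (k * b)) univ := by
        intro c hc
        obtain ⟨x, hx, rfl⟩ := mem_image.mp hc
        have hx' := (mem_filter.mp hx).1
        have hu := uniq (m := k * b - a) hp hk (fun i => (x0 i - ξ) / p ^ a) (fun i => (x i - ξ) / p ^ a)
          (fun i j hij hd => h2 x0 (hX _ hx0') i j hij (by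
            have : x0 i - x0 j = p ^ a * ((x0 i - ξ) / p ^ a - (x0 j - ξ) / p ^ a) := by
              rw [mul_sub, ← hy1 x0 hx0' i, ← hy1 x0 hx0' j]; ring
            rw [this, pow_succ]
            exact mul_dvd_mul_left _ hd))
          (fun j hj1 hj2 => by
            have g1 := congrFun ((mem_filter.mp hx0).2.trans (mem_filter.mp hx).2.symm) ⟨j-1, by omega⟩
            simp only at g1
            rw [show j - 1 + 1 = j by omega] at g1
            exact g1)
        choose σ hσ using hu
        refine mem_image.mpr ⟨σ, mem_univ _, ?_⟩
        funext i
        have hd : (p:ℤ) ^ (k * b) ∣ x i - x0 (σ i) := by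
          have e3 : x i - x0 (σ i) = p ^ a * ((x i - ξ) / p ^ a - (x0 (σ i) - ξ) / p ^ a) := by
            rw [mul_sub, ← hy1 x hx' i, ← hy1 x0 hx0' (σ i)]; ring
          have e4 : (p:ℤ) ^ (k * b) = p ^ a * p ^ (k * b - a) := by
            rw [← pow_add]; congr 1
            have := hak 1 (by have := i.2; omega); omega
          rw [e3, e4]
          exact mul_dvd_mul_left _ (hσ i)
        exact (Int.modEq_iff_dvd.mpr hd : x0 (σ i) ≡ x i [ZMOD _])
      refine (card_le_card this).trans (card_image_le.trans ?_)
      simp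
end Vino

namespace Vino
open Finset MeasureTheory

/-- residue class in the interval -/
noncomputable def cl (N m : ℕ) (η : ℤ) : Finset ℤ := {n ∈ Icc (1:ℤ) N | (m:ℤ) ∣ n - η}

lemma mem_cl {N m : ℕ} {η n : ℤ} : n ∈ cl N m η ↔ (1 ≤ n ∧ n ≤ N) ∧ (m:ℤ) ∣ n - η := by
  simp [cl]

noncomputable def fS (k N m : ℕ) (η : ℤ) (α : Fin k → ℝ) : ℂ := S (cl N m η) (pv k) α

@[fun_prop] lemma continuous_fS (k N m : ℕ) (η : ℤ) : Continuous (fS k N m η) := by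
  unfold fS; fun_prop

def rr (p a : ℕ) (ξ n : ℤ) : ZMod p := (((n - ξ) / (p:ℤ) ^ a : ℤ) : ZMod p)

noncomputable def G (k N p a : ℕ) (ξ : ℤ) : Finset (Fin k → ℤ) :=
  {x ∈ Fintype.piFinset fun _ : Fin k => cl N (p ^ a) ξ | Function.Injective fun i => rr p a ξ (x i)}

noncomputable def FS (k N p a : ℕ) (ξ : ℤ) (α : Fin k → ℝ) : ℂ :=
  S (G k N p a ξ) (fun x => ∑ i, pv k (x i)) α

@[fun_prop] lemma continuous_FS (k N m a : ℕ) (η : ℤ) : Continuous (FS k N m a η) := by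
  unfold FS; fun_prop

lemma S_fiber {k : ℕ} {ι σ : Type*} [Fintype σ] [DecidableEq σ] (Ω : Finset ι) (φ : ι → Fin k → ℤ) (r : ι → σ)
    (α : Fin k → ℝ) : S Ω φ α = ∑ j, S {n ∈ Ω | r n = j} φ α := by
  unfold S; rw [sum_fiberwise]

lemma S_inj {k : ℕ} {ι σ : Type*} [Fintype σ] [DecidableEq σ] (Ω : Finset ι) (φ : ι → Fin k → ℤ) (r : ι → σ)
    (α : Fin k → ℝ) : S ({x ∈ Fintype.piFinset fun _ : Fin k => Ω | Function.Injective fun i => r (x i)})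
      (fun x => ∑ i, φ (x i)) α =
    ∑ f : Fin k → σ with Function.Injective f, ∏ i, S {n ∈ Ω | r n = f i} φ α := by
  rw [S_fiber _ _ (fun x i => r (x i))]
  rw [sum_filter]
  refine sum_congr rfl fun f _ => ?_
  split_ifs with hf
  · rw [← S_pi]
    congr 1
    ext x
    simp only [mem_filter, Fintype.mem_piFinset]
    constructor
    · rintro ⟨⟨h1, h2⟩, h3⟩ i; exact ⟨h1 i, congrFun h3 i⟩
    · intro h
      have : (fun i => r (x i)) = f := funext fun i => (h i).2
      exact ⟨⟨fun i => (h i).1, this ▸ hf⟩, this⟩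
  · unfold S
    rw [filter_eq_empty_iff.mpr, sum_empty]
    intro x hx h3
    exact hf (h3 ▸ (mem_filter.mp hx).2)

lemma cl_rr {N p b : ℕ} [hp : NeZero p] (η : ℤ) (j : ZMod p) :
    {n ∈ cl N (p ^ b) η | rr p b η n = j} = cl N (p ^ (b+1)) (η + p ^ b * j.val) := by
  have hp0 : (p:ℤ) ≠ 0 := by exact_mod_cast hp.out
  ext n
  rw [mem_filter, mem_cl, mem_cl]
  unfold rr
  have hj : ((j.val : ℤ) : ZMod p) = j := by simp
  constructor
  · rintro ⟨⟨h1, h2⟩, h3⟩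
    refine ⟨h1, ?_⟩
    rw [← hj] at h3
    have h4 := (ZMod.intCast_eq_intCast_iff_dvd_sub _ _ _).mp h3.symm
    push_cast at h2 ⊢
    obtain ⟨w, hw⟩ := h2
    rw [hw, Int.mul_ediv_cancel_left _ (pow_ne_zero _ hp0)] at h4
    rw [show n - (η + (p:ℤ)^b * j.val) = p ^ b * (w - j.val) by linear_combination hw, pow_succ]
    exact mul_dvd_mul_left _ h4
  · rintro ⟨h1, h2⟩
    push_cast at h2 ⊢
    obtain ⟨w, hw⟩ := h2
    have h3 : n - η = p ^ b * (p * w + j.val) := by rw [pow_succ] at hw; linear_combination hw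
    refine ⟨⟨h1, ⟨_, h3⟩⟩, ?_⟩
    rw [h3, Int.mul_ediv_cancel_left _ (pow_ne_zero _ hp0)]
    push_cast; simp

lemma fS_split (k N p b : ℕ) [hp : NeZero p] (η : ℤ) (α : Fin k → ℝ) :
    fS k N (p ^ b) η α = ∑ j : ZMod p, fS k N (p ^ (b+1)) (η + p ^ b * j.val) α := by
  unfold fS
  rw [S_fiber _ _ (rr p b η)]
  simp_rw [cl_rr]

lemma dich (k : ℕ) : ∃ C : ℝ, 1 ≤ C ∧ ∀ (N p b : ℕ) [NeZero p] (η : ℤ) (α : Fin k → ℝ),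
    ‖fS k N (p ^ b) η α‖ ^ (2 * k) ≤ C * ‖FS k N p b η α‖ ^ 2 ∨
    ‖fS k N (p ^ b) η α‖ ^ (2 * k) ≤ C * (∑ j : ZMod p, ‖fS k N (p ^ (b+1)) (η + p ^ b * j.val) α‖ ^ 2) ^ k := by
  obtain ⟨C, hC, h⟩ := dichotomy k
  refine ⟨C, hC, fun N p b _ η α => ?_⟩
  have h1 := h (ZMod p) (fun j => fS k N (p ^ (b+1)) (η + p ^ b * j.val) α)
  rw [← fS_split] at h1
  convert h1 using 4
  unfold FS G
  rw [S_inj]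
  simp_rw [cl_rr]
  unfold fS
  congr!

lemma Vbound (s k N m : ℕ) (hm : 1 ≤ m) (η : ℤ) (c : ℝ) :
    ∫ α, ‖fS k N m η α‖ ^ (2 * s) ∂(μ k c) ≤ Jn s k (N / m + 1) := by
  have h1 : ∫ α, ‖fS k N m η α‖ ^ (2 * s) ∂(μ k c) =
      cnt (Fintype.piFinset fun _ : Fin s => cl N m η) (fun x => ∑ i, pv k (x i)) := by
    rw [← orth c]
    simp_rw [S_pow, norm_pow, ← pow_mul, mul_comm s 2, fS]
  rw [h1]; unfold Jn
  have hm0 : (0:ℤ) < m := by exact_mod_cast hm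
  have key : ∀ n ∈ cl N m η, n = m * ((n - 1) / m + 1) + ((η - 1) % m + 1 - m) := by
    intro n hn
    have h2 := (mem_cl.mp hn).2
    have h3 : (n - 1) % m = (η - 1) % m := by
      apply Int.ModEq.symm; rw [Int.modEq_iff_dvd]; simpa using h2
    have := Int.mul_ediv_add_emod (n - 1) m
    rw [h3] at this; linarith
  refine Nat.cast_le.mpr ?_
  refine cnt_le_of_inj (fun x i => (x i - 1) / m + 1) ?_ ?_ ?_
  · intro x hx
    rw [Fintype.mem_piFinset] at hx ⊢
    intro i
    obtain ⟨⟨h2, h3⟩, -⟩ := mem_cl.mp (hx i)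
    rw [mem_Icc]
    have h4 : 0 ≤ (x i - 1) / m := Int.ediv_nonneg (by linarith) hm0.le
    have h5 : (x i - 1) / m ≤ N / m := Int.ediv_le_ediv hm0 (by linarith)
    push_cast
    constructor <;> linarith
  · intro x hx y hy hxy
    rw [mem_coe, Fintype.mem_piFinset] at hx hy
    funext i
    rw [key _ (hx i), key _ (hy i)]
    rw [show (x i - 1) / (m:ℤ) + 1 = (y i - 1) / m + 1 from congrFun hxy i]
  · intro x hx y hy hxy
    rw [Fintype.mem_piFinset] at hx hy
    have h2 : ∀ j, 1 ≤ j → j ≤ k → ∑ i, x i ^ j = ∑ i, y i ^ j := by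
      intro j hj1 hj2
      have := congrFun hxy ⟨j - 1, by omega⟩
      simp only [Finset.sum_apply, pv] at this
      rwa [show j - 1 + 1 = j by omega] at this
    funext j
    simp only [Finset.sum_apply, pv]
    have h3 := shift_psum x y (-((η - 1) % m + 1 - m)) h2 ((j:ℕ)+1) j.2
    have h4 : ∀ z : Fin s → ℤ, (∀ i, z i ∈ cl N m η) → ∑ i, (z i + (-((η - 1) % m + 1 - m))) ^ ((j:ℕ)+1) =
        (m:ℤ) ^ ((j:ℕ)+1) * ∑ i, ((z i - 1) / m + 1) ^ ((j:ℕ)+1) := by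
      intro z hz
      rw [mul_sum]
      refine sum_congr rfl fun i _ => ?_
      rw [← mul_pow]; congr 1
      have := key _ (hz i); linarith
    rw [h4 x hx, h4 y hy] at h3
    exact mul_left_cancel₀ (pow_ne_zero _ hm0.ne') h3

lemma orthU {k u : ℕ} {ι : Type*} (c : ℝ) (Ω : Finset ι) (φ : ι → Fin k → ℤ) (N m : ℕ) (η : ℤ) :
    ∫ α, ‖S Ω φ α‖ ^ 2 * ‖fS k N m η α‖ ^ (2 * u) ∂(μ k c) =
      cnt (Ω ×ˢ Fintype.piFinset fun _ : Fin u => cl N m η) (fun z => φ z.1 + ∑ i, pv k (z.2 i)) := by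
  rw [← orth c]
  have : ∀ α, S (Ω ×ˢ Fintype.piFinset fun _ : Fin u => cl N m η) (fun z => φ z.1 + ∑ i, pv k (z.2 i)) α =
      S Ω φ α * fS k N m η α ^ u := by
    intro α
    rw [S_prod Ω (Fintype.piFinset fun _ : Fin u => cl N m η) φ (fun x => ∑ i, pv k (x i)), S_pow]; rfl
  simp_rw [this, norm_mul, mul_pow, norm_pow, ← pow_mul, mul_comm u 2]

lemma FS_le (k N p a : ℕ) (ξ : ℤ) (u m : ℕ) (η : ℤ) (c : ℝ) :
    ∫ α, ‖FS k N p a ξ α‖ ^ 2 * ‖fS k N m η α‖ ^ (2 * u) ∂(μ k c) ≤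
    ∫ α, ‖fS k N (p ^ a) ξ α‖ ^ (2 * k) * ‖fS k N m η α‖ ^ (2 * u) ∂(μ k c) := by
  have h1 := orthU (u := u) c (Fintype.piFinset fun _ : Fin k => cl N (p ^ a) ξ) (fun x => ∑ i, pv k (x i)) N m η
  simp_rw [S_pow, norm_pow, ← pow_mul, mul_comm k 2] at h1
  unfold FS
  rw [orthU]
  refine le_trans ?_ h1.ge
  norm_cast
  refine cnt_mono (product_subset_product_left ?_)
  exact filter_subset _ _

end Vino

namespace Vino
open Finset MeasureTheory

lemma rr_ne {p a : ℕ} (hp : 0 < p) {ξ n n' : ℤ} (h : (p:ℤ)^a ∣ n - ξ) (h' : (p:ℤ)^a ∣ n' - ξ)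
    (hne : rr p a ξ n ≠ rr p a ξ n') : ¬ (p:ℤ) ^ (a+1) ∣ n - n' := by
  intro hd
  apply hne
  have hp0 : (p:ℤ) ^ a ≠ 0 := by positivity
  obtain ⟨w, hw⟩ := h
  obtain ⟨w', hw'⟩ := h'
  unfold rr
  rw [hw, hw', Int.mul_ediv_cancel_left _ hp0, Int.mul_ediv_cancel_left _ hp0]
  symm
  rw [ZMod.intCast_eq_intCast_iff_dvd_sub]
  have : n - n' = (p:ℤ)^a * (w - w') := by linear_combination hw - hw'
  rw [this, pow_succ] at hd
  exact (mul_dvd_mul_iff_left hp0).mp hd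

lemma prod_le_sum_pow {k : ℕ} (hk : 1 ≤ k) (a : Fin k → ℝ) (h : ∀ i, 0 ≤ a i) : ∏ i, a i ≤ ∑ i, a i ^ k := by
  have : Nonempty (Fin k) := ⟨⟨0, hk⟩⟩
  obtain ⟨m, -, hm⟩ := exists_max_image univ a ⟨⟨0, hk⟩, mem_univ _⟩
  calc ∏ i, a i ≤ ∏ i : Fin k, a m := prod_le_prod (fun i _ => h i) (fun i _ => hm i (mem_univ _))
    _ = a m ^ k := by simp
    _ ≤ _ := single_le_sum (f := fun i => a i ^ k) (fun i _ => pow_nonneg (h i) k) (mem_univ m)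

lemma Ubound {k N p a b u : ℕ} (hp : p.Prime) (hkp : k < p) (hk : 1 ≤ k) (hab : a ≤ b) (ξ η : ℤ) {T : ℝ}
    (hT : ∀ ξ', ∫ α, ‖fS k N (p ^ (k * b)) ξ' α‖ ^ (2 * k) * ‖fS k N (p ^ b) η α‖ ^ (2 * u) ∂(μ k 0) ≤ T) :
    ∫ α, ‖FS k N p a ξ α‖ ^ 2 * ‖fS k N (p ^ b) η α‖ ^ (2 * u) ∂(μ k 0) ≤
      ((p:ℝ) ^ (k * (k - 1) / 2 * (a + b)) * k ^ k) * ((p:ℝ) ^ (k * (k * b - a)) * (k * T)) := by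
  have hp0 := hp.pos
  have hT0 : 0 ≤ T := (integral_nonneg fun α => by positivity).trans (hT 0)
  unfold FS
  rw [orthU]
  set Ω := G k N p a ξ ×ˢ Fintype.piFinset fun _ : Fin u => cl N (p ^ b) η with hΩ
  set φ : (Fin k → ℤ) × (Fin u → ℤ) → Fin k → ℤ := fun z => ∑ i, pv k (z.1 i) + ∑ i, pv k (z.2 i) with hφ
  set ρ : (Fin k → ℤ) × (Fin u → ℤ) → Fin k → ℤ := fun z i => z.1 i % (p:ℤ) ^ (k * b) with hρ
  have hG : ∀ z ∈ Ω, (∀ i, z.1 i ∈ cl N (p ^ a) ξ) ∧ (Function.Injective fun i => rr p a ξ (z.1 i)) ∧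
      ∀ i, z.2 i ∈ cl N (p ^ b) η := by
    intro z hz
    rw [hΩ, mem_product, G, mem_filter, Fintype.mem_piFinset, Fintype.mem_piFinset] at hz
    exact ⟨hz.1.1, hz.1.2, hz.2⟩
  have hdvd : ∀ z ∈ Ω, ∀ i, (p:ℤ) ^ a ∣ z.1 i - ξ := by
    intro z hz i; have := (mem_cl.mp ((hG z hz).1 i)).2; push_cast at this; exact this
  have hB : ∀ v, #(image ρ {z ∈ Ω | φ z = v}) ≤ p ^ (k * (k - 1) / 2 * (a + b)) * k ^ k := by
    intro v
    have := linnik hp hkp hab ξ η (image Prod.fst {z ∈ Ω | φ z = v}) ?_ ?_ ?_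
    · rw [image_image] at this; exact this
    · intro x hx i
      obtain ⟨z, hz, rfl⟩ := mem_image.mp hx
      exact hdvd z (mem_filter.mp hz).1 i
    · intro x hx i j hij
      obtain ⟨z, hz, rfl⟩ := mem_image.mp hx
      have hz' := (mem_filter.mp hz).1
      exact rr_ne hp0 (hdvd z hz' i) (hdvd z hz' j) (fun h => hij ((hG z hz').2.1 h))
    · intro x hx y hy j hj1 hj2
      obtain ⟨z, hz, rfl⟩ := mem_image.mp hx
      obtain ⟨w, hw, rfl⟩ := mem_image.mp hy
      have h1 : φ z = φ w := (mem_filter.mp hz).2.trans (mem_filter.mp hw).2.symm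
      have h2 := shift_psum (k := k) (Fin.append z.1 z.2) (Fin.append w.1 w.2) (-η) (fun j h1' h2' => by
        have := congrFun h1 ⟨j - 1, by omega⟩
        simp only [hφ, Pi.add_apply, Finset.sum_apply, pv] at this
        rw [show j - 1 + 1 = j by omega] at this
        simpa [Fin.sum_univ_add] using this) j hj2
      simp only [Fin.sum_univ_add, Fin.append_left, Fin.append_right, ← sub_eq_add_neg] at h2
      have h3 : ∀ z ∈ Ω, ((p ^ (j * b) : ℕ) : ℤ) ∣ ∑ i, (z.2 i - η) ^ j := by
        intro z hz
        refine dvd_sum fun i _ => ?_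
        have := (mem_cl.mp ((hG z hz).2.2 i)).2
        rw [mul_comm, pow_mul]; push_cast at this ⊢
        exact pow_dvd_pow_of_dvd this j
      rw [Int.modEq_iff_dvd]
      have := dvd_sub (h3 z (mem_filter.mp hz).1) (h3 w (mem_filter.mp hw).1)
      rwa [show ∑ i, (z.2 i - η) ^ j - ∑ i, (w.2 i - η) ^ j = ∑ i, (w.1 i - η) ^ j - ∑ i, (z.1 i - η) ^ j by
        linarith] at this
  have h1 := cnt_class Ω φ ρ _ hB
  have hcard : #(image ρ Ω) ≤ p ^ (k * (k * b - a)) := by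
    refine (vec_card _ (fun _ => p ^ a) (fun _ => p ^ (k * b - a)) (fun _ => by positivity) ?_ ?_).trans ?_
    · intro y hy j
      obtain ⟨z, hz, rfl⟩ := mem_image.mp hy
      refine ⟨Int.emod_nonneg _ (by positivity), ?_⟩
      refine (Int.emod_lt_of_pos _ (by positivity)).trans_le (le_of_eq ?_)
      norm_cast
      rw [← pow_add]; congr 1
      have := Nat.le_mul_of_pos_left b hk; omega
    · intro y hy y' hy' j
      obtain ⟨z, hz, rfl⟩ := mem_image.mp hy
      obtain ⟨w, hw, rfl⟩ := mem_image.mp hy'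
      have hd : ((p ^ a : ℕ) : ℤ) ∣ (p:ℤ) ^ (k * b) := by
        push_cast; exact pow_dvd_pow _ (hab.trans (Nat.le_mul_of_pos_left b hk))
      have g1 := (Int.mod_modEq (z.1 j) ((p:ℤ) ^ (k * b))).of_dvd hd
      have g2 := (Int.mod_modEq (w.1 j) ((p:ℤ) ^ (k * b))).of_dvd hd
      refine g1.trans (Int.ModEq.trans ?_ g2.symm)
      rw [Int.modEq_iff_dvd]
      have := dvd_sub (hdvd w hw j) (hdvd z hz j)
      push_cast
      rwa [show w.1 j - ξ - (z.1 j - ξ) = w.1 j - z.1 j by ring] at this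
    · rw [prod_const, ← pow_mul, card_univ, Fintype.card_fin, mul_comm]
  have hcl : ∀ c, (cnt {z ∈ Ω | ρ z = c} φ : ℝ) ≤ k * T := by
    intro c
    have h2 : cnt {z ∈ Ω | ρ z = c} φ ≤ cnt ((Fintype.piFinset fun i : Fin k => cl N (p ^ (k * b)) (c i)) ×ˢ
        Fintype.piFinset fun _ : Fin u => cl N (p ^ b) η) φ := by
      refine cnt_mono ?_
      intro z hz
      obtain ⟨hz, hc⟩ := mem_filter.mp hz
      rw [mem_product, Fintype.mem_piFinset, Fintype.mem_piFinset]
      refine ⟨fun i => ?_, (hG z hz).2.2⟩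
      rw [mem_cl]
      refine ⟨(mem_cl.mp ((hG z hz).1 i)).1, ?_⟩
      rw [← hc, hρ]; push_cast
      exact Int.dvd_self_sub_emod
    have h3 := orthU (u := u) 0 (Fintype.piFinset fun i : Fin k => cl N (p ^ (k * b)) (c i)) (fun x => ∑ i, pv k (x i)) N (p ^ b) η
    refine (Nat.cast_le.mpr h2).trans (h3.ge.trans ?_)
    simp_rw [S_pi]
    calc _ ≤ ∫ α, ∑ i, ‖fS k N (p ^ (k * b)) (c i) α‖ ^ (2 * k) * ‖fS k N (p ^ b) η α‖ ^ (2 * u) ∂(μ k 0) := by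
          refine integral_mono (integrable_of_cont 0 (by fun_prop)) (integrable_of_cont 0 (by fun_prop)) fun α => ?_
          simp only
          rw [← sum_mul]
          gcongr
          rw [norm_prod, ← prod_pow]
          refine (prod_le_sum_pow hk _ fun i => by positivity).trans (le_of_eq ?_)
          simp_rw [← pow_mul]; rfl
      _ = ∑ i, ∫ α, ‖fS k N (p ^ (k * b)) (c i) α‖ ^ (2 * k) * ‖fS k N (p ^ b) η α‖ ^ (2 * u) ∂(μ k 0) := by
          rw [integral_finsetSum]
          exact fun i _ => integrable_of_cont 0 (by fun_prop)
      _ ≤ ∑ i : Fin k, T := sum_le_sum fun i _ => hT _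
      _ = k * T := by simp
  calc (cnt Ω φ : ℝ) ≤ (p ^ (k * (k - 1) / 2 * (a + b)) * k ^ k : ℕ) * ∑ c ∈ image ρ Ω, (cnt {z ∈ Ω | ρ z = c} φ : ℝ) := by
        exact_mod_cast h1
    _ ≤ (p ^ (k * (k - 1) / 2 * (a + b)) * k ^ k : ℕ) * ∑ c ∈ image ρ Ω, (k * T) := by
        gcongr with c; exact hcl c
    _ ≤ (p ^ (k * (k - 1) / 2 * (a + b)) * k ^ k : ℕ) * ((p ^ (k * (k * b - a)) : ℕ) * (k * T)) := by
        rw [sum_const, nsmul_eq_mul]; gcongr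
    _ = _ := by push_cast; ring

end Vino

namespace Vino
open Finset MeasureTheory

lemma pmean {p : ℕ} [NeZero p] (z : ZMod p → ℝ) (hz : ∀ j, 0 ≤ z j) (n : ℕ) (hn : 1 ≤ n) :
    (∑ j, z j) ^ n ≤ (p:ℝ) ^ (n-1) * ∑ j, z j ^ n := by
  obtain ⟨m, rfl⟩ : ∃ m, n = m + 1 := ⟨n - 1, by omega⟩
  have := pow_sum_div_card_le_sum_pow (s := (univ : Finset (ZMod p))) (f := z) (fun j _ => hz j) m
  rw [card_univ, ZMod.card, div_le_iff₀ (by have := NeZero.pos p; positivity)] at this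
  simpa [mul_comm] using this

lemma dich' (k : ℕ) (hk : 1 ≤ k) : ∃ C : ℝ, 1 ≤ C ∧ ∀ (q : ℕ) (_ : 1 ≤ q) (N p b : ℕ) [NeZero p] (η : ℤ) (α : Fin k → ℝ),
    ‖fS k N (p ^ b) η α‖ ^ (2 * (k * q)) ≤ C * (‖FS k N p b η α‖ ^ 2 * ‖fS k N (p ^ b) η α‖ ^ (2 * (k * (q - 1)))) +
    C ^ q * (p:ℝ) ^ (k * q - 1) * ∑ j : ZMod p, ‖fS k N (p ^ (b+1)) (η + p ^ b * j.val) α‖ ^ (2 * (k * q)) := by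
  obtain ⟨C, hC, h⟩ := dich k
  refine ⟨C, hC, fun q hq N p b _ η α => ?_⟩
  have hkq : 1 ≤ k * q := Nat.mul_pos hk hq
  rcases h N p b η α with h1 | h1
  · refine le_trans ?_ (le_add_of_nonneg_right (by positivity))
    have e : 2 * (k * q) = 2 * k + 2 * (k * (q - 1)) := by
      obtain ⟨m, rfl⟩ : ∃ m, q = m + 1 := ⟨q - 1, by omega⟩
      simp; ring
    rw [e, pow_add]
    exact (mul_le_mul_of_nonneg_right h1 (pow_nonneg (norm_nonneg _) _)).trans (le_of_eq (mul_assoc _ _ _))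
  · refine le_trans ?_ (le_add_of_nonneg_left (by positivity))
    calc ‖fS k N (p ^ b) η α‖ ^ (2 * (k * q)) = (‖fS k N (p ^ b) η α‖ ^ (2 * k)) ^ q := by
          rw [← pow_mul, mul_assoc]
      _ ≤ (C * (∑ j : ZMod p, ‖fS k N (p ^ (b+1)) (η + p ^ b * j.val) α‖ ^ 2) ^ k) ^ q := by gcongr
      _ = C ^ q * (∑ j : ZMod p, ‖fS k N (p ^ (b+1)) (η + p ^ b * j.val) α‖ ^ 2) ^ (k * q) := by
          rw [mul_pow, ← pow_mul]
      _ ≤ C ^ q * ((p:ℝ) ^ (k * q - 1) * ∑ j : ZMod p, (‖fS k N (p ^ (b+1)) (η + p ^ b * j.val) α‖ ^ 2) ^ (k * q)) := by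
          gcongr; exact pmean _ (fun j => by positivity) _ hkq
      _ = _ := by simp_rw [← pow_mul]; ring

lemma Trec (k : ℕ) (hk : 1 ≤ k) : ∃ C : ℝ, 1 ≤ C ∧ ∀ (N p b c : ℕ) [NeZero p] (ξ η : ℤ) (U V T : ℝ), 0 < U → 0 < V →
    (∫ α, ‖FS k N p b η α‖ ^ 2 * ‖fS k N (p ^ c) ξ α‖ ^ (2 * (k * k)) ∂(μ k 0) ≤ U) →
    (∫ α, ‖fS k N (p ^ b) η α‖ ^ (2 * (k * (k + 1))) ∂(μ k 0) ≤ V) →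
    (∀ η', ∫ α, ‖fS k N (p ^ c) ξ α‖ ^ (2 * k) * ‖fS k N (p ^ (b+1)) η' α‖ ^ (2 * (k * k)) ∂(μ k 0) ≤ T) →
    ∫ α, ‖fS k N (p ^ c) ξ α‖ ^ (2 * k) * ‖fS k N (p ^ b) η α‖ ^ (2 * (k * k)) ∂(μ k 0) ≤
      C * (U ^ (1 / (k:ℝ)) * V ^ (1 - 1 / (k:ℝ))) + C ^ k * (p:ℝ) ^ (k * k) * T := by
  obtain ⟨C, hC, h⟩ := dich' k hk
  refine ⟨C, hC, fun N p b c _ ξ η U V T hU hV h1 h2 h3 => ?_⟩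
  have hk0 : (0:ℝ) < k := by exact_mod_cast hk
  have hV' : ∫ α, ‖FS k N p b η α‖ ^ 2 * ‖fS k N (p ^ b) η α‖ ^ (2 * (k * k)) ∂(μ k 0) ≤ V := by
    refine (FS_le ..).trans (le_trans (le_of_eq ?_) h2)
    congr 1; ext α; rw [← pow_add]; congr 1; ring
  have hH := holder (k := k) 0 (A := fun α => ‖FS k N p b η α‖ ^ 2 * ‖fS k N (p ^ c) ξ α‖ ^ (2 * (k * k)))
    (B := fun α => ‖FS k N p b η α‖ ^ 2 * ‖fS k N (p ^ b) η α‖ ^ (2 * (k * k))) (by fun_prop) (by fun_prop)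
    (fun α => by positivity) (fun α => by positivity) hU hV (θ := 1 / (k:ℝ)) (by positivity)
    (by rw [div_le_one hk0]; exact_mod_cast hk) h1 hV'
  have hpt : ∀ α, (‖FS k N p b η α‖ ^ 2 * ‖fS k N (p ^ c) ξ α‖ ^ (2 * (k * k))) ^ (1 / (k:ℝ)) *
      (‖FS k N p b η α‖ ^ 2 * ‖fS k N (p ^ b) η α‖ ^ (2 * (k * k))) ^ (1 - 1 / (k:ℝ)) =
      ‖fS k N (p ^ c) ξ α‖ ^ (2 * k) * (‖FS k N p b η α‖ ^ 2 * ‖fS k N (p ^ b) η α‖ ^ (2 * (k * (k - 1)))) := by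
    intro α
    have hθ : 0 ≤ 1 - 1 / (k:ℝ) := by
      rw [sub_nonneg, div_le_one hk0]; exact_mod_cast hk
    rw [Real.mul_rpow (by positivity) (by positivity), Real.mul_rpow (by positivity) (by positivity)]
    have e1 : (‖fS k N (p ^ c) ξ α‖ ^ (2 * (k * k))) ^ (1 / (k:ℝ)) = ‖fS k N (p ^ c) ξ α‖ ^ (2 * k) := by
      rw [← Real.rpow_natCast, ← Real.rpow_mul (norm_nonneg _), ← Real.rpow_natCast]
      congr 1; push_cast; field_simp
    have e2 : (‖fS k N (p ^ b) η α‖ ^ (2 * (k * k))) ^ (1 - 1 / (k:ℝ)) = ‖fS k N (p ^ b) η α‖ ^ (2 * (k * (k - 1))) := by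
      rw [← Real.rpow_natCast, ← Real.rpow_mul (norm_nonneg _), ← Real.rpow_natCast]
      congr 1; push_cast [Nat.cast_sub hk]; field_simp
    have e3 : (‖FS k N p b η α‖ ^ 2) ^ (1 / (k:ℝ)) * (‖FS k N p b η α‖ ^ 2) ^ (1 - 1 / (k:ℝ)) = ‖FS k N p b η α‖ ^ 2 := by
      rw [← Real.rpow_add_of_nonneg (by positivity) (by positivity) hθ]; simp
    rw [e1, e2]
    linear_combination (‖fS k N (p ^ c) ξ α‖ ^ (2 * k) * ‖fS k N (p ^ b) η α‖ ^ (2 * (k * (k - 1)))) * e3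
  simp_rw [hpt] at hH
  calc _ ≤ ∫ α, C * (‖fS k N (p ^ c) ξ α‖ ^ (2 * k) * (‖FS k N p b η α‖ ^ 2 * ‖fS k N (p ^ b) η α‖ ^ (2 * (k * (k - 1))))) +
        C ^ k * (p:ℝ) ^ (k * k - 1) * ∑ j : ZMod p, ‖fS k N (p ^ c) ξ α‖ ^ (2 * k) * ‖fS k N (p ^ (b+1)) (η + p ^ b * j.val) α‖ ^ (2 * (k * k)) ∂(μ k 0) := by
        refine integral_mono (integrable_of_cont 0 (by fun_prop)) (integrable_of_cont 0 (by fun_prop)) fun α => ?_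
        simp only
        rw [← mul_sum]
        refine (mul_le_mul_of_nonneg_left (h k hk N p b η α) (by positivity)).trans (le_of_eq (by ring))
    _ = C * ∫ α, (‖fS k N (p ^ c) ξ α‖ ^ (2 * k) * (‖FS k N p b η α‖ ^ 2 * ‖fS k N (p ^ b) η α‖ ^ (2 * (k * (k - 1))))) ∂(μ k 0) +
        C ^ k * (p:ℝ) ^ (k * k - 1) * ∑ j : ZMod p, ∫ α, ‖fS k N (p ^ c) ξ α‖ ^ (2 * k) * ‖fS k N (p ^ (b+1)) (η + p ^ b * j.val) α‖ ^ (2 * (k * k)) ∂(μ k 0) := by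
        rw [integral_add (integrable_of_cont 0 (by fun_prop)) (integrable_of_cont 0 (by fun_prop)), integral_const_mul, integral_const_mul,
          integral_finsetSum]
        exact fun i _ => integrable_of_cont 0 (by fun_prop)
    _ ≤ C * (U ^ (1 / (k:ℝ)) * V ^ (1 - 1 / (k:ℝ))) + C ^ k * (p:ℝ) ^ (k * k - 1) * ∑ j : ZMod p, T := by
        gcongr with j; exact h3 _
    _ = _ := by
        have : (p:ℝ) ^ (k * k) = p ^ (k * k - 1) * p := by
          rw [← pow_succ]; congr 1; have := Nat.mul_pos hk hk; omega
        rw [sum_const, card_univ, ZMod.card, nsmul_eq_mul, this]; ring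

lemma fS_zero (k N p : ℕ) (α : Fin k → ℝ) : fS k N (p ^ 0) 0 α = S (Icc (1:ℤ) N) (pv k) α := by
  unfold fS cl; congr 1; rw [filter_true_of_mem]; simp

lemma Jrec (k : ℕ) (hk : 1 ≤ k) : ∃ C : ℝ, 1 ≤ C ∧ ∀ (N p : ℕ) [NeZero p] (U V : ℝ),
    (∀ η, ∫ α, ‖FS k N p 0 0 α‖ ^ 2 * ‖fS k N (p ^ 1) η α‖ ^ (2 * (k * k)) ∂(μ k 0) ≤ U) →
    (∀ η, ∫ α, ‖fS k N (p ^ 1) η α‖ ^ (2 * (k * (k + 1))) ∂(μ k 0) ≤ V) →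
    (Jn (k * (k + 1)) k N : ℝ) ≤ C * ((p:ℝ) ^ (2 * (k * k)) * U) + C ^ (k + 1) * (p:ℝ) ^ (k * (k + 1)) * V := by
  obtain ⟨C, hC, h⟩ := dich' k hk
  refine ⟨C, hC, fun N p _ U V h1 h2 => ?_⟩
  have hkk := Nat.mul_pos hk hk
  rw [← Jn_eq _ _ _ 0]
  have e1 : (p:ℝ) ^ (2 * (k * k)) = p ^ (2 * (k * k) - 1) * p := by
    rw [← pow_succ]; congr 1; omega
  have e2 : (p:ℝ) ^ (k * (k+1)) = p ^ (k * (k+1) - 1) * p := by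
    rw [← pow_succ]; congr 1; have : 0 < k * (k + 1) := by positivity
    omega
  calc _ ≤ ∫ α, C * ((p:ℝ) ^ (2 * (k * k) - 1) * ∑ j : ZMod p, ‖FS k N p 0 0 α‖ ^ 2 * ‖fS k N (p ^ 1) (0 + p ^ 0 * j.val) α‖ ^ (2 * (k * k))) +
        C ^ (k + 1) * (p:ℝ) ^ (k * (k + 1) - 1) * ∑ j : ZMod p, ‖fS k N (p ^ 1) (0 + p ^ 0 * j.val) α‖ ^ (2 * (k * (k+1))) ∂(μ k 0) := by
        refine integral_mono (integrable_of_cont 0 (by fun_prop)) (integrable_of_cont 0 (by fun_prop)) fun α => ?_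
        have := h (k+1) (by omega) N p 0 0 α
        have h4 : ‖fS k N (p ^ 0) 0 α‖ ^ (2 * (k * k)) ≤ (p:ℝ) ^ (2 * (k * k) - 1) * ∑ j : ZMod p, ‖fS k N (p ^ (0+1)) (0 + p ^ 0 * j.val) α‖ ^ (2 * (k * k)) := by
          rw [fS_split]
          refine le_trans ?_ (pmean (fun j : ZMod p => ‖fS k N (p ^ (0+1)) (0 + p ^ 0 * j.val) α‖) (fun j => norm_nonneg _) _ (by omega))
          gcongr; exact norm_sum_le _ _
        simp only
        rw [← fS_zero k N p]
        refine this.trans ?_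
        simp only [Nat.add_sub_cancel]
        refine add_le_add_left (mul_le_mul_of_nonneg_left ?_ (by linarith)) _
        rw [← mul_sum]
        refine (mul_le_mul_of_nonneg_left h4 (by positivity)).trans (le_of_eq (by ring))
    _ = C * ((p:ℝ) ^ (2 * (k * k) - 1) * ∑ j : ZMod p, ∫ α, ‖FS k N p 0 0 α‖ ^ 2 * ‖fS k N (p ^ 1) (0 + p ^ 0 * j.val) α‖ ^ (2 * (k * k)) ∂(μ k 0)) +
        C ^ (k + 1) * (p:ℝ) ^ (k * (k + 1) - 1) * ∑ j : ZMod p, ∫ α, ‖fS k N (p ^ 1) (0 + p ^ 0 * j.val) α‖ ^ (2 * (k * (k+1))) ∂(μ k 0) := by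
        rw [integral_add (integrable_of_cont 0 (by fun_prop)) (integrable_of_cont 0 (by fun_prop)), integral_const_mul, integral_const_mul,
          integral_const_mul, integral_finsetSum, integral_finsetSum]
        · exact fun i _ => integrable_of_cont 0 (by fun_prop)
        · exact fun i _ => integrable_of_cont 0 (by fun_prop)
    _ ≤ C * ((p:ℝ) ^ (2 * (k * k) - 1) * ∑ j : ZMod p, U) + C ^ (k + 1) * (p:ℝ) ^ (k * (k + 1) - 1) * ∑ j : ZMod p, V := by
        gcongr with j _ j
        · exact h1 _
        · exact h2 _
    _ = _ := by
        rw [sum_const, sum_const, card_univ, ZMod.card, nsmul_eq_mul, nsmul_eq_mul, e1, e2]; ring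

end Vino

namespace Vino
open Finset MeasureTheory

lemma interp {A P C D x y θ : ℝ} (hA : 0 < A) (hP : 0 < P) (hC : 1 ≤ C) (hD : 1 ≤ D) (h0 : 0 ≤ θ) (h1 : θ ≤ 1) :
    (C * (A * P ^ x)) ^ θ * (D * (A * P ^ y)) ^ (1 - θ) ≤ C * D * (A * P ^ (x * θ + y * (1 - θ))) := by
  have hC0 : 0 < C := by linarith
  have hD0 : 0 < D := by linarith
  rw [Real.mul_rpow hC0.le (by positivity), Real.mul_rpow hD0.le (by positivity), Real.mul_rpow hA.le (by positivity),
    Real.mul_rpow hA.le (by positivity), ← Real.rpow_mul hP.le, ← Real.rpow_mul hP.le]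
  have e1 : A ^ θ * A ^ (1 - θ) = A := by rw [← Real.rpow_add hA]; simp
  have e2 : P ^ (x * θ) * P ^ (y * (1 - θ)) = P ^ (x * θ + y * (1 - θ)) := by rw [← Real.rpow_add hP]
  have e3 : C ^ θ ≤ C := by
    calc C ^ θ ≤ C ^ (1:ℝ) := Real.rpow_le_rpow_of_exponent_le hC h1
      _ = C := Real.rpow_one C
  have e4 : D ^ (1 - θ) ≤ D := by
    calc D ^ (1 - θ) ≤ D ^ (1:ℝ) := Real.rpow_le_rpow_of_exponent_le hD (by linarith)
      _ = D := Real.rpow_one D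
  calc _ = C ^ θ * D ^ (1 - θ) * ((A ^ θ * A ^ (1 - θ)) * (P ^ (x * θ) * P ^ (y * (1 - θ)))) := by ring
    _ = C ^ θ * D ^ (1 - θ) * (A * P ^ (x * θ + y * (1 - θ))) := by rw [e1, e2]
    _ ≤ _ := by gcongr

def HV (k : ℕ) (L C : ℝ) : Prop := ∀ (N p b : ℕ) (η : ℤ), p.Prime → p ^ b ≤ N →
  ∫ α, ‖fS k N (p ^ b) η α‖ ^ (2 * (k * (k + 1))) ∂(μ k 0) ≤ C * ((N:ℝ) ^ L * (p:ℝ) ^ (-(b * L)))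

def Cl (k : ℕ) (L : ℝ) (m : ℕ) (g : ℝ) : Prop := ∃ C P0 : ℝ, 1 ≤ C ∧ ∀ (N p a b : ℕ) (ξ η : ℤ), p.Prime → P0 ≤ p →
  1 ≤ b → a ≤ b → p ^ (m * b) ≤ N →
  ∫ α, ‖FS k N p a ξ α‖ ^ 2 * ‖fS k N (p ^ b) η α‖ ^ (2 * (k * k)) ∂(μ k 0) ≤
    C * ((N:ℝ) ^ L * (p:ℝ) ^ ((k:ℝ) * (k - 3) / 2 * a - 2 * k ^ 2 * b - g * b))

lemma young2 {k N m m' : ℕ} (ξ η : ℤ) {V W : ℝ}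
    (h1 : ∫ α, ‖fS k N m ξ α‖ ^ (2 * (k * (k + 1))) ∂(μ k 0) ≤ V)
    (h2 : ∫ α, ‖fS k N m' η α‖ ^ (2 * (k * (k + 1))) ∂(μ k 0) ≤ W) :
    ∫ α, ‖fS k N m ξ α‖ ^ (2 * k) * ‖fS k N m' η α‖ ^ (2 * (k * k)) ∂(μ k 0) ≤ V + W := by
  refine le_trans ?_ (add_le_add h1 h2)
  rw [← integral_add (integrable_of_cont 0 (by fun_prop)) (integrable_of_cont 0 (by fun_prop))]
  refine integral_mono (integrable_of_cont 0 (by fun_prop)) (integrable_of_cont 0 (by fun_prop)) fun α => ?_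
  simp only
  have e : 2 * (k * (k+1)) = 2 * k + 2 * (k * k) := by ring
  rw [e]
  rcases le_total ‖fS k N m ξ α‖ ‖fS k N m' η α‖ with h | h
  · refine le_trans ?_ (le_add_of_nonneg_left (by positivity))
    rw [pow_add]; gcongr
  · refine le_trans ?_ (le_add_of_nonneg_right (by positivity))
    rw [pow_add]; gcongr

lemma Cl_zero {k : ℕ} (hk : 2 ≤ k) {L C : ℝ} (hC : 1 ≤ C) (hL : 0 ≤ L) (h : HV k L C) : Cl k L 1 (-(2 * k ^ 2 + 2 * k)) := by
  refine ⟨2 * C, 0, by linarith, fun N p a b ξ η hp _ hb hab hN => ?_⟩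
  have hP : (1:ℝ) ≤ p := by exact_mod_cast hp.one_lt.le
  have hk' : (2:ℝ) ≤ k := by exact_mod_cast hk
  have hb' : (1:ℝ) ≤ b := by exact_mod_cast hb
  have hab' : (a:ℝ) ≤ b := by exact_mod_cast hab
  rw [one_mul] at hN
  refine (FS_le ..).trans ((young2 _ _ (h N p a ξ hp ((Nat.pow_le_pow_right hp.pos hab).trans hN)) (h N p b η hp hN)).trans ?_)
  have e : ∀ x : ℕ, C * ((N:ℝ) ^ L * (p:ℝ) ^ (-(x * L))) ≤
      C * ((N:ℝ) ^ L * (p:ℝ) ^ ((k:ℝ) * (k - 3) / 2 * a - 2 * k ^ 2 * b - (-(2 * k ^ 2 + 2 * k)) * b)) := by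
    intro x
    gcongr
    · have h1 : -(x * L) ≤ 0 := by have : 0 ≤ x * L := by positivity
                                   linarith
      have h2 : -(a:ℝ) ≤ (k:ℝ) * (k - 3) / 2 * a := by
        have : (0:ℝ) ≤ a := by positivity
        nlinarith [mul_nonneg (mul_nonneg (sub_nonneg.mpr hk') (by linarith : (0:ℝ) ≤ k - 1)) this]
      nlinarith
  linarith [e a, e b]

lemma Cl_step {k : ℕ} (hk : 2 ≤ k) {L Δ C g g' : ℝ} {m : ℕ} (hm : 1 ≤ m) (hΔ : 0 < Δ) (hC : 1 ≤ C)
    (hL : L = 3 * (k ^ 2 + k) / 2 + Δ)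
    (h : HV k L C) (hc : Cl k L m g) (hg : g' ≤ g + Δ * (1 - 1 / k)) (hg2 : g' ≤ Δ * k) :
    Cl k L (m * k) g' := by
  obtain ⟨C1, hC1, hT⟩ := Trec k (by omega)
  obtain ⟨Cn, P0, hCn, hU⟩ := hc
  have hk' : (2:ℝ) ≤ k := by exact_mod_cast hk
  set D := 2 * (C1 * (Cn * C)) + 2 * C with hD
  have hD1 : 1 ≤ D := by
    have : 0 ≤ C1 * (Cn * C) := by positivity
    linarith
  have hk1 : (1:ℝ) ≤ (k:ℝ)^k * (k * D) := by
    have : (1:ℝ) ≤ (k:ℝ)^k := one_le_pow₀ (by linarith)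
    have : (1:ℝ) ≤ k * D := by nlinarith
    nlinarith
  refine ⟨(k:ℝ)^k * (k * D), max P0 (max (2 * C1 ^ k) (k + 1)), hk1, fun N p a b ξ η hp hp0 hb hab hN => ?_⟩
  obtain ⟨hp1, hp2, hp3⟩ : P0 ≤ p ∧ 2 * C1 ^ k ≤ p ∧ (k:ℝ) + 1 ≤ p := by
    simpa using hp0
  have hkp : k < p := by exact_mod_cast (by linarith : (k:ℝ) < p)
  have hp2' := hp.two_le
  have : NeZero p := ⟨by omega⟩
  set P : ℝ := (p:ℝ) with hPdef
  have hP : (1:ℝ) ≤ P := by rw [hPdef]; exact_mod_cast hp.one_lt.le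
  have hP0 : 0 < P := by linarith
  have hN1 : 1 ≤ N := le_trans (Nat.one_le_pow _ _ hp.pos) hN
  set A := (N:ℝ) ^ L with hA
  have hA0 : 0 < A := Real.rpow_pos_of_pos (by exact_mod_cast hN1) _
  have hb' : (1:ℝ) ≤ b := by exact_mod_cast hb
  -- main induction
  have main : ∀ i b', b' + i = k * b → b ≤ b' → ∀ ξ η,
      ∫ α, ‖fS k N (p ^ (k * b)) ξ α‖ ^ (2 * k) * ‖fS k N (p ^ b') η α‖ ^ (2 * (k * k)) ∂(μ k 0) ≤
      D * (A * P ^ (-2 * k * (k * b) - b' * ((3 * k ^ 2 - k) / 2) - g' * b)) := by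
    intro i
    induction i with
    | zero =>
      intro b' hb1 hb2 ξ η
      rw [add_zero] at hb1
      subst hb1
      have hN' : p ^ (k * b) ≤ N := le_trans (Nat.pow_le_pow_right hp.pos (by rw [mul_assoc]; exact Nat.le_mul_of_pos_left _ hm)) hN
      have h1 := young2 ξ η (h N p (k * b) ξ hp hN') (h N p (k * b) η hp hN')
      refine h1.trans ?_
      have e : A * P ^ (-((k * b : ℕ) * L)) ≤ A * P ^ (-2 * k * (k * b) - (k * b : ℕ) * ((3 * k ^ 2 - k) / 2) - g' * b) := by
        gcongr
        · push_cast; rw [hL]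
          nlinarith [mul_le_mul_of_nonneg_right hg2 (by linarith : (0:ℝ) ≤ b)]
      calc C * (A * P ^ (-((k * b : ℕ) * L))) + C * (A * P ^ (-((k * b : ℕ) * L))) = 2 * C * (A * P ^ (-((k * b : ℕ) * L))) := by ring
        _ ≤ D * (A * P ^ (-2 * k * (k * b) - (k * b : ℕ) * ((3 * k ^ 2 - k) / 2) - g' * b)) := by
          refine mul_le_mul ?_ e (by positivity) (by linarith)
          have : 0 ≤ C1 * (Cn * C) := by positivity
          linarith
    | succ i ih =>
      intro b' hb1 hb2 ξ η
      have hb3 : b' ≤ k * b := by omega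
      have hNc : p ^ (m * (k * b)) ≤ N := by rw [← mul_assoc]; exact hN
      have hNb : p ^ b' ≤ N := le_trans (Nat.pow_le_pow_right hp.pos (hb3.trans (Nat.le_mul_of_pos_left _ hm))) hNc
      have hb4 : (b:ℝ) ≤ b' := by exact_mod_cast hb2
      have hkb : 1 ≤ k * b := Nat.mul_pos (by omega) hb
      have h1 := hT N p b' (k * b) ξ η _ _ _ (by positivity) (by positivity)
        (hU N p b' (k * b) η ξ hp hp1 hkb hb3 hNc) (h N p b' η hp hNb) (fun η' => ih (b' + 1) (by omega) (by omega) ξ η')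
      refine h1.trans ?_
      have h2 := interp hA0 hP0 hCn hC (x := (k:ℝ) * (k - 3) / 2 * b' - 2 * k ^ 2 * (k * b : ℕ) - g * (k * b : ℕ))
        (y := -(b' * L)) (θ := 1 / (k:ℝ)) (by positivity) (by rw [div_le_one (by linarith)]; linarith)
      set E := -2 * (k:ℝ) * (k * b) - b' * ((3 * k ^ 2 - k) / 2) - g' * b with hE
      have h3 : ((k:ℝ) * (k - 3) / 2 * b' - 2 * k ^ 2 * (k * b : ℕ) - g * (k * b : ℕ)) * (1 / (k:ℝ)) + -(b' * L) * (1 - 1 / (k:ℝ)) ≤ E := by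
        have e1 : ((k:ℝ) * (k - 3) / 2 * b' - 2 * k ^ 2 * (k * b : ℕ) - g * (k * b : ℕ)) * (1 / (k:ℝ)) + -(b' * L) * (1 - 1 / (k:ℝ))
            = -2 * (k:ℝ) * (k * b) - b' * ((3 * k ^ 2 - k) / 2) - g * b - Δ * (1 - 1 / k) * b' := by
          rw [hL]; push_cast; field_simp; ring
        rw [e1, hE]
        have e2 : 0 ≤ Δ * (1 - 1 / (k:ℝ)) := by
          have : 1 / (k:ℝ) ≤ 1 := by rw [div_le_one (by linarith)]; linarith
          exact mul_nonneg hΔ.le (by linarith)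
        have e3 := mul_le_mul_of_nonneg_left hb4 e2
        have e4 := mul_le_mul_of_nonneg_right hg (by linarith : (0:ℝ) ≤ b)
        linarith
      have h4 := Real.rpow_le_rpow_of_exponent_le hP h3
      have h5 : C1 ^ k * P ^ (k * k) * (D * (A * P ^ (-2 * (k:ℝ) * (k * b) - (b' + 1 : ℕ) * ((3 * k ^ 2 - k) / 2) - g' * b))) ≤
          D / 2 * (A * P ^ E) := by
        have e1 : P ^ (k * k) * P ^ (-2 * (k:ℝ) * (k * b) - (b' + 1 : ℕ) * ((3 * k ^ 2 - k) / 2) - g' * b) =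
            P ^ E * P ^ (-((k:ℝ) ^ 2 - k) / 2) := by
          rw [← Real.rpow_natCast P, ← Real.rpow_add hP0, ← Real.rpow_add hP0]
          congr 1; rw [hE]; push_cast; ring
        have e2 : P ^ (-((k:ℝ) ^ 2 - k) / 2) ≤ P⁻¹ := by
          rw [← Real.rpow_neg_one]
          refine Real.rpow_le_rpow_of_exponent_le hP ?_
          nlinarith
        have e3 : C1 ^ k * P ^ (-((k:ℝ) ^ 2 - k) / 2) ≤ 1 / 2 := by
          refine (mul_le_mul_of_nonneg_left e2 (by positivity)).trans ?_
          rw [← div_eq_mul_inv, div_le_iff₀ hP0]; linarith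
        calc _ = D * A * C1 ^ k * (P ^ (k * k) * P ^ (-2 * (k:ℝ) * (k * b) - (b' + 1 : ℕ) * ((3 * k ^ 2 - k) / 2) - g' * b)) := by ring
          _ = D * A * P ^ E * (C1 ^ k * P ^ (-((k:ℝ) ^ 2 - k) / 2)) := by rw [e1]; ring
          _ ≤ D * A * P ^ E * (1 / 2) := by gcongr
          _ = _ := by ring
      have h6 : C1 * ((Cn * (A * P ^ ((k:ℝ) * (k - 3) / 2 * b' - 2 * k ^ 2 * (k * b : ℕ) - g * (k * b : ℕ)))) ^ (1 / (k:ℝ)) *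
          (C * (A * P ^ (-(b' * L)))) ^ (1 - 1 / (k:ℝ))) ≤ D / 2 * (A * P ^ E) := by
        calc _ ≤ C1 * (Cn * C * (A * P ^ E)) := by
              refine mul_le_mul_of_nonneg_left (h2.trans ?_) (by linarith)
              gcongr
          _ = (C1 * (Cn * C)) * (A * P ^ E) := by ring
          _ ≤ _ := by gcongr; linarith
      refine (add_le_add h6 h5).trans (le_of_eq ?_)
      ring
  have hak : a ≤ k * b := hab.trans (Nat.le_mul_of_pos_left _ (by omega))
  have h7 := Ubound (N := N) (u := k * k) hp hkp (by omega) hab ξ η (fun ξ' => main (k * b - b) b (by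
    have := Nat.le_mul_of_pos_left b (show 0 < k by omega)
    omega) le_rfl ξ' η)
  refine h7.trans (le_of_eq ?_)
  have e0 : ((k * (k - 1) / 2 : ℕ) : ℝ) = ((k:ℝ) ^ 2 - k) / 2 := by
    have h2 : 2 * (k * (k - 1) / 2) = k * (k - 1) := Nat.mul_div_cancel' (Nat.even_mul_pred_self k).two_dvd
    have h3 : (2:ℝ) * ((k * (k - 1) / 2 : ℕ) : ℝ) = k * (k - 1) := by
      have := congrArg (Nat.cast (R := ℝ)) h2
      push_cast [Nat.cast_sub (by omega : 1 ≤ k)] at this ⊢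
      exact this
    linarith
  have e1 : P ^ (k * (k - 1) / 2 * (a + b)) * (P ^ (k * (k * b - a)) * P ^ (-2 * k * (k * b) - b * ((3 * k ^ 2 - k) / 2) - g' * b)) =
      P ^ ((k:ℝ) * (k - 3) / 2 * a - 2 * k ^ 2 * b - g' * b) := by
    rw [← Real.rpow_natCast P, ← Real.rpow_natCast P, ← Real.rpow_add hP0, ← Real.rpow_add hP0]
    congr 1
    rw [Nat.cast_mul, e0]
    push_cast [Nat.cast_sub hak]
    ring
  rw [← e1]; ring

end Vino

namespace Vino
open Finset MeasureTheory

def Hyp (k : ℕ) (Δ : ℝ) : Prop := ∃ C : ℝ, 1 ≤ C ∧ ∀ N : ℕ, 1 ≤ N →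
  (Jn (k * (k + 1)) k N : ℝ) ≤ C * (N:ℝ) ^ (3 * ((k:ℝ) ^ 2 + k) / 2 + Δ)

lemma Hyp_mono {k : ℕ} {Δ Δ' : ℝ} (h : Hyp k Δ) (hl : Δ ≤ Δ') : Hyp k Δ' := by
  obtain ⟨C, hC, h⟩ := h
  refine ⟨C, hC, fun N hN => (h N hN).trans ?_⟩
  have : (1:ℝ) ≤ N := by exact_mod_cast hN
  gcongr

lemma Jn_triv (s k N : ℕ) : (Jn s k N : ℝ) ≤ (N:ℝ) ^ (2 * s) := by
  have : Jn s k N ≤ N ^ (2 * s) := by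
    unfold Jn cnt
    refine (card_filter_le _ _).trans ?_
    rw [card_product, Fintype.card_piFinset]
    simp [two_mul, pow_add]
  exact_mod_cast this

lemma HV_of {k : ℕ} {L C : ℝ} (hL : 0 ≤ L) (hC : 1 ≤ C)
    (h : ∀ N : ℕ, 1 ≤ N → (Jn (k * (k + 1)) k N : ℝ) ≤ C * (N:ℝ) ^ L) : HV k L (C * 2 ^ L) := by
  intro N p b η hp hN
  have hpb : 0 < p ^ b := pow_pos hp.pos b
  refine (Vbound _ k N (p ^ b) hpb η 0).trans ((h _ (Nat.le_add_left 1 _)).trans ?_)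
  have hP : (0:ℝ) < p := by exact_mod_cast hp.pos
  have e1 : ((N / p ^ b + 1 : ℕ) : ℝ) ≤ 2 * (N / (p:ℝ) ^ b) := by
    have h1 : ((N / p ^ b : ℕ) : ℝ) ≤ N / (p ^ b : ℕ) := Nat.cast_div_le
    have h2 : (1:ℝ) ≤ N / (p ^ b : ℕ) := by
      rw [le_div_iff₀ (by exact_mod_cast hpb)]; simpa using (by exact_mod_cast hN : ((p ^ b : ℕ):ℝ) ≤ N)
    push_cast at h1 h2 ⊢
    linarith
  calc C * ((N / p ^ b + 1 : ℕ) : ℝ) ^ L ≤ C * (2 * (N / (p:ℝ) ^ b)) ^ L := by gcongr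
    _ = C * 2 ^ L * ((N:ℝ) ^ L * (p:ℝ) ^ (-(b * L))) := by
      rw [Real.mul_rpow (by norm_num) (by positivity), Real.div_rpow (by positivity) (by positivity), Real.rpow_neg hP.le,
        Real.rpow_mul hP.le, Real.rpow_natCast]
      ring

set_option maxHeartbeats 1000000 in
lemma Hyp_step {k : ℕ} (hk : 2 ≤ k) {Δ0 : ℝ} (hΔ0 : 0 < Δ0) : ∃ κ : ℝ, 0 < κ ∧ ∀ Δ, Δ0 ≤ Δ → Hyp k Δ → Hyp k (Δ - κ) := by
  have hk' : (2:ℝ) ≤ k := by exact_mod_cast hk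
  set δ0 := Δ0 * (1 - 1 / (k:ℝ)) with hδ0
  have hk2 : 1 / (k:ℝ) ≤ 1 / 2 := one_div_le_one_div_of_le (by norm_num) hk'
  have hδ : 0 < δ0 := mul_pos hΔ0 (by linarith)
  obtain ⟨n, hn⟩ := exists_nat_ge ((2 * (k:ℝ) ^ 2 + 2 * k + 1) / δ0)
  rw [div_le_iff₀ hδ] at hn
  set γ := min 1 (Δ0 * k) with hγ
  have hγ0 : 0 < γ := by rw [hγ, lt_min_iff]; exact ⟨one_pos, by positivity⟩
  have hγ1 : γ ≤ 1 := min_le_left _ _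
  set M := k ^ n with hM
  have hM1 : 1 ≤ M := Nat.one_le_pow _ _ (by omega)
  have hM1' : (1:ℝ) ≤ M := by exact_mod_cast hM1
  refine ⟨γ / M, by positivity, fun Δ hΔ ⟨C, hC, hJ⟩ => ?_⟩
  set L := 3 * ((k:ℝ) ^ 2 + k) / 2 + Δ with hL
  have hΔp : 0 < Δ := hΔ0.trans_le hΔ
  have hL0 : 0 ≤ L := by positivity
  have hC2 : 1 ≤ C * 2 ^ L := by
    have : (1:ℝ) ≤ 2 ^ L := Real.one_le_rpow (by norm_num) hL0
    nlinarith
  have hV := HV_of hL0 hC hJ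
  have hchain : ∀ n : ℕ, Cl k L (k ^ n) (min (-(2 * (k:ℝ) ^ 2 + 2 * k) + n * δ0) (Δ0 * k)) := by
    intro n
    induction n with
    | zero =>
      have : min (-(2 * (k:ℝ) ^ 2 + 2 * k) + (0:ℕ) * δ0) (Δ0 * k) = -(2 * (k:ℝ) ^ 2 + 2 * k) := by
        rw [min_eq_left]
        · simp
        · have : 0 < Δ0 * k := by positivity
          simp only [Nat.cast_zero, zero_mul, add_zero]; nlinarith
      rw [this, pow_zero]
      exact Cl_zero hk hC2 hL0 hV
    | succ n ih =>
      rw [pow_succ]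
      have h0 : δ0 ≤ Δ * (1 - 1 / (k:ℝ)) := by rw [hδ0]; gcongr; linarith
      refine Cl_step hk (Nat.one_le_pow _ _ (by omega)) (hΔ0.trans_le hΔ) hC2 hL hV ih ?_ ?_
      · rw [← min_add_add_right]
        refine le_min ((min_le_left _ _).trans ?_) ((min_le_right _ _).trans ?_)
        · push_cast; linarith
        · linarith
      · refine (min_le_right _ _).trans ?_
        gcongr
  obtain ⟨Cn, P0, hCn, hU⟩ := hchain n
  set g := min (-(2 * (k:ℝ) ^ 2 + 2 * k) + n * δ0) (Δ0 * k) with hg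
  have hγg : γ ≤ g := min_le_min (by linarith) le_rfl
  obtain ⟨C1, hC1, hJr⟩ := Jrec k (by omega)
  set W := C1 * Cn + C1 ^ (k + 1) * (C * 2 ^ L) with hW
  have hW0 : 0 ≤ W := by positivity
  have key : ∀ (N p : ℕ), p.Prime → P0 ≤ p → p ^ M ≤ N → (Jn (k * (k + 1)) k N : ℝ) ≤ W * ((N:ℝ) ^ L * (p:ℝ) ^ (-γ)) := by
    intro N p hp hp0 hN
    have : NeZero p := ⟨hp.pos.ne'⟩
    have hP : (1:ℝ) ≤ p := by exact_mod_cast hp.one_lt.le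
    have hP0 : (0:ℝ) < p := by linarith
    have h1 := hJr N p _ _ (fun η => hU N p 0 1 0 η hp hp0 le_rfl (by omega) (by simpa using hN))
      (fun η => hV N p 1 η hp (by rw [pow_one]; exact le_trans (Nat.le_self_pow (by omega) p) hN))
    refine h1.trans ?_
    have e1 : (p:ℝ) ^ (2 * (k * k)) * (p:ℝ) ^ ((k:ℝ) * (k - 3) / 2 * (0:ℕ) - 2 * k ^ 2 * (1:ℕ) - g * (1:ℕ)) ≤ (p:ℝ) ^ (-γ) := by
      rw [← Real.rpow_natCast (p:ℝ), ← Real.rpow_add hP0]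
      refine Real.rpow_le_rpow_of_exponent_le hP ?_
      push_cast; linarith only [hγg]
    have e2 : (p:ℝ) ^ (k * (k + 1)) * (p:ℝ) ^ (-((1:ℕ) * L)) ≤ (p:ℝ) ^ (-γ) := by
      rw [← Real.rpow_natCast (p:ℝ), ← Real.rpow_add hP0]
      refine Real.rpow_le_rpow_of_exponent_le hP ?_
      have : (0:ℝ) ≤ (k:ℝ) ^ 2 := by positivity
      push_cast; linarith only [this, hk', hΔp, hL, hγ1]
    have hA : (0:ℝ) ≤ (N:ℝ) ^ L := by positivity
    calc _ = C1 * Cn * ((N:ℝ) ^ L * ((p:ℝ) ^ (2 * (k * k)) * (p:ℝ) ^ ((k:ℝ) * (k - 3) / 2 * (0:ℕ) - 2 * k ^ 2 * (1:ℕ) - g * (1:ℕ)))) +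
          C1 ^ (k + 1) * (C * 2 ^ L) * ((N:ℝ) ^ L * ((p:ℝ) ^ (k * (k + 1)) * (p:ℝ) ^ (-((1:ℕ) * L)))) := by ring
      _ ≤ C1 * Cn * ((N:ℝ) ^ L * (p:ℝ) ^ (-γ)) + C1 ^ (k + 1) * (C * 2 ^ L) * ((N:ℝ) ^ L * (p:ℝ) ^ (-γ)) := by
          gcongr
      _ = _ := by rw [hW]; ring
  set B := max P0 1 with hB
  have hB1 : 1 ≤ B := le_max_right _ _
  set N1 := (2 * B) ^ (M:ℝ) with hN1
  refine ⟨W * 2 ^ γ + (N1 ^ (2 * (k * (k + 1))) + 1), by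
    have : (0:ℝ) ≤ W * 2 ^ γ := by positivity
    have : (0:ℝ) ≤ N1 ^ (2 * (k * (k + 1))) := by positivity
    linarith, fun N hN => ?_⟩
  have hNr : (1:ℝ) ≤ N := by exact_mod_cast hN
  have hexp : 3 * ((k:ℝ) ^ 2 + k) / 2 + (Δ - γ / M) = L - γ / M := by rw [hL]; ring
  rw [hexp]
  have hexp0 : 0 ≤ L - γ / M := by
    have hq : γ / M ≤ 1 := by rw [div_le_one (by linarith)]; linarith
    have : (0:ℝ) ≤ (k:ℝ) ^ 2 := by positivity
    linarith only [hq, this, hk', hΔp, hL]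
  have hone : (1:ℝ) ≤ (N:ℝ) ^ (L - γ / M) := Real.one_le_rpow hNr hexp0
  rcases lt_or_ge (N:ℝ) N1 with hs | hs
  · have h1 : (Jn (k * (k + 1)) k N : ℝ) ≤ N1 ^ (2 * (k * (k + 1))) := (Jn_triv _ _ _).trans (by gcongr)
    have h2 : (0:ℝ) ≤ W * 2 ^ γ := by positivity
    have h3 : (0:ℝ) ≤ N1 ^ (2 * (k * (k + 1))) := by positivity
    refine h1.trans ((le_mul_of_one_le_right h3 hone).trans ?_)
    gcongr
    linarith only [h2]
  · set R := (N:ℝ) ^ (1 / (M:ℝ)) with hR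
    have hR2 : 2 * B ≤ R := by
      have : 2 * B = N1 ^ (1 / (M:ℝ)) := by
        rw [hN1, ← Real.rpow_mul (by positivity), mul_one_div_cancel (by positivity), Real.rpow_one]
      rw [this, hR]; gcongr
    set Y := ⌊R / 2⌋₊ with hY
    have hY1 : Y ≠ 0 := by
      have : 1 ≤ Y := Nat.le_floor (by push_cast; linarith)
      omega
    obtain ⟨p, hp, hp1, hp2⟩ := Nat.exists_prime_lt_and_le_two_mul Y hY1
    have hp3 : R / 2 < p := (Nat.lt_floor_add_one (R / 2)).trans_le (by exact_mod_cast hp1)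
    have hp4 : (p:ℝ) ≤ R := by
      have h1 : (Y:ℝ) ≤ R / 2 := Nat.floor_le (by positivity)
      have h2 : (p:ℝ) ≤ 2 * Y := by exact_mod_cast hp2
      linarith
    have hp5 : p ^ M ≤ N := by
      have : (p:ℝ) ^ M ≤ N := by
        calc (p:ℝ) ^ M ≤ R ^ M := by gcongr
          _ = N := by
            rw [hR, ← Real.rpow_natCast, ← Real.rpow_mul (by positivity), one_div_mul_cancel (by positivity), Real.rpow_one]
      exact_mod_cast this
    have h1 := key N p hp ((le_max_left P0 1).trans (by linarith only [hR2, hp3])) hp5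
    have hR0 : 0 < R := by linarith only [hR2, hB1]
    have h2 : (p:ℝ) ^ (-γ) ≤ 2 ^ γ * (N:ℝ) ^ (-(γ / M)) := by
      calc (p:ℝ) ^ (-γ) ≤ (R / 2) ^ (-γ) := Real.rpow_le_rpow_of_nonpos (by positivity) hp3.le (by linarith)
        _ = _ := by
          rw [Real.div_rpow hR0.le (by norm_num), hR, ← Real.rpow_mul (by positivity), Real.rpow_neg (by norm_num : (0:ℝ) ≤ 2), div_inv_eq_mul, mul_comm]
          congr 2; ring
    calc (Jn (k * (k + 1)) k N : ℝ) ≤ W * ((N:ℝ) ^ L * (2 ^ γ * (N:ℝ) ^ (-(γ / M)))) := h1.trans (by gcongr)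
      _ = W * 2 ^ γ * (N:ℝ) ^ (L - γ / M) := by
        have e : (N:ℝ)^(L-γ/M) = (N:ℝ)^L * (N:ℝ)^(-(γ/M)) := by
          rw [← Real.rpow_add (by linarith only [hNr]), sub_eq_add_neg]
        rw [e]; ring
      _ ≤ _ := by
        gcongr
        have : (0:ℝ) ≤ N1 ^ (2 * (k * (k + 1))) := by positivity
        linarith

/-- Vinogradov mean value theorem at the moment k(k+1) -/
theorem vmvt {k : ℕ} (hk : 1 ≤ k) {ε : ℝ} (hε : 0 < ε) : Hyp k ε := by
  rcases Nat.lt_or_ge 1 k with hk2 | hk1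
  · obtain ⟨κ, hκ, h⟩ := Hyp_step (k := k) hk2 hε
    have : ∀ n : ℕ, Hyp k (max ε (((k:ℝ) ^ 2 + k) / 2 - n * κ)) := by
      intro n
      induction n with
      | zero =>
        refine Hyp_mono (Δ := ((k:ℝ) ^ 2 + k) / 2) ⟨1, le_rfl, fun N hN => ?_⟩ (by simp)
        refine (Jn_triv _ _ _).trans (le_of_eq ?_)
        rw [one_mul, ← Real.rpow_natCast]; congr 1; push_cast; ring
      | succ n ih =>
        refine Hyp_mono (h _ (le_max_left _ _) ih) ?_
        rcases le_total ε (((k:ℝ) ^ 2 + k) / 2 - n * κ) with h1 | h1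
        · rw [max_eq_right h1]; refine le_trans (le_of_eq ?_) (le_max_right _ _); push_cast; ring
        · rw [max_eq_left h1]; refine le_trans ?_ (le_max_left _ _); linarith
    obtain ⟨n, hn⟩ := exists_nat_ge (((k:ℝ) ^ 2 + k) / 2 / κ)
    rw [div_le_iff₀ hκ] at hn
    have h2 := this n
    rwa [max_eq_left (by linarith)] at h2
  · obtain rfl : k = 1 := by omega
    refine Hyp_mono (Δ := 0) ⟨1, le_rfl, fun N hN => ?_⟩ hε.le
    rw [← Jn_eq _ _ _ 0]
    have h1 : cnt (Icc (1:ℤ) N) (pv 1) ≤ N := by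
      unfold cnt
      refine le_trans (card_le_card_of_injOn (t := Icc (1:ℤ) N) (fun z => z.1) ?_ ?_) (by simp)
      · intro z hz; simp only [coe_filter, mem_product, Set.mem_ofPred_eq] at hz; exact mem_coe.mpr hz.1.1
      · intro z hz w hw hzw
        simp only [coe_filter, mem_product, Set.mem_ofPred_eq] at hz hw
        have hz2 := congrFun hz.2 0
        have hw2 := congrFun hw.2 0
        simp only [pv, Fin.val_zero, zero_add, pow_one] at hz2 hw2
        exact Prod.ext hzw (by rw [← hz2, ← hw2]; exact hzw)
    calc _ ≤ ∫ α, (N:ℝ) ^ 2 * ‖S (Icc (1:ℤ) N) (pv 1) α‖ ^ 2 ∂(μ 1 0) := by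
          refine integral_mono (integrable_of_cont 0 (by fun_prop)) (integrable_of_cont 0 (by fun_prop)) fun α => ?_
          simp only
          have := norm_S_le (Icc (1:ℤ) N) (pv 1) α
          simp only [Int.card_Icc, add_sub_cancel_right, Int.toNat_natCast] at this
          rw [show 2 * (1 * (1 + 1)) = 2 + 2 by norm_num, pow_add]
          gcongr
      _ = (N:ℝ) ^ 2 * cnt (Icc (1:ℤ) N) (pv 1) := by rw [integral_const_mul, orth]
      _ ≤ (N:ℝ) ^ 2 * N := by gcongr
      _ = _ := by
          rw [one_mul, ← pow_succ, ← Real.rpow_natCast]; congr 1; norm_num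

end Vino

namespace Vino
open Finset MeasureTheory

/-- two elements of a set of integers which are close -/
lemma close_pair {H : Finset ℤ} {x L : ℝ} (hL : 0 < L) (hH : ∀ h ∈ H, x ≤ h ∧ (h:ℝ) ≤ x + L) (h3 : 3 ≤ #H) :
    ∃ a ∈ H, ∃ b ∈ H, a < b ∧ ((b:ℝ) - a) * #H ≤ 2 * L := by
  have hm : (3:ℝ) ≤ #H := by exact_mod_cast h3
  have hm0 : (0:ℝ) < #H := by linarith
  set w : ℝ := 2 * L / #H with hw
  have hw0 : 0 < w := by positivity
  have hmap : ∀ h ∈ H, ⌊((h:ℝ) - x) / w⌋₊ ∈ range (⌊(#H:ℝ) / 2⌋₊ + 1) := by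
    intro h hh
    obtain ⟨h1, h2⟩ := hH h hh
    rw [mem_range, Nat.lt_succ_iff]
    refine Nat.floor_le_floor ?_
    rw [div_le_iff₀ hw0, hw]
    field_simp
    linarith
  have hcard : #(range (⌊(#H:ℝ) / 2⌋₊ + 1)) < #H := by
    rw [card_range]
    have : (⌊(#H:ℝ) / 2⌋₊ : ℝ) ≤ #H / 2 := Nat.floor_le (by positivity)
    have : ((⌊(#H:ℝ) / 2⌋₊ + 1 : ℕ) : ℝ) < #H := by push_cast; linarith
    exact_mod_cast this
  obtain ⟨a, ha, b, hb, hab, heq⟩ := exists_ne_map_eq_of_card_lt_of_maps_to hcard hmap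
  have key : ∀ a ∈ H, ∀ b ∈ H, a < b → ⌊((a:ℝ) - x) / w⌋₊ = ⌊((b:ℝ) - x) / w⌋₊ → ((b:ℝ) - a) * #H ≤ 2 * L := by
    intro a ha b hb hab heq
    have h1 := Nat.floor_le (a := ((a:ℝ) - x) / w) (div_nonneg (by linarith [(hH a ha).1]) hw0.le)
    have h2 := Nat.lt_floor_add_one (((b:ℝ) - x) / w)
    rw [← heq] at h2
    have h3 : ((b:ℝ) - x) / w < ((a:ℝ) - x) / w + 1 := by linarith
    have h4 : ((b:ℝ) - a) < w := by
      have := mul_lt_mul_of_pos_right h3 hw0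
      rw [add_mul, div_mul_cancel₀ _ hw0.ne', div_mul_cancel₀ _ hw0.ne'] at this
      linarith
    calc ((b:ℝ) - a) * #H ≤ w * #H := by gcongr
      _ = 2 * L := by rw [hw]; field_simp
  rcases lt_or_gt_of_ne hab with h | h
  · exact ⟨a, ha, b, hb, h, key a ha b hb h heq⟩
  · exact ⟨b, hb, a, ha, h, key b hb a ha h heq.symm⟩

lemma small_near {x ε : ℝ} {z : ℤ} (hx : |x| ≤ 1 / 2) (hz : |x - z| ≤ ε) : |x| ≤ ε := by
  by_cases h : z = 0
  · subst h; simpa using hz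
  · have h1 : (1:ℝ) ≤ |(z:ℝ)| := by exact_mod_cast Int.one_le_abs h
    have h2 : |(z:ℝ)| ≤ |x - z| + |x| := by
      have := abs_sub_abs_le_abs_sub (z:ℝ) x
      rw [abs_sub_comm] at this; linarith
    linarith

/-- recurrence lemma -/
lemma recur {H : Finset ℤ} {x L β ε : ℝ} (hL : 0 < L) (hH : ∀ h ∈ H, x ≤ h ∧ (h:ℝ) ≤ x + L)
    (h3 : 3 ≤ #H) (hε : 4 * ε * L ≤ 1) (hε0 : 0 ≤ ε) (hβ : ∀ h ∈ H, ∃ z : ℤ, |(h:ℝ) * β - z| ≤ ε) :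
    ∃ q : ℕ, 1 ≤ q ∧ (q:ℝ) * #H ≤ 2 * L ∧ ∃ z : ℤ, |(q:ℝ) * β - z| * (#H / q - 1) ≤ 2 * ε := by
  obtain ⟨a, ha, b, hb, hab, hlen⟩ := close_pair hL hH h3
  have hdiff : ∀ a ∈ H, ∀ b ∈ H, ∃ z : ℤ, |((b:ℝ) - a) * β - z| ≤ 2 * ε := by
    intro a ha b hb
    obtain ⟨z, hz⟩ := hβ a ha
    obtain ⟨w, hw⟩ := hβ b hb
    refine ⟨w - z, ?_⟩
    have : ((b:ℝ) - a) * β - ((w - z : ℤ) : ℝ) = (b * β - w) - (a * β - z) := by push_cast; ring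
    rw [this]
    exact (abs_sub _ _).trans (by linarith)
  obtain ⟨q, hq⟩ := Int.eq_ofNat_of_zero_le (by omega : 0 ≤ b - a)
  have hqr : (b:ℝ) - a = q := by exact_mod_cast hq
  have hq1 : 1 ≤ q := by omega
  have hq0 : (0:ℝ) < q := by exact_mod_cast hq1
  obtain ⟨z, hz⟩ := hdiff a ha b hb
  rw [hqr] at hlen hz
  refine ⟨q, hq1, hlen, z, ?_⟩
  set θ := (q:ℝ) * β - z with hθ
  -- a residue class
  obtain ⟨n, hqn, h7⟩ : ∃ n : ℕ, q * n < #H ∧ #H ≤ q * (n + 1) := by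
    refine ⟨(#H - 1) / q, ?_, ?_⟩
    · have : q * ((#H - 1) / q) ≤ #H - 1 := Nat.mul_div_le _ _
      omega
    · have := Nat.lt_mul_div_succ (#H - 1) (b := q) (by omega)
      omega
  have hmap : ∀ h ∈ H, h % (q:ℤ) ∈ Ico (0:ℤ) q := fun h _ =>
    mem_Ico.mpr ⟨Int.emod_nonneg _ (by omega), Int.emod_lt_of_pos _ (by omega)⟩
  obtain ⟨c, hc, hcard⟩ := exists_lt_card_fiber_of_mul_lt_card_of_maps_to hmap (n := n) (by simpa using hqn)
  set F := {h ∈ H | h % (q:ℤ) = c} with hF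
  have hne : F.Nonempty := card_pos.mp (by omega)
  set u := F.min' hne with hu
  set v := F.max' hne with hv
  have huF := F.min'_mem hne
  have hvF := F.max'_mem hne
  rw [← hu] at huF
  rw [← hv] at hvF
  have huH : u ∈ H := (mem_filter.mp huF).1
  have hvH : v ∈ H := (mem_filter.mp hvF).1
  have hdvd : (q:ℤ) ∣ v - u := by
    have h1 := (mem_filter.mp huF).2
    have h2 := (mem_filter.mp hvF).2
    exact Int.ModEq.dvd (show u ≡ v [ZMOD q] from h1.trans h2.symm)
  obtain ⟨M, hM⟩ := hdvd
  have hnM : (n:ℤ) ≤ M := by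
    have hsub : F ⊆ image (fun i : ℤ => u + q * i) (Icc 0 M) := by
      intro h hh
      have h1 := (mem_filter.mp hh).2
      have h2 := (mem_filter.mp huF).2
      obtain ⟨j, hj⟩ := Int.ModEq.dvd (show u ≡ h [ZMOD q] from h2.trans h1.symm)
      have h3 : u ≤ h := F.min'_le _ hh
      have h4 : h ≤ v := F.le_max' _ hh
      have hq' : (0:ℤ) < q := by omega
      refine mem_image.mpr ⟨j, mem_Icc.mpr ⟨?_, ?_⟩, by linarith⟩
      · by_contra hneg
        push Not at hneg
        nlinarith
      · by_contra hneg
        push Not at hneg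
        nlinarith
    have h1 := (card_le_card hsub).trans card_image_le
    rw [Int.card_Icc] at h1
    omega
  have hMr : (v:ℝ) - u = q * M := by exact_mod_cast hM
  have hM0 : (0:ℝ) ≤ M := by
    have : (0:ℤ) ≤ M := by omega
    exact_mod_cast this
  obtain ⟨y, hy⟩ := hdiff u huH v hvH
  have hy2 : |M * θ - ((y - M * z : ℤ) : ℝ)| ≤ 2 * ε := by
    have : M * θ - ((y - M * z : ℤ) : ℝ) = ((v:ℝ) - u) * β - y := by rw [hMr, hθ]; push_cast; ring
    rw [this]; exact hy
  have hML : (M:ℝ) ≤ L := by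
    have h1 : (q:ℝ) * M ≤ L := by
      rw [← hMr]; linarith [(hH u huH).1, (hH v hvH).2]
    have : (1:ℝ) ≤ q := by exact_mod_cast hq1
    nlinarith
  have hsm : |M * θ| ≤ 1 / 2 := by
    rw [abs_mul, abs_of_nonneg hM0]
    calc (M:ℝ) * |θ| ≤ L * (2 * ε) := by gcongr
      _ ≤ 1 / 2 := by linarith
  have h5 := small_near hsm hy2
  rw [abs_mul, abs_of_nonneg hM0] at h5
  have h6 : (#H:ℝ) / q - 1 ≤ M := by
    have h8 : (#H:ℝ) ≤ q * (n + 1) := by exact_mod_cast h7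
    have h9 : (n:ℝ) ≤ M := by exact_mod_cast hnM
    have : (#H:ℝ) / q ≤ n + 1 := by rw [div_le_iff₀ hq0]; linarith
    linarith
  calc |θ| * (#H / q - 1) ≤ |θ| * M := by gcongr
    _ ≤ 2 * ε := by linarith

/-- polynomials via differences -/
def PolyLead : ℕ → (ℤ → ℝ) → ℝ → Prop
  | 0, φ, β => ∀ n, φ n = β
  | k + 1, φ, β => ∀ h : ℤ, PolyLead k (fun n => φ (n + h) - φ n) (h * β)

lemma PolyLead.add : ∀ {k : ℕ} {φ ψ : ℤ → ℝ} {β γ : ℝ}, PolyLead k φ β → PolyLead k ψ γ →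
    PolyLead k (fun n => φ n + ψ n) (β + γ)
  | 0, _, _, _, _, h1, h2 => fun n => by simp only [h1 n, h2 n]
  | k + 1, φ, ψ, β, γ, h1, h2 => fun h => by
    have := (h1 h).add (h2 h)
    convert this using 1
    · ext n; ring
    · ring

lemma PolyLead.smul : ∀ {k : ℕ} {φ : ℤ → ℝ} {β : ℝ} (c : ℝ), PolyLead k φ β →
    PolyLead k (fun n => c * φ n) (c * β)
  | 0, _, _, _, h1 => fun n => by simp only [h1 n]
  | k + 1, φ, β, c, h1 => fun h => by
    have := (h1 h).smul c
    convert this using 1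
    · ext n; ring
    · ring

lemma PolyLead.shift : ∀ {k : ℕ} {φ : ℤ → ℝ} {β : ℝ} (c : ℤ), PolyLead k φ β →
    PolyLead k (fun n => φ (n + c)) β
  | 0, _, _, c, h1 => fun n => h1 _
  | k + 1, φ, β, c, h1 => fun h => by
    have := (h1 h).shift c
    convert this using 1
    ext n; ring_nf

lemma PolyLead.up {k : ℕ} {φ : ℤ → ℝ} {β : ℝ} (h : PolyLead k φ β) : PolyLead (k + 1) φ 0 := fun c => by
  have := (h.shift c).add (h.smul (-1))
  convert this using 1
  · ext n; ring
  · ring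

lemma PolyLead.mulLin (a b : ℝ) : ∀ {k : ℕ} {φ : ℤ → ℝ} {β : ℝ}, PolyLead k φ β →
    PolyLead (k + 1) (fun n => (a * n + b) * φ n) ((k + 1) * (a * β))
  | 0, φ, β, h => fun c n => by simp only [h _]; push_cast; ring
  | k + 1, φ, β, h => fun c => by
    have := ((h c).mulLin a b).add ((h.shift c).smul (a * c))
    convert this using 1
    · ext n; push_cast; ring
    · push_cast; ring

lemma PolyLead.linPow (a b : ℝ) : ∀ k : ℕ, PolyLead k (fun n => (a * n + b) ^ k) (k.factorial * a ^ k)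
  | 0 => fun n => by simp
  | k + 1 => by
    have := (PolyLead.linPow a b k).mulLin a b
    convert this using 1
    · ext n; ring
    · rw [Nat.factorial_succ]; push_cast; ring

/-- sums of lower powers -/
lemma PolyLead.poly (a b : ℝ) (α : ℕ → ℝ) : ∀ k : ℕ,
    PolyLead k (fun n => ∑ i ∈ range (k + 1), α i * (a * n + b) ^ i) (α k * (k.factorial * a ^ k))
  | 0 => fun n => by simp
  | k + 1 => by
    have := (PolyLead.poly a b α k).up.add ((PolyLead.linPow a b (k + 1)).smul (α (k + 1)))
    convert this using 1
    · ext n; rw [sum_range_succ]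
    · ring

end Vino

namespace Vino
open Finset MeasureTheory

/-- Weyl inverse property for the leading coefficient -/
def SP (k : ℕ) : Prop := ∃ A : ℕ, ∃ C : ℝ, 1 ≤ C ∧ ∀ (φ : ℤ → ℝ) (β : ℝ), PolyLead k φ β →
  ∀ (N : ℕ) (a b : ℤ), 1 ≤ N → b ≤ a + N → ∀ D : ℝ, 1 ≤ D → (N:ℝ) / D ≤ ‖∑ n ∈ Ico a b, e (φ n)‖ →
  ∃ q : ℕ, 1 ≤ q ∧ (q:ℝ) ≤ C * D ^ A ∧ ∃ z : ℤ, |(q:ℝ) * β - z| ≤ C * D ^ A / (N:ℝ) ^ k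

lemma e_sub_one_ge (β : ℝ) : 4 * |β - round β| ≤ ‖e β - 1‖ := by
  set θ := β - round β with hθ
  have h1 : e β = e θ := by
    rw [hθ, ← e_add_int (β - round β) (round β)]; congr 1; ring
  have h2 : |θ| ≤ 1 / 2 := abs_sub_round β
  rw [h1]
  unfold e
  rw [mul_comm (_ : ℂ) Complex.I, Complex.norm_exp_I_mul_ofReal_sub_one, Real.norm_eq_abs, abs_mul]
  have h3 : |Real.sin (2 * Real.pi * θ / 2)| = Real.sin (Real.pi * |θ|) := by
    rw [show 2 * Real.pi * θ / 2 = Real.pi * θ by ring]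
    rcases le_total 0 θ with h | h
    · rw [abs_of_nonneg h, abs_of_nonneg]
      rw [abs_of_nonneg h] at h2
      exact Real.sin_nonneg_of_nonneg_of_le_pi (by positivity) (by nlinarith [Real.pi_pos])
    · rw [abs_of_nonpos h]
      rw [abs_of_nonpos h] at h2
      rw [mul_neg, Real.sin_neg, abs_of_nonpos]
      exact Real.sin_nonpos_of_nonpos_of_neg_pi_le (by nlinarith [Real.pi_pos]) (by nlinarith [Real.pi_pos])
  rw [h3]
  have h4 := Real.mul_le_sin (x := Real.pi * |θ|) (by positivity) (by nlinarith [Real.pi_pos])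
  have h5 : 2 / Real.pi * (Real.pi * |θ|) = 2 * |θ| := by field_simp
  rw [h5] at h4
  simp only [abs_two]
  linarith

lemma SP_one : SP 1 := by
  refine ⟨1, 1, le_refl _, fun φ β h N a b hN hab D hD hS => ⟨1, le_refl _, by simpa using hD, round β, ?_⟩⟩
  have hN0 : (0:ℝ) < N := by exact_mod_cast hN
  have hstep : ∀ n, e (φ (n + 1)) = e (φ n) * e β := by
    intro n
    have := h 1 n
    rw [← e_add]; congr 1
    push_cast at this; linarith
  have htel : ∀ m : ℕ, (e β - 1) * ∑ n ∈ Ico a (a + m), e (φ n) = e (φ (a + m)) - e (φ a) := by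
    intro m
    induction m with
    | zero => simp
    | succ m ih =>
      have h1 : Ico a (a + (m + 1 : ℕ)) = insert (a + m) (Ico a (a + m)) := by
        ext x; simp only [mem_Ico, mem_insert]; push_cast; omega
      rw [h1, sum_insert (by simp), mul_add, ih]
      have h2 : a + ((m + 1 : ℕ):ℤ) = (a + m) + 1 := by push_cast; ring
      rw [h2, hstep]; ring
  have hbd : ‖(e β - 1) * ∑ n ∈ Ico a b, e (φ n)‖ ≤ 2 := by
    rcases le_total a b with hab' | hab'
    · obtain ⟨m, hm⟩ := Int.eq_ofNat_of_zero_le (by omega : 0 ≤ b - a)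
      have : b = a + m := by omega
      rw [this, htel]
      refine (norm_sub_le _ _).trans ?_
      rw [norm_e, norm_e]; norm_num
    · rw [Ico_eq_empty (by omega)]; simp
  rw [norm_mul] at hbd
  have h1 : 4 * |β - round β| * (N / D) ≤ 2 :=
    (mul_le_mul (e_sub_one_ge β) hS (by positivity) (norm_nonneg _)).trans hbd
  rw [Nat.cast_one, one_mul, one_mul, pow_one, pow_one, le_div_iff₀ hN0]
  have hD0 : 0 < D := by linarith
  have h2 : 4 * |β - round β| * (N / D) * D ≤ 2 * D := by gcongr
  have h3 : 4 * |β - round β| * (N / D) * D = 4 * |β - round β| * N := by field_simp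
  rw [h3] at h2
  have : 0 ≤ |β - round β| * N := by positivity
  linarith

lemma vdc (φ : ℤ → ℝ) (N : ℕ) (a b : ℤ) (hab : b ≤ a + N) :
    ‖∑ n ∈ Ico a b, e (φ n)‖ ^ 2 ≤ ∑ h ∈ Ioo (-(N:ℤ)) N,
      ‖∑ n ∈ Ico (max a (a - h)) (min b (b - h)), e (φ (n + h) - φ n)‖ := by
  have h1 : ((‖∑ n ∈ Ico a b, e (φ n)‖ ^ 2 : ℝ) : ℂ) = ∑ h ∈ Ioo (-(N:ℤ)) N,
      ∑ n ∈ Ico (max a (a - h)) (min b (b - h)), e (φ (n + h) - φ n) := by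
    rw [← Complex.normSq_eq_norm_sq, ← Complex.mul_conj, map_sum, sum_mul_sum, ← sum_product', sum_sigma']
    refine sum_bij' (fun z _ => ⟨z.1 - z.2, z.2⟩) (fun z _ => (z.2 + z.1, z.2)) ?_ ?_ ?_ ?_ ?_
    · rintro ⟨x, y⟩ hz
      simp only [mem_product, mem_Ico, mem_sigma, mem_Ioo] at hz ⊢
      refine ⟨by omega, ?_, ?_⟩ <;> simp only [max_le_iff, lt_min_iff] <;> omega
    · rintro ⟨x, y⟩ hz
      simp only [mem_product, mem_Ico, mem_sigma, mem_Ioo, max_le_iff, lt_min_iff] at hz ⊢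
      omega
    · rintro ⟨x, y⟩ hz; simp
    · rintro ⟨x, y⟩ hz; simp
    · rintro ⟨x, y⟩ hz
      simp only [add_sub_cancel, ← e_neg, ← e_add]
      rfl
  calc ‖∑ n ∈ Ico a b, e (φ n)‖ ^ 2 = ‖((‖∑ n ∈ Ico a b, e (φ n)‖ ^ 2 : ℝ) : ℂ)‖ := by
        rw [Complex.norm_real, Real.norm_of_nonneg (by positivity)]
    _ ≤ _ := by rw [h1]; exact norm_sum_le _ _

lemma vdc_many (φ : ℤ → ℝ) (N : ℕ) (a b : ℤ) (hN : 1 ≤ N) (hab : b ≤ a + N) {D : ℝ} (hD : 1 ≤ D)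
    (hS : (N:ℝ) / D ≤ ‖∑ n ∈ Ico a b, e (φ n)‖) :
    ∃ G ⊆ Ioo (-(N:ℤ)) N, (N:ℝ) / (2 * D ^ 2) ≤ #G ∧ ∀ h ∈ G, (N:ℝ) / (4 * D ^ 2) ≤
      ‖∑ n ∈ Ico (max a (a - h)) (min b (b - h)), e (φ (n + h) - φ n)‖ := by
  classical
  set T : ℤ → ℝ := fun h => ‖∑ n ∈ Ico (max a (a - h)) (min b (b - h)), e (φ (n + h) - φ n)‖ with hT
  have hN0 : (0:ℝ) < N := by exact_mod_cast hN
  have hTN : ∀ h, T h ≤ N := by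
    intro h
    refine (norm_sum_le _ _).trans ?_
    simp only [norm_e, sum_const, Int.card_Ico, nsmul_eq_mul, mul_one]
    have : (min b (b - h) - max a (a - h)).toNat ≤ N := by omega
    exact_mod_cast this
  refine ⟨{h ∈ Ioo (-(N:ℤ)) N | (N:ℝ) / (4 * D ^ 2) ≤ T h}, filter_subset _ _, ?_, fun h hh => (mem_filter.mp hh).2⟩
  set G := {h ∈ Ioo (-(N:ℤ)) N | (N:ℝ) / (4 * D ^ 2) ≤ T h} with hG
  have h1 := vdc φ N a b hab
  have h2 : ∑ h ∈ Ioo (-(N:ℤ)) N, T h ≤ #G * N + 2 * N * (N / (4 * D ^ 2)) := by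
    rw [← sum_filter_add_sum_filter_not _ (fun h => (N:ℝ) / (4 * D ^ 2) ≤ T h)]
    refine add_le_add ?_ ?_
    · refine (sum_le_card_nsmul _ _ (N:ℝ) (fun h _ => hTN h)).trans ?_
      rw [nsmul_eq_mul]
    · refine (sum_le_card_nsmul _ _ ((N:ℝ) / (4 * D ^ 2)) (fun h hh => ?_)).trans ?_
      · exact (not_le.mp (mem_filter.mp hh).2).le
      · rw [nsmul_eq_mul]
        gcongr
        have : #{h ∈ Ioo (-(N:ℤ)) N | ¬ (N:ℝ) / (4 * D ^ 2) ≤ T h} ≤ 2 * N :=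
          (card_filter_le _ _).trans (by rw [Int.card_Ioo]; omega)
        exact_mod_cast this
  have h3 : ((N:ℝ) / D) ^ 2 ≤ #G * N + 2 * N * (N / (4 * D ^ 2)) :=
    ((pow_le_pow_left₀ (by positivity) hS 2).trans h1).trans h2
  have hD0 : 0 < D := by linarith
  rw [div_le_iff₀ (by positivity)]
  have h4 : ((N:ℝ) / D) ^ 2 - 2 * N * (N / (4 * D ^ 2)) = N * (N / (2 * D ^ 2)) := by field_simp; norm_num
  have h5 : N * ((N:ℝ) / (2 * D ^ 2)) ≤ N * #G := by linarith
  have h6 := le_of_mul_le_mul_left h5 hN0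
  rwa [div_le_iff₀ (by positivity)] at h6

set_option maxHeartbeats 1000000 in
lemma SP_step {k : ℕ} (hk : 1 ≤ k) (h : SP k) : SP (k + 1) := by
  classical
  obtain ⟨A, C, hC, h⟩ := h
  refine ⟨(2 * A + 2) * 4 * (k + 1), (648 * (C * 4 ^ A) ^ 4) ^ (k + 1), ?_, ?_⟩
  · refine one_le_pow₀ ?_
    have : 1 ≤ (C * 4 ^ A) ^ 4 := one_le_pow₀ (one_le_mul_of_one_le_of_one_le hC (one_le_pow₀ (by norm_num)))
    linarith
  intro φ β hφ N a b hN hab D hD hS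
  have hN0 : (0:ℝ) < N := by exact_mod_cast hN
  have hN1 : (1:ℝ) ≤ N := by exact_mod_cast hN
  have hD0 : 0 < D := by linarith
  obtain ⟨Q, hQ⟩ : ∃ Q : ℝ, Q = C * (4 * D ^ 2) ^ A := ⟨_, rfl⟩
  have hD2 : 1 ≤ D ^ 2 := one_le_pow₀ hD
  have hQ1 : 1 ≤ Q := by
    rw [hQ]; exact one_le_mul_of_one_le_of_one_le hC (one_le_pow₀ (by linarith))
  obtain ⟨E, hE⟩ : ∃ E : ℝ, E = D ^ 2 * Q := ⟨_, rfl⟩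
  have hE1 : 1 ≤ E := by rw [hE]; exact one_le_mul_of_one_le_of_one_le hD2 hQ1
  have hQE : Q ≤ E := by rw [hE]; exact le_mul_of_one_le_left (by linarith) hD2
  have hfin : (648 * (C * 4 ^ A) ^ 4) ^ (k + 1) * D ^ ((2 * A + 2) * 4 * (k + 1)) = (648 * E ^ 4) ^ (k + 1) := by
    rw [hE, hQ, pow_mul D, ← mul_pow]
    congr 1
    rw [pow_mul, mul_pow 4, ← pow_mul D 2 A, pow_add]
    ring
  rw [hfin]
  have hbig : 648 * E ^ 4 ≤ (648 * E ^ 4) ^ (k + 1) := by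
    refine le_self_pow₀ ?_ (by omega)
    have : 1 ≤ E ^ 4 := one_le_pow₀ hE1
    linarith
  have hE34 : E ^ 3 ≤ E ^ 4 := pow_le_pow_right₀ hE1 (by norm_num)
  have hE24 : E ^ 2 ≤ E ^ 4 := pow_le_pow_right₀ hE1 (by norm_num)
  have hE3 : 1 ≤ E ^ 3 := one_le_pow₀ hE1
  have hE2 : 1 ≤ E ^ 2 := one_le_pow₀ hE1
  rcases lt_or_ge (N:ℝ) (324 * E ^ 3) with hsm | hbg
  · refine ⟨1, le_refl _, by push_cast; linarith, round β, ?_⟩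
    rw [le_div_iff₀ (by positivity), Nat.cast_one, one_mul]
    have h1 : |β - round β| ≤ 1 := (abs_sub_round β).trans (by norm_num)
    calc |β - round β| * (N:ℝ) ^ (k + 1) ≤ 1 * (648 * E ^ 4) ^ (k + 1) := by
          gcongr; linarith
      _ = _ := one_mul _
  obtain ⟨G, hG, hGc, hGS⟩ := vdc_many φ N a b hN hab hD hS
  have hq : ∀ h' ∈ G, ∃ q : ℕ, 1 ≤ q ∧ (q:ℝ) ≤ Q ∧ ∃ z : ℤ, |(q:ℝ) * (h' * β) - z| ≤ Q / (N:ℝ) ^ k := by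
    intro h' hh'
    rw [hQ]
    exact h _ _ (hφ h') N _ _ hN (by omega) (4 * D ^ 2) (by linarith) (hGS h' hh')
  choose! q hq1 hqQ hqz using hq
  obtain ⟨L, hL⟩ : ∃ L : ℝ, L = N / (4 * Q) := ⟨_, rfl⟩
  have hQ0 : 0 < Q := by linarith
  have hL0 : 0 < L := by rw [hL]; positivity
  have hmaps : ∀ h' ∈ G, (q h', ⌊((h':ℝ) + N) / L⌋₊) ∈ Icc 1 ⌊Q⌋₊ ×ˢ range (⌊8 * Q⌋₊ + 1) := by
    intro h' hh'
    have h1 := mem_Ioo.mp (hG hh')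
    have h2 : (h':ℝ) ≤ N := by exact_mod_cast h1.2.le
    refine mem_product.mpr ⟨mem_Icc.mpr ⟨hq1 h' hh', Nat.le_floor (hqQ h' hh')⟩, ?_⟩
    rw [mem_range, Nat.lt_succ_iff]
    refine Nat.floor_le_floor ?_
    rw [div_le_iff₀ hL0, hL]
    have : 8 * Q * (N / (4 * Q)) = 2 * N := by field_simp; norm_num
    rw [this]; linarith
  have hcardle : #(Icc 1 ⌊Q⌋₊ ×ˢ range (⌊8 * Q⌋₊ + 1)) • ((N:ℝ) / (18 * E * Q)) ≤ (#G : ℝ) := by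
    refine le_trans ?_ hGc
    rw [nsmul_eq_mul, card_product, Nat.card_Icc, card_range]
    have h1 : (⌊Q⌋₊ : ℝ) ≤ Q := Nat.floor_le hQ0.le
    have h2 : (⌊8 * Q⌋₊ : ℝ) ≤ 8 * Q := Nat.floor_le (by positivity)
    have h3 : ((((⌊Q⌋₊ + 1 - 1) * (⌊8 * Q⌋₊ + 1) : ℕ)) : ℝ) ≤ Q * (9 * Q) := by
      rw [Nat.add_sub_cancel]; push_cast
      gcongr
      linarith
    calc _ ≤ Q * (9 * Q) * ((N:ℝ) / (18 * E * Q)) := by gcongr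
      _ = N / (2 * D ^ 2) := by rw [hE]; field_simp; norm_num
  obtain ⟨⟨q0, y0⟩, hy, hcard⟩ := exists_le_card_fiber_of_nsmul_le_card_of_maps_to hmaps ⟨(1, 0), by
    refine mem_product.mpr ⟨mem_Icc.mpr ⟨le_refl _, Nat.le_floor (by simpa using hQ1)⟩, by simp⟩⟩ hcardle
  set H := {x ∈ G | (q x, ⌊((x:ℝ) + N) / L⌋₊) = (q0, y0)} with hH
  have hHm : ∀ x ∈ H, x ∈ G ∧ q x = q0 ∧ ⌊((x:ℝ) + N) / L⌋₊ = y0 := by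
    intro x hx
    have := mem_filter.mp hx
    exact ⟨this.1, (Prod.mk.inj this.2).1, (Prod.mk.inj this.2).2⟩
  have hq0 : 1 ≤ q0 ∧ (q0:ℝ) ≤ Q := by
    have := mem_Icc.mp (mem_product.mp hy).1
    exact ⟨this.1, (Nat.cast_le.mpr this.2).trans (Nat.floor_le hQ0.le)⟩
  -- apply recurrence
  have hEQ : 18 * E * Q ≤ 18 * E ^ 2 := by nlinarith
  have hcard2 : (N:ℝ) / (18 * E ^ 2) ≤ #H := le_trans (by gcongr) hcard
  have hc18 : 18 * E ≤ #H := by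
    refine le_trans ?_ hcard2
    rw [le_div_iff₀ (by positivity)]
    calc 18 * E * (18 * E ^ 2) = 324 * E ^ 3 := by ring
      _ ≤ (N:ℝ) := hbg
  have hH3 : 3 ≤ #H := by
    have : (3:ℝ) ≤ #H := by linarith
    exact_mod_cast this
  obtain ⟨q1, hq11, hq12, z, hz⟩ := recur (H := H) (x := y0 * L - N) (L := L) (β := q0 * β) (ε := Q / (N:ℝ) ^ k) hL0
    (by
      intro x hx
      obtain ⟨hxG, -, hxy⟩ := hHm x hx
      have h1 := mem_Ioo.mp (hG hxG)
      have h2 : (-(N:ℝ)) ≤ x := by exact_mod_cast h1.1.le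
      have h3 : (y0:ℝ) ≤ ((x:ℝ) + N) / L := by rw [← hxy]; exact Nat.floor_le (div_nonneg (by linarith) hL0.le)
      have h4 : ((x:ℝ) + N) / L < y0 + 1 := by rw [← hxy]; exact Nat.lt_floor_add_one _
      rw [le_div_iff₀ hL0] at h3
      rw [div_lt_iff₀ hL0] at h4
      constructor <;> linarith) hH3
    (by
      have h1 : (N:ℝ) ≤ (N:ℝ) ^ k := le_self_pow₀ hN1 (by omega)
      have h2 : Q / (N:ℝ) ^ k ≤ Q / N := by gcongr
      calc 4 * (Q / (N:ℝ) ^ k) * L ≤ 4 * (Q / N) * L := by gcongr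
        _ = 1 := by rw [hL]; field_simp)
    (by positivity)
    (by
      intro x hx
      obtain ⟨hxG, hxq, -⟩ := hHm x hx
      obtain ⟨z, hz⟩ := hqz x hxG
      rw [hxq] at hz
      refine ⟨z, ?_⟩
      rw [show (x:ℝ) * (q0 * β) = q0 * (x * β) by ring]
      exact hz)
  have hq10 : (0:ℝ) < q1 := by exact_mod_cast hq11
  have hq1E : (q1:ℝ) ≤ 9 * E := by
    have h1 : (q1:ℝ) * (N / (18 * E * Q)) ≤ 2 * L := le_trans (by gcongr) hq12
    rw [hL, mul_div_assoc', div_le_iff₀ (by positivity)] at h1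
    have h2 : 2 * ((N:ℝ) / (4 * Q)) * (18 * E * Q) = 9 * E * N := by field_simp; norm_num
    rw [h2] at h1
    exact le_of_mul_le_mul_right h1 hN0
  have hMn : (N:ℝ) / (324 * E ^ 3) ≤ #H / q1 - 1 := by
    have h1 : (N:ℝ) / (18 * E ^ 2) / (9 * E) ≤ #H / q1 := by gcongr
    have h2 : (N:ℝ) / (18 * E ^ 2) / (9 * E) = 2 * (N / (324 * E ^ 3)) := by field_simp; norm_num
    have h3 : 1 ≤ (N:ℝ) / (324 * E ^ 3) := by rw [one_le_div (by positivity)]; exact hbg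
    linarith
  refine ⟨q0 * q1, Nat.mul_pos hq0.1 hq11, ?_, z, ?_⟩
  · push_cast
    calc (q0:ℝ) * q1 ≤ E * (9 * E) := by gcongr; exact hq0.2.trans hQE
      _ = 9 * E ^ 2 := by ring
      _ ≤ _ := by linarith
  · rw [show ((q0 * q1 : ℕ):ℝ) * β = q1 * (q0 * β) by push_cast; ring]
    refine le_trans ?_ (div_le_div_of_nonneg_right hbig (by positivity))
    have h1 : |(q1:ℝ) * (q0 * β) - z| * (N / (324 * E ^ 3)) ≤ 2 * (E / (N:ℝ) ^ k) :=
      ((mul_le_mul_of_nonneg_left hMn (abs_nonneg _)).trans hz).trans (by gcongr)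
    rw [mul_div_assoc', div_le_iff₀ (by positivity)] at h1
    rw [le_div_iff₀ (by positivity), pow_succ]
    calc |(q1:ℝ) * (q0 * β) - z| * ((N:ℝ) ^ k * N) = |(q1:ℝ) * (q0 * β) - z| * N * (N:ℝ) ^ k := by ring
      _ ≤ 2 * (E / (N:ℝ) ^ k) * (324 * E ^ 3) * (N:ℝ) ^ k := by gcongr
      _ = 648 * E ^ 4 := by field_simp; norm_num

lemma SP_all (k : ℕ) : SP (k + 1) := by
  induction k with
  | zero => exact SP_one
  | succ k ih => exact SP_step (by omega) ih

end Vino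

namespace Vino
open Finset MeasureTheory

lemma conv_Ico (F : Finset ℤ) (hF : ∀ x ∈ F, ∀ y ∈ F, ∀ z, x ≤ z → z ≤ y → z ∈ F) {L : ℕ} (hL : #F ≤ L) :
    ∃ a b : ℤ, F = Ico a b ∧ b ≤ a + L := by
  rcases F.eq_empty_or_nonempty with h | h
  · exact ⟨0, 0, by simp [h], by omega⟩
  · have heq : F = Ico (F.min' h) (F.max' h + 1) := by
      ext x
      rw [mem_Ico]
      constructor
      · intro hx
        have h1 := F.min'_le x hx
        have h2 := F.le_max' x hx
        omega
      · rintro ⟨h1, h2⟩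
        exact hF _ (F.min'_mem h) _ (F.max'_mem h) x h1 (by omega)
    refine ⟨_, _, heq, ?_⟩
    rw [heq, Int.card_Ico] at hL
    omega

/-- averaging over short progressions -/
lemma avg_prog (g : ℤ → ℂ) (N q L : ℕ) (hqL : q * L ≤ N) {B : ℝ}
    (hB : ∀ n0 : ℤ, ‖∑ m ∈ Ico (0:ℤ) L with 1 ≤ n0 + q * m ∧ n0 + q * m ≤ N, g (n0 + q * m)‖ ≤ B) :
    L * ‖∑ n ∈ Icc (1:ℤ) N, g n‖ ≤ 2 * N * B := by
  have h1 : (L:ℂ) * ∑ n ∈ Icc (1:ℤ) N, g n = ∑ n0 ∈ Ioc (-(q * L : ℤ)) N,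
      ∑ m ∈ Ico (0:ℤ) L with 1 ≤ n0 + q * m ∧ n0 + q * m ≤ N, g (n0 + q * m) := by
    simp_rw [sum_filter]
    rw [sum_comm]
    have : ∀ m ∈ Ico (0:ℤ) L, (∑ x ∈ Ioc (-(q * L : ℤ)) N, if 1 ≤ x + q * m ∧ x + q * m ≤ N then g (x + q * m) else 0)
        = ∑ n ∈ Icc (1:ℤ) N, g n := by
      intro m hm
      rw [mem_Ico] at hm
      rw [← sum_filter]
      have hqm : (0:ℤ) ≤ q * m := mul_nonneg (by positivity) hm.1
      have hqm2 : (q:ℤ) * m ≤ q * L := by gcongr; exact hm.2.le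
      refine sum_bij' (fun x _ => x + q * m) (fun x _ => x - q * m) ?_ ?_ ?_ ?_ ?_
      · intro x hx; simp only [mem_filter, mem_Icc] at hx ⊢; exact hx.2
      · intro x hx; simp only [mem_filter, mem_Icc, mem_Ioc] at hx ⊢; omega
      · intro x hx; simp
      · intro x hx; simp
      · intro x hx; rfl
    rw [sum_congr rfl this]
    simp
  have h2 : (L:ℝ) * ‖∑ n ∈ Icc (1:ℤ) N, g n‖ = ‖(L:ℂ) * ∑ n ∈ Icc (1:ℤ) N, g n‖ := by
    rw [norm_mul, Complex.norm_natCast]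
  rw [h2, h1]
  have hB0 : 0 ≤ B := (norm_nonneg _).trans (hB 0)
  refine (norm_sum_le_of_le _ (fun n0 _ => hB n0)).trans ?_
  rw [sum_const, nsmul_eq_mul, Int.card_Ioc]
  gcongr
  have : ((N:ℤ) - -(q * L : ℤ)).toNat ≤ 2 * N := by
    have : (q:ℤ) * L ≤ N := by exact_mod_cast hqL
    omega
  exact_mod_cast this

lemma high_one {α Q : ℝ} {q N L i : ℕ} {z n ν : ℤ} (hq : 1 ≤ q) (hN : 1 ≤ N) (hi : 1 ≤ i)
    (hz : |(q:ℝ) * α - z| ≤ Q / (N:ℝ) ^ i) (hn : 1 ≤ n ∧ n ≤ N) (hν : 1 ≤ ν ∧ ν ≤ N)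
    (hd : (q:ℤ) ∣ n - ν) (hL : |n - ν| ≤ q * L) :
    ∃ w : ℤ, |α * (n:ℝ) ^ i - α * (ν:ℝ) ^ i - w| ≤ i * Q * L / N := by
  obtain ⟨y, hy⟩ := hd.trans (sub_dvd_pow_sub_pow n ν i)
  refine ⟨z * y, ?_⟩
  have hq0 : (0:ℝ) < q := by exact_mod_cast hq
  have hN0 : (0:ℝ) < N := by exact_mod_cast hN
  have hyr : (n:ℝ) ^ i - (ν:ℝ) ^ i = q * y := by exact_mod_cast hy
  have h1 : α * (n:ℝ) ^ i - α * (ν:ℝ) ^ i - ((z * y : ℤ) : ℝ) = (q * α - z) * (((n:ℝ) ^ i - (ν:ℝ) ^ i) / q) := by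
    rw [← mul_sub, hyr, mul_div_cancel_left₀ _ hq0.ne']; push_cast; ring
  have hn1 : |(n:ℝ)| ≤ N := by
    rw [abs_of_nonneg (by exact_mod_cast (by omega : 0 ≤ n))]; exact_mod_cast hn.2
  have hn2 : |(ν:ℝ)| ≤ N := by
    rw [abs_of_nonneg (by exact_mod_cast (by omega : 0 ≤ ν))]; exact_mod_cast hν.2
  have h2 : |(n:ℝ) ^ i - (ν:ℝ) ^ i| ≤ (q * L) * i * (N:ℝ) ^ (i - 1) := by
    refine (abs_pow_sub_pow_le _ _ _).trans ?_
    have h3 : |(n:ℝ) - ν| ≤ q * L := by exact_mod_cast hL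
    have h4 : max |(n:ℝ)| |(ν:ℝ)| ≤ N := max_le hn1 hn2
    gcongr
  rw [h1, abs_mul, abs_div, abs_of_pos hq0]
  have hQ0 : 0 ≤ Q / (N:ℝ) ^ i := (abs_nonneg _).trans hz
  calc |(q:ℝ) * α - z| * (|(n:ℝ) ^ i - (ν:ℝ) ^ i| / q) ≤ Q / (N:ℝ) ^ i * ((q * L) * i * (N:ℝ) ^ (i - 1) / q) := by gcongr
    _ = i * Q * L / N := by
      obtain ⟨j, rfl⟩ : ∃ j, i = j + 1 := ⟨i - 1, by omega⟩
      rw [Nat.add_sub_cancel, pow_succ]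
      field_simp

lemma high_all {α : ℕ → ℝ} {Q : ℝ} {k d q N L : ℕ} {n ν : ℤ} (hq : 1 ≤ q) (hN : 1 ≤ N) (hQ : 0 ≤ Q)
    (hz : ∀ i, d < i → i ≤ k → ∃ z : ℤ, |(q:ℝ) * α i - z| ≤ Q / (N:ℝ) ^ i) (hn : 1 ≤ n ∧ n ≤ N) (hν : 1 ≤ ν ∧ ν ≤ N)
    (hd : (q:ℤ) ∣ n - ν) (hL : |n - ν| ≤ q * L) :
    ‖e (∑ i ∈ Ioc d k, α i * (n:ℝ) ^ i) - e (∑ i ∈ Ioc d k, α i * (ν:ℝ) ^ i)‖ ≤ 7 * (k + 1) ^ 2 * Q * L / N := by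
  have h : ∀ i ∈ Ioc d k, ∃ w : ℤ, |α i * (n:ℝ) ^ i - α i * (ν:ℝ) ^ i - w| ≤ k * Q * L / N := by
    intro i hi
    rw [mem_Ioc] at hi
    obtain ⟨z, hz⟩ := hz i hi.1 hi.2
    obtain ⟨w, hw⟩ := high_one hq hN (by omega) hz hn hν hd hL
    refine ⟨w, hw.trans ?_⟩
    have : (i:ℝ) ≤ k := by exact_mod_cast hi.2
    gcongr
  choose! w hw using h
  have h1 : e (∑ i ∈ Ioc d k, α i * (n:ℝ) ^ i) = e (∑ i ∈ Ioc d k, α i * (n:ℝ) ^ i + ((-∑ i ∈ Ioc d k, w i : ℤ) : ℝ)) :=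
    (e_add_int _ _).symm
  rw [h1]
  refine (e_sub_le _ _).trans ?_
  have h2 : ∑ i ∈ Ioc d k, α i * (n:ℝ) ^ i + ((-∑ i ∈ Ioc d k, w i : ℤ) : ℝ) - ∑ i ∈ Ioc d k, α i * (ν:ℝ) ^ i =
      ∑ i ∈ Ioc d k, (α i * (n:ℝ) ^ i - α i * (ν:ℝ) ^ i - w i) := by
    rw [sum_sub_distrib, sum_sub_distrib]; push_cast; ring
  rw [h2]
  have h3 : |∑ i ∈ Ioc d k, (α i * (n:ℝ) ^ i - α i * (ν:ℝ) ^ i - w i)| ≤ k * (k * Q * L / N) := by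
    refine (abs_sum_le_sum_abs _ _).trans ((sum_le_card_nsmul _ _ _ hw).trans ?_)
    rw [nsmul_eq_mul, Nat.card_Ioc]
    gcongr
    omega
  have hpi : 2 * Real.pi ≤ 7 := by linarith [Real.pi_lt_d2]
  calc _ ≤ 7 * (k * (k * Q * L / N)) := by gcongr
    _ = 7 * ((k:ℝ) * k) * Q * L / N := by ring
    _ ≤ _ := by
      gcongr
      nlinarith [(Nat.cast_nonneg k : (0:ℝ) ≤ k)]

/-- partial inverse statement for the coefficients above d -/
def WI (k d : ℕ) : Prop := ∃ A : ℕ, ∃ C : ℝ, 1 ≤ C ∧ ∀ (α : ℕ → ℝ) (N : ℕ), 1 ≤ N → ∀ D : ℝ, 1 ≤ D →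
  (N:ℝ) / D ≤ ‖∑ n ∈ Icc (1:ℤ) N, e (∑ i ∈ range (k + 1), α i * (n:ℝ) ^ i)‖ →
  ∃ q : ℕ, 1 ≤ q ∧ (q:ℝ) ≤ C * D ^ A ∧ ∀ i, d < i → i ≤ k → ∃ z : ℤ, |(q:ℝ) * α i - z| ≤ C * D ^ A / (N:ℝ) ^ i

set_option maxHeartbeats 1000000 in
lemma WI_step {k d : ℕ} (hdk : d + 1 ≤ k) (h : WI k (d + 1)) : WI k d := by
  classical
  obtain ⟨A, C, hC, h⟩ := h
  obtain ⟨A', C', hC', h'⟩ := SP_all d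
  obtain ⟨B, hB⟩ : ∃ B : ℝ, B = 56 * ((k:ℝ) + 1) ^ 2 * C * C' * 4 ^ A' * (d + 1).factorial := ⟨_, rfl⟩
  have hk1 : (1:ℝ) ≤ ((k:ℝ) + 1) ^ 2 := one_le_pow₀ (by linarith [(Nat.cast_nonneg k : (0:ℝ) ≤ k)])
  have hfac : (1:ℝ) ≤ (d + 1).factorial := by exact_mod_cast Nat.factorial_pos _
  have hB1 : 1 ≤ B := by
    have h1 : (1:ℝ) ≤ 56 * ((k:ℝ) + 1) ^ 2 := by linarith
    have h2 : (1:ℝ) ≤ 4 ^ A' := one_le_pow₀ (by norm_num)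
    rw [hB]
    exact one_le_mul_of_one_le_of_one_le (one_le_mul_of_one_le_of_one_le (one_le_mul_of_one_le_of_one_le
      (one_le_mul_of_one_le_of_one_le h1 hC) hC') h2) hfac
  refine ⟨(A + 1 + A') * (k + 1), B ^ (k + 1), one_le_pow₀ hB1, ?_⟩
  intro α N hN D hD hS
  obtain ⟨q, hq1, hqQ, hqz⟩ := h α N hN D hD hS
  obtain ⟨Q, hQ⟩ : ∃ Q : ℝ, Q = C * D ^ A := ⟨_, rfl⟩
  obtain ⟨Q', hQ'⟩ : ∃ Q' : ℝ, Q' = C' * (4 * D) ^ A' := ⟨_, rfl⟩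
  obtain ⟨P, hP⟩ : ∃ P : ℝ, P = 56 * ((k:ℝ) + 1) ^ 2 * Q * D := ⟨_, rfl⟩
  obtain ⟨E, hE⟩ : ∃ E : ℝ, E = P * Q' * (d + 1).factorial := ⟨_, rfl⟩
  rw [← hQ] at hqQ hqz
  have hD0 : 0 < D := by linarith
  have hN0 : (0:ℝ) < N := by exact_mod_cast hN
  have hQ1 : 1 ≤ Q := by rw [hQ]; exact one_le_mul_of_one_le_of_one_le hC (one_le_pow₀ hD)
  have hQ'1 : 1 ≤ Q' := by rw [hQ']; exact one_le_mul_of_one_le_of_one_le hC' (one_le_pow₀ (by linarith))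
  have hQP : Q ≤ P := by
    rw [hP]
    calc Q = 1 * Q * 1 := by ring
      _ ≤ 56 * ((k:ℝ) + 1) ^ 2 * Q * D := by gcongr; linarith
  have hP1 : 1 ≤ P := hQ1.trans hQP
  have hPE : P ≤ E := by
    rw [hE, mul_assoc]; exact le_mul_of_one_le_right (by linarith) (one_le_mul_of_one_le_of_one_le hQ'1 hfac)
  have hE1 : 1 ≤ E := hP1.trans hPE
  have hfin : B ^ (k + 1) * D ^ ((A + 1 + A') * (k + 1)) = E ^ (k + 1) := by
    rw [pow_mul, ← mul_pow]
    congr 1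
    rw [hE, hP, hQ, hQ', hB, mul_pow, pow_add, pow_succ]; ring
  rw [hfin]
  rcases lt_or_ge (N:ℝ) P with hsm | hbg
  · refine ⟨1, le_refl _, by push_cast; exact one_le_pow₀ hE1, fun i _ hik => ⟨round (α i), ?_⟩⟩
    rw [le_div_iff₀ (by positivity), Nat.cast_one, one_mul]
    have h1 : |α i - round (α i)| ≤ 1 := (abs_sub_round _).trans (by norm_num)
    calc |α i - round (α i)| * (N:ℝ) ^ i ≤ 1 * P ^ i := by gcongr
      _ ≤ E ^ i := by rw [one_mul]; gcongr
      _ ≤ E ^ (k + 1) := pow_le_pow_right₀ hE1 (by omega)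
  obtain ⟨L, hL⟩ : ∃ L : ℕ, L = ⌊2 * (N:ℝ) / P⌋₊ := ⟨_, rfl⟩
  have hP0 : 0 < P := by linarith
  have hNP : 1 ≤ (N:ℝ) / P := by rw [one_le_div hP0]; exact hbg
  have hLle : (L:ℝ) ≤ 2 * N / P := by rw [hL]; exact Nat.floor_le (by positivity)
  have hLge : (N:ℝ) / P ≤ L := by
    have := Nat.lt_floor_add_one (2 * (N:ℝ) / P)
    rw [← hL] at this
    have h2 : 2 * (N:ℝ) / P = 2 * (N / P) := by ring
    linarith
  have hL1 : 1 ≤ L := by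
    have : (1:ℝ) ≤ L := hNP.trans hLge
    exact_mod_cast this
  have hL0 : (0:ℝ) < L := by exact_mod_cast hL1
  have hqL : q * L ≤ N := by
    have : (q:ℝ) * L ≤ N := by
      calc (q:ℝ) * L ≤ Q * (2 * N / P) := by gcongr
        _ = N * (2 * Q / P) := by ring
        _ ≤ N * 1 := by
          gcongr
          rw [div_le_one hP0, hP]
          calc 2 * Q = 2 * Q * 1 := by ring
            _ ≤ 56 * ((k:ℝ) + 1) ^ 2 * Q * D := by gcongr; linarith
        _ = N := mul_one _
    exact_mod_cast this
  -- find a good progression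
  obtain ⟨g, hg⟩ : ∃ g : ℤ → ℂ, g = fun n : ℤ => e (∑ i ∈ range (k + 1), α i * (n:ℝ) ^ i) := ⟨_, rfl⟩
  have hex : ∃ n0 : ℤ, (L:ℝ) / (2 * D) ≤ ‖∑ m ∈ Ico (0:ℤ) L with 1 ≤ n0 + q * m ∧ n0 + q * m ≤ N, g (n0 + q * m)‖ := by
    by_contra hcon
    push Not at hcon
    -- strict inequality by finiteness is not needed: shrink
    obtain ⟨M, hM⟩ : ∃ M : ℝ, (∀ n0 : ℤ, ‖∑ m ∈ Ico (0:ℤ) L with 1 ≤ n0 + q * m ∧ n0 + q * m ≤ N, g (n0 + q * m)‖ ≤ M) ∧ M < L / (2 * D) := by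
      obtain ⟨x, hx, hmax⟩ := exists_max_image (Ioc (-(q * L : ℤ)) N)
        (fun n0 : ℤ => ‖∑ m ∈ Ico (0:ℤ) L with 1 ≤ n0 + q * m ∧ n0 + q * m ≤ N, g (n0 + q * m)‖) ⟨N, by
          rw [mem_Ioc]; refine ⟨?_, le_refl _⟩
          have : (0:ℤ) ≤ q * L := by positivity
          omega⟩
      refine ⟨_, fun n0 => ?_, hcon x⟩
      by_cases hn0 : n0 ∈ Ioc (-(q * L : ℤ)) N
      · exact hmax n0 hn0
      · rw [filter_false_of_mem]
        · simp
        · intro m hm hc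
          apply hn0
          rw [mem_Ico] at hm
          have h1 : (0:ℤ) ≤ q * m := mul_nonneg (by positivity) hm.1
          have h2 : (q:ℤ) * m ≤ q * L := by gcongr; exact hm.2.le
          rw [mem_Ioc]; omega
    have h1 := avg_prog g N q L hqL hM.1
    have h2 : (L:ℝ) * (N / D) ≤ 2 * N * M := le_trans (by rw [hg]; gcongr) h1
    have h3 : 2 * N * M < 2 * N * (L / (2 * D)) := by gcongr; exact hM.2
    have h4 : 2 * (N:ℝ) * (L / (2 * D)) = L * (N / D) := by field_simp
    linarith
  obtain ⟨n0, hn0⟩ := hex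
  obtain ⟨F, hF⟩ : ∃ F : Finset ℤ, F = {m ∈ Ico (0:ℤ) L | 1 ≤ n0 + q * m ∧ n0 + q * m ≤ N} := ⟨_, rfl⟩
  rw [← hF] at hn0
  have hFm : ∀ m ∈ F, (0 ≤ m ∧ m < L) ∧ (1 ≤ n0 + q * m ∧ n0 + q * m ≤ N) := by
    intro m hm; rw [hF] at hm; simpa using hm
  have hFc : #F ≤ L := by
    rw [hF]; exact (card_filter_le _ _).trans (by simp)
  have hFne : F.Nonempty := by
    rw [nonempty_iff_ne_empty]
    rintro rfl
    simp only [sum_empty, norm_zero] at hn0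
    have : 0 < (L:ℝ) / (2 * D) := by positivity
    linarith
  obtain ⟨a, b, hab, hlen⟩ := conv_Ico F (by
    intro x hx y hy z hxz hzy
    have h1 := hFm x hx
    have h2 := hFm y hy
    rw [hF, mem_filter, mem_Ico]
    have h3 : (q:ℤ) * x ≤ q * z := by gcongr
    have h4 : (q:ℤ) * z ≤ q * y := by gcongr
    omega) hFc
  obtain ⟨m0, hm0⟩ := hFne
  obtain ⟨ν, hν⟩ : ∃ ν : ℤ, ν = n0 + q * m0 := ⟨_, rfl⟩
  obtain ⟨φ, hφ⟩ : ∃ φ : ℤ → ℝ, φ = fun m : ℤ => ∑ i ∈ range (d + 1 + 1), α i * ((q:ℝ) * m + n0) ^ i := ⟨_, rfl⟩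
  obtain ⟨hi, hhi⟩ : ∃ hi : ℤ → ℝ, hi = fun n : ℤ => ∑ i ∈ Ioc (d + 1) k, α i * (n:ℝ) ^ i := ⟨_, rfl⟩
  have hsplit : ∀ m : ℤ, g (n0 + q * m) = e (φ m) * e (hi (n0 + q * m)) := by
    intro m
    rw [← e_add, hg, hφ, hhi]
    simp only
    congr 1
    have h1 : range (k + 1) = range (d + 1 + 1) ∪ Ioc (d + 1) k := by
      ext x; simp only [mem_range, mem_union, mem_Ioc]; omega
    rw [h1, sum_union]
    · congr 1
      refine sum_congr rfl fun i _ => ?_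
      push_cast; ring
    · rw [disjoint_left]; intro x; simp only [mem_range, mem_Ioc]; omega
  have hclose : ∀ m ∈ F, ‖e (hi (n0 + q * m)) - e (hi ν)‖ ≤ 1 / (4 * D) := by
    intro m hm
    have h1 := hFm m hm
    have h2 := hFm m0 hm0
    rw [hhi]
    refine (high_all (L := L) hq1 hN (by linarith) hqz h1.2 (by rw [hν]; exact h2.2) ?_ ?_).trans ?_
    · rw [hν]; exact ⟨m - m0, by ring⟩
    · rw [hν, show n0 + q * m - (n0 + q * m0) = (q:ℤ) * (m - m0) by ring, abs_mul, Nat.abs_cast]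
      gcongr
      rw [abs_le]; omega
    · calc 7 * ((k:ℝ) + 1) ^ 2 * Q * L / N ≤ 7 * ((k:ℝ) + 1) ^ 2 * Q * (2 * N / P) / N := by gcongr
        _ = 1 / (4 * D) := by rw [hP]; field_simp; norm_num
  have hlow : (L:ℝ) / (4 * D) ≤ ‖∑ m ∈ Ico a b, e (φ m)‖ := by
    rw [← hab]
    have h1 : ‖∑ m ∈ F, e (φ m)‖ = ‖∑ m ∈ F, e (φ m) * e (hi ν)‖ := by
      rw [← sum_mul, norm_mul, norm_e, mul_one]
    have h2 : ∑ m ∈ F, g (n0 + q * m) = ∑ m ∈ F, e (φ m) * e (hi ν) +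
        ∑ m ∈ F, e (φ m) * (e (hi (n0 + q * m)) - e (hi ν)) := by
      rw [← sum_add_distrib]
      refine sum_congr rfl fun m _ => ?_
      rw [hsplit]; ring
    have h3 : ‖∑ m ∈ F, e (φ m) * (e (hi (n0 + q * m)) - e (hi ν))‖ ≤ L * (1 / (4 * D)) := by
      refine (norm_sum_le_of_le (n := fun _ => 1 / (4 * D)) _ (fun m hm => ?_)).trans ?_
      · rw [norm_mul, norm_e, one_mul]; exact hclose m hm
      · rw [sum_const, nsmul_eq_mul]; gcongr
    rw [h2] at hn0
    have h4 := hn0.trans (norm_add_le _ _)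
    rw [h1]
    have h5 : (L:ℝ) / (2 * D) = L / (4 * D) + L * (1 / (4 * D)) := by field_simp; norm_num
    linarith
  obtain ⟨q', hq'1, hq'Q, z, hz⟩ := h' φ _ (by rw [hφ]; exact PolyLead.poly (q:ℝ) n0 α (d + 1)) L a b hL1 hlen (4 * D)
    (by linarith) hlow
  rw [← hQ'] at hq'Q hz
  have hQ0 : 0 < Q := by linarith
  have hQ'0 : 0 < Q' := by linarith
  have hEd : Q' * (d + 1).factorial * Q ^ (d + 1) ≤ E ^ (k + 1) := by
    calc Q' * (d + 1).factorial * Q ^ (d + 1) ≤ P * Q' * (d + 1).factorial * P ^ d := by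
          rw [pow_succ]
          have : Q ^ d ≤ P ^ d := by gcongr
          calc Q' * ((d + 1).factorial:ℝ) * (Q ^ d * Q) = Q * Q' * (d + 1).factorial * Q ^ d := by ring
            _ ≤ _ := by gcongr
      _ ≤ E * E ^ d := by rw [← hE]; gcongr
      _ = E ^ (d + 1) := by ring
      _ ≤ E ^ (k + 1) := pow_le_pow_right₀ hE1 (by omega)
  refine ⟨q' * (d + 1).factorial * q ^ (d + 1), ?_, ?_, ?_⟩
  · exact Nat.mul_pos (Nat.mul_pos hq'1 (Nat.factorial_pos _)) (pow_pos hq1 _)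
  · push_cast
    refine le_trans ?_ hEd
    gcongr
  · intro i hdi hik
    rcases Nat.lt_or_ge (d + 1) i with hlt | hge
    · obtain ⟨w, hw⟩ := hqz i hlt hik
      refine ⟨(q' * (d + 1).factorial * q ^ d : ℕ) * w, ?_⟩
      have h1 : ((q' * (d + 1).factorial * q ^ (d + 1) : ℕ) : ℝ) * α i - (((q' * (d + 1).factorial * q ^ d : ℕ) * w : ℤ) : ℝ)
          = (q' * (d + 1).factorial * q ^ d) * (q * α i - w) := by push_cast; ring
      rw [h1, abs_mul, abs_of_nonneg (by positivity)]
      calc ((q':ℝ) * (d + 1).factorial * q ^ d) * |(q:ℝ) * α i - w| ≤ (Q' * (d + 1).factorial * Q ^ d) * (Q / (N:ℝ) ^ i) := by gcongr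
        _ = Q' * (d + 1).factorial * Q ^ (d + 1) / (N:ℝ) ^ i := by ring
        _ ≤ _ := by gcongr
    · have hid : i = d + 1 := by omega
      subst hid
      refine ⟨z, ?_⟩
      have h1 : ((q' * (d + 1).factorial * q ^ (d + 1) : ℕ) : ℝ) * α (d + 1) = q' * (α (d + 1) * ((d + 1).factorial * (q:ℝ) ^ (d + 1))) := by
        push_cast; ring
      rw [h1]
      refine hz.trans ?_
      have h2 : ((N:ℝ) / P) ^ (d + 1) ≤ (L:ℝ) ^ (d + 1) := by gcongr
      calc Q' / (L:ℝ) ^ (d + 1) ≤ Q' / ((N:ℝ) / P) ^ (d + 1) := by gcongr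
        _ = Q' * P ^ (d + 1) / (N:ℝ) ^ (d + 1) := by rw [div_pow]; field_simp
        _ ≤ _ := by
          gcongr
          calc Q' * P ^ (d + 1) = P * Q' * 1 * P ^ d := by ring
            _ ≤ P * Q' * (d + 1).factorial * E ^ d := by gcongr
            _ = E ^ (d + 1) := by rw [← hE]; ring
            _ ≤ E ^ (k + 1) := pow_le_pow_right₀ hE1 (by omega)

lemma WI_all (k d : ℕ) : WI k (k - d) := by
  induction d with
  | zero => exact ⟨0, 1, le_refl _, fun α N hN D hD _ => ⟨1, le_refl _, by simp, fun i h1 h2 => by omega⟩⟩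
  | succ d ih =>
    rcases Nat.lt_or_ge d k with h | h
    · refine WI_step (by omega) ?_
      rwa [show k - (d + 1) + 1 = k - d by omega]
    · rwa [show k - (d + 1) = k - d by omega]

/-- Weyl's inequality in inverse form -/
theorem weyl (k : ℕ) : ∃ A : ℕ, ∃ C : ℝ, 1 ≤ C ∧ ∀ (α : Fin k → ℝ) (N : ℕ), 1 ≤ N → ∀ D : ℝ, 1 ≤ D →
    (N:ℝ) / D ≤ ‖S (Icc (1:ℤ) N) (pv k) α‖ →
    ∃ q : ℕ, 1 ≤ q ∧ (q:ℝ) ≤ C * D ^ A ∧ ∀ i : Fin k, ∃ z : ℤ, |(q:ℝ) * α i - z| ≤ C * D ^ A / (N:ℝ) ^ ((i:ℕ) + 1) := by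
  obtain ⟨A, C, hC, h⟩ := WI_all k k
  refine ⟨A, C, hC, fun α N hN D hD hS => ?_⟩
  obtain ⟨q, hq1, hq2, hq3⟩ := h (fun i => if hi : i - 1 < k then (if i = 0 then 0 else α ⟨i - 1, hi⟩) else 0) N hN D hD (by
    convert hS using 3
    refine sum_congr rfl fun n _ => ?_
    congr 1
    rw [sum_range_succ', ph, ← Fin.sum_univ_eq_sum_range (fun i => _)]
    simp [pv])
  refine ⟨q, hq1, hq2, fun i => ?_⟩
  have := hq3 (i + 1) (by omega) (by omega)
  simpa using this

end Vino

namespace Vino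
open Finset MeasureTheory

lemma shift_sum (g : ℕ → ℂ) (hg : ∀ n, ‖g n‖ ≤ 1) (N l : ℕ) :
    ‖∑ n ∈ range N, g (n + l) - ∑ n ∈ range N, g n‖ ≤ 2 * l := by
  induction l with
  | zero => simp
  | succ l ih =>
    have h1 : ∑ n ∈ range N, g (n + (l + 1)) - ∑ n ∈ range N, g (n + l) = g (N + l) - g (0 + l) := by
      rw [← sum_sub_distrib, ← sum_range_sub (fun n => g (n + l))]
      refine sum_congr rfl fun n _ => ?_
      congr 2; ring
    have h2 : ‖g (N + l) - g (0 + l)‖ ≤ 2 := (norm_sub_le _ _).trans (by linarith [hg (N + l), hg (0 + l)])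
    have h3 : ∑ n ∈ range N, g (n + (l + 1)) - ∑ n ∈ range N, g n =
      (g (N + l) - g (0 + l)) + (∑ n ∈ range N, g (n + l) - ∑ n ∈ range N, g n) := by rw [← h1]; ring
    rw [h3]
    refine (norm_add_le _ _).trans ?_
    push_cast; linarith

lemma per_sum (c : ℕ → ℂ) (q : ℕ) (hper : ∀ n, c (n + q) = c n) (n : ℕ) :
    ∑ l ∈ range q, c (n + l) = ∑ l ∈ range q, c l := by
  induction n with
  | zero => simp
  | succ n ih =>
    rw [← ih, ← sub_eq_zero, ← sum_sub_distrib]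
    have : ∀ l ∈ range q, c (n + 1 + l) - c (n + l) = (fun l => c (n + l)) (l + 1) - (fun l => c (n + l)) l := by
      intro l _; simp only; congr 2; ring
    rw [sum_congr rfl this]
    exact (sum_range_sub (fun l => c (n + l)) q).trans (by simp [hper])

lemma riemann {w : ℝ → ℂ} (hw : Continuous w) {Λ : ℝ} (hΛ : 0 ≤ Λ)
    (hL : ∀ u v, 0 ≤ u → 0 ≤ v → ‖w u - w v‖ ≤ Λ * |u - v|) {N : ℕ} (hN : 1 ≤ N) :
    ‖∑ n ∈ range N, w (n / N) - N * ∫ u in (0:ℝ)..1, w u‖ ≤ Λ := by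
  have hN0 : (0:ℝ) < N := by exact_mod_cast hN
  have h1 : ∫ u in (0:ℝ)..1, w u = ∑ n ∈ range N, ∫ u in ((n:ℝ) / N)..((n + 1 : ℕ):ℝ) / N, w u := by
    rw [intervalIntegral.sum_integral_adjacent_intervals (a := fun n : ℕ => (n:ℝ) / N)
      (fun n _ => hw.intervalIntegrable _ _)]
    simp [hN0.ne']
  have hlen : ∀ n : ℕ, ((n + 1 : ℕ):ℝ) / N - (n:ℝ) / N = 1 / N := by intro n; push_cast; ring
  rw [h1, mul_sum, ← sum_sub_distrib]
  have h2 : ∀ n ∈ range N, ‖w (n / N) - N * ∫ u in ((n:ℝ) / N)..((n + 1 : ℕ):ℝ) / N, w u‖ ≤ Λ / N := by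
    intro n _
    have h3 : w (n / N) = N * ∫ u in ((n:ℝ) / N)..((n + 1 : ℕ):ℝ) / N, w (n / N) := by
      rw [intervalIntegral.integral_const, hlen, Complex.real_smul]
      push_cast
      have : (N:ℂ) ≠ 0 := by exact_mod_cast hN0.ne'
      field_simp
    rw [h3, ← mul_sub, ← intervalIntegral.integral_sub (by simp) (hw.intervalIntegrable _ _), norm_mul, Complex.norm_natCast]
    have h4 : ‖∫ u in ((n:ℝ) / N)..((n + 1 : ℕ):ℝ) / N, (w (n / N) - w u)‖ ≤ (Λ / N) * |((n + 1 : ℕ):ℝ) / N - (n:ℝ) / N| := by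
      refine intervalIntegral.norm_integral_le_of_norm_le_const fun u hu => ?_
      have hle : (n:ℝ) / N ≤ ((n + 1 : ℕ):ℝ) / N := by
        have := hlen n
        have h5 : 0 < 1 / (N:ℝ) := by positivity
        linarith
      rw [Set.uIoc_of_le hle] at hu
      have h0 : 0 ≤ (n:ℝ) / N := by positivity
      refine (hL _ _ h0 (h0.trans hu.1.le)).trans ?_
      rw [abs_sub_comm, abs_of_pos (by linarith [hu.1])]
      have h6 : u - (n:ℝ) / N ≤ 1 / N := by linarith [hu.2, hlen n]
      calc Λ * (u - (n:ℝ) / N) ≤ Λ * (1 / N) := by gcongr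
        _ = Λ / N := by ring
    calc (N:ℝ) * _ ≤ N * ((Λ / N) * |((n + 1 : ℕ):ℝ) / N - (n:ℝ) / N|) := by gcongr
      _ = Λ / N := by rw [hlen, abs_of_pos (by positivity)]; field_simp
  refine (norm_sum_le_of_le _ h2).trans ?_
  rw [sum_const, card_range, nsmul_eq_mul]
  field_simp; rfl

lemma per_avg {c : ℕ → ℂ} {q : ℕ} (hq : 1 ≤ q) (hper : ∀ n, c (n + q) = c n) (hc : ∀ n, ‖c n‖ ≤ 1)
    {w : ℝ → ℂ} (hw : Continuous w) (hw1 : ∀ u, ‖w u‖ ≤ 1) {Λ : ℝ} (hΛ : 0 ≤ Λ)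
    (hL : ∀ u v, 0 ≤ u → 0 ≤ v → ‖w u - w v‖ ≤ Λ * |u - v|) {N : ℕ} (hN : 1 ≤ N) :
    ‖(∑ n ∈ range N, c (n + 1) * w ((n + 1 : ℕ) / N)) / N - (∑ l ∈ range q, c l) / q * ∫ u in (0:ℝ)..1, w u‖
      ≤ (4 * q + Λ * (q + 1)) / N := by
  have hN0 : (0:ℝ) < N := by exact_mod_cast hN
  have hq0 : (0:ℝ) < q := by exact_mod_cast hq
  have hNc : (N:ℂ) ≠ 0 := by exact_mod_cast hN0.ne'
  have hqc : (q:ℂ) ≠ 0 := by exact_mod_cast hq0.ne'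
  set g : ℕ → ℂ := fun n => c n * w ((n:ℝ) / N) with hg
  have hg1 : ∀ n, ‖g n‖ ≤ 1 := by
    intro n; rw [hg]; simp only [norm_mul]
    exact mul_le_one₀ (hc n) (norm_nonneg _) (hw1 _)
  have hF : ∑ n ∈ range N, c (n + 1) * w ((n + 1 : ℕ) / N) = ∑ n ∈ range N, g (n + 1) := rfl
  rw [hF]
  set F := ∑ n ∈ range N, g (n + 1) with hFd
  set I := ∫ u in (0:ℝ)..1, w u with hI
  set G := ∑ l ∈ range q, c l with hG
  have hGq : ‖G‖ ≤ q := by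
    refine (norm_sum_le_of_le (n := fun _ => (1:ℝ)) _ (fun l _ => hc l)).trans ?_
    simp
  -- compare q F with the double sum
  have h1 : ∀ l ∈ range q, ‖F - ∑ n ∈ range N, c (n + l) * w ((n:ℝ) / N)‖ ≤ 2 + (2 * (q - 1)) + Λ * q := by
    intro l hl
    have hlq : (l:ℝ) + 1 ≤ q := by exact_mod_cast mem_range.mp hl
    have a1 := shift_sum g hg1 N 1
    have a2 := shift_sum g hg1 N l
    have a3 : ‖∑ n ∈ range N, g (n + l) - ∑ n ∈ range N, c (n + l) * w ((n:ℝ) / N)‖ ≤ Λ * l := by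
      rw [← sum_sub_distrib]
      refine (norm_sum_le_of_le (n := fun _ => Λ * (l / N)) _ (fun n _ => ?_)).trans ?_
      · rw [hg]; simp only
        rw [← mul_sub, norm_mul]
        refine (mul_le_of_le_one_left (norm_nonneg _) (hc _)).trans ?_
        refine (hL _ _ (by positivity) (by positivity)).trans ?_
        rw [← sub_div, Nat.cast_add, add_sub_cancel_left, abs_of_nonneg (by positivity)]
      · rw [sum_const, card_range, nsmul_eq_mul]; field_simp; rfl
    have a4 : F - ∑ n ∈ range N, c (n + l) * w ((n:ℝ) / N) = (F - ∑ n ∈ range N, g n) -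
      (∑ n ∈ range N, g (n + l) - ∑ n ∈ range N, g n) +
      (∑ n ∈ range N, g (n + l) - ∑ n ∈ range N, c (n + l) * w ((n:ℝ) / N)) := by ring
    rw [a4]
    refine (norm_add_le _ _).trans (add_le_add ((norm_sub_le _ _).trans (add_le_add ?_ ?_)) ?_)
    · simpa using a1
    · exact a2.trans (by linarith)
    · exact a3.trans (by gcongr; exact (mem_range.mp hl).le)
  have h2 : ∑ l ∈ range q, ∑ n ∈ range N, c (n + l) * w ((n:ℝ) / N) = G * ∑ n ∈ range N, w ((n:ℝ) / N) := by
    rw [sum_comm, mul_sum]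
    refine sum_congr rfl fun n _ => ?_
    rw [← sum_mul, per_sum c q hper]
  have h3 : ‖q * F - G * ∑ n ∈ range N, w ((n:ℝ) / N)‖ ≤ q * (2 * q + Λ * q) := by
    have : q * F - G * ∑ n ∈ range N, w ((n:ℝ) / N) = ∑ l ∈ range q, (F - ∑ n ∈ range N, c (n + l) * w ((n:ℝ) / N)) := by
      rw [sum_sub_distrib, h2]; simp
    rw [this]
    refine (norm_sum_le_of_le _ h1).trans ?_
    rw [sum_const, card_range, nsmul_eq_mul]
    gcongr; linarith
  have h4 := riemann hw hΛ hL hN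
  rw [← hI] at h4
  have h5 : ‖q * F - G * (N * I)‖ ≤ q * (2 * q + Λ * q) + q * Λ := by
    have : q * F - G * (N * I) = (q * F - G * ∑ n ∈ range N, w ((n:ℝ) / N)) + G * (∑ n ∈ range N, w (n / N) - N * I) := by ring
    rw [this]
    refine (norm_add_le _ _).trans (add_le_add h3 ?_)
    rw [norm_mul]; gcongr
  have h6 : F / N - G / q * I = (q * F - G * (N * I)) / (q * N) := by field_simp
  rw [h6, norm_div, norm_mul, Complex.norm_natCast, Complex.norm_natCast, div_le_div_iff₀ (by positivity) hN0]
  calc _ ≤ (q * (2 * q + Λ * q) + q * Λ) * N := by gcongr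
    _ = (2 * q + Λ * (q + 1)) * (q * N) := by ring
    _ ≤ _ := by gcongr; linarith

/-- the scaling vector -/
noncomputable def sc (k N : ℕ) : Fin k → ℝ := fun i => ((N:ℝ) ^ ((i:ℕ) + 1))⁻¹

lemma clip_lip (γ : ℝ) (j : ℕ) (u v : ℝ) (hu : 0 ≤ u) (hv : 0 ≤ v) :
    |γ * (min u 1) ^ j - γ * (min v 1) ^ j| ≤ |γ| * j * |u - v| := by
  rw [← mul_sub, abs_mul, mul_assoc]
  gcongr
  refine (abs_pow_sub_pow_le _ _ _).trans ?_
  have h1 : |min u 1 - min v 1| ≤ |u - v| := by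
    have := abs_min_sub_min_le_max u 1 v 1
    simpa using this
  have h2 : max |min u 1| |min v 1| ≤ 1 := by
    rw [abs_of_nonneg (le_min hu zero_le_one), abs_of_nonneg (le_min hv zero_le_one)]
    exact max_le (min_le_right _ _) (min_le_right _ _)
  calc |min u 1 - min v 1| * j * max |min u 1| |min v 1| ^ (j - 1) ≤ |u - v| * j * 1 := by
        gcongr
        exact pow_le_one₀ (le_max_of_le_left (abs_nonneg _)) h2
    _ = _ := by ring

/-- approximation of the exponential sum on a major arc -/
lemma approx {k q R : ℕ} (hq : 1 ≤ q) (hqR : q ≤ R) (a : Fin k → ℤ) (γ : Fin k → ℝ) (hγ : ∀ i, |γ i| ≤ R) :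
    ∃ m : ℂ, ∀ N : ℕ, 1 ≤ N →
      ‖S (Icc (1:ℤ) N) (pv k) (fun i => (a i : ℝ) / q + sc k N i * γ i) / N - m‖ ≤ (20 * (k + 1) ^ 2 * R ^ 2 : ℝ) / N := by
  have hq0 : (0:ℝ) < q := by exact_mod_cast hq
  have hR1 : (1:ℝ) ≤ R := by exact_mod_cast hq.trans hqR
  set c : ℕ → ℂ := fun n => e (∑ i, (a i : ℝ) / q * (n:ℝ) ^ ((i:ℕ) + 1)) with hc
  set w : ℝ → ℂ := fun u => e (∑ i, γ i * (min u 1) ^ ((i:ℕ) + 1)) with hw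
  have hper : ∀ n, c (n + q) = c n := by
    intro n
    have : ∀ i, ∃ y : ℤ, (((n + q : ℕ) : ℤ)) ^ ((i:ℕ) + 1) - (n:ℤ) ^ ((i:ℕ) + 1) = q * y := by
      intro i
      refine (Dvd.dvd.trans ?_ (sub_dvd_pow_sub_pow _ _ _) : (q:ℤ) ∣ _)
      exact ⟨1, by push_cast; ring⟩
    choose y hy using this
    rw [hc]; simp only
    rw [← e_add_int (∑ i, (a i : ℝ) / q * (n:ℝ) ^ ((i:ℕ) + 1)) (∑ i : Fin k, a i * y i)]
    congr 1
    push_cast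
    rw [← sum_add_distrib]
    refine sum_congr rfl fun i _ => ?_
    have h1 : ((n:ℝ) + q) ^ ((i:ℕ) + 1) - (n:ℝ) ^ ((i:ℕ) + 1) = q * y i := by exact_mod_cast hy i
    have h2 : ((n:ℝ) + q) ^ ((i:ℕ) + 1) = (n:ℝ) ^ ((i:ℕ) + 1) + q * y i := by linarith
    rw [h2]; field_simp
  have hL : ∀ u v, 0 ≤ u → 0 ≤ v → ‖w u - w v‖ ≤ (7 * (k + 1) ^ 2 * R : ℝ) * |u - v| := by
    intro u v hu hv
    refine (e_sub_le _ _).trans ?_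
    rw [← sum_sub_distrib]
    have h1 : |∑ i : Fin k, (γ i * (min u 1) ^ ((i:ℕ) + 1) - γ i * (min v 1) ^ ((i:ℕ) + 1))| ≤ k * (R * (k + 1) * |u - v|) := by
      refine (abs_sum_le_sum_abs _ _).trans ((sum_le_card_nsmul _ _ (R * (k + 1) * |u - v|) fun i _ => ?_).trans ?_)
      · refine (clip_lip _ _ _ _ hu hv).trans ?_
        gcongr
        · exact hγ i
        · have : ((i:ℕ):ℝ) ≤ k := by exact_mod_cast i.2.le
          push_cast; linarith
      · simp
    have hpi : 2 * Real.pi ≤ 7 := by linarith [Real.pi_lt_d2]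
    calc _ ≤ 7 * (((k:ℝ) + 1) * (R * (k + 1) * |u - v|)) := by
          gcongr
          refine h1.trans ?_
          gcongr; linarith
      _ = _ := by ring
  refine ⟨(∑ l ∈ range q, c l) / q * ∫ u in (0:ℝ)..1, w u, fun N hN => ?_⟩
  have hN0 : (0:ℝ) < N := by exact_mod_cast hN
  have hS : S (Icc (1:ℤ) N) (pv k) (fun i => (a i : ℝ) / q + sc k N i * γ i) =
      ∑ n ∈ range N, c (n + 1) * w ((n + 1 : ℕ) / N) := by
    unfold S
    refine (sum_bij (fun n _ => ((n + 1 : ℕ) : ℤ)) ?_ ?_ ?_ ?_).symm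
    · intro n hn; rw [mem_range] at hn; rw [mem_Icc]; omega
    · intro n _ m _ h; simpa using h
    · intro b hb; rw [mem_Icc] at hb; exact ⟨(b - 1).toNat, by rw [mem_range]; omega, by omega⟩
    · intro n hn
      rw [mem_range] at hn
      rw [hc, hw]; simp only
      rw [← e_add]; congr 1
      have h1 : min (((n + 1 : ℕ):ℝ) / N) 1 = ((n + 1 : ℕ):ℝ) / N := by
        refine min_eq_left ?_
        rw [div_le_one hN0]; exact_mod_cast hn
      rw [h1, ← sum_add_distrib]
      unfold ph pv sc
      refine sum_congr rfl fun i _ => ?_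
      push_cast
      rw [div_pow]; ring
  rw [hS]
  refine (per_avg hq hper (fun n => (norm_e _).le) (by have := continuous_e; fun_prop) (fun u => (norm_e _).le) (by positivity) hL hN).trans ?_
  gcongr
  have hqR' : (q:ℝ) ≤ R := by exact_mod_cast hqR
  have h1 : (1:ℝ) ≤ ((k:ℝ) + 1) ^ 2 := one_le_pow₀ (by linarith [(Nat.cast_nonneg k : (0:ℝ) ≤ k)])
  calc 4 * (q:ℝ) + 7 * ((k:ℝ) + 1) ^ 2 * R * (q + 1) ≤ 4 * (((k:ℝ) + 1) ^ 2 * (R * R)) + 7 * ((k:ℝ) + 1) ^ 2 * R * (R + R) := by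
        gcongr
        calc (q:ℝ) ≤ 1 * (1 * R) := by linarith
          _ ≤ _ := by gcongr
    _ ≤ 20 * ((k:ℝ) + 1) ^ 2 * R ^ 2 := by
      have : (0:ℝ) ≤ ((k:ℝ) + 1) ^ 2 * R ^ 2 := by positivity
      linarith

/-- diagonal change of variables -/
lemma cov {k : ℕ} (r v : Fin k → ℝ) (hv : ∀ i, 0 < v i) (R : ℝ) (g : (Fin k → ℝ) → ℝ) :
    ∫ α in Set.Icc (fun i => r i - v i * R) (fun i => r i + v i * R), g α =
      (∏ i, v i) * ∫ γ in Set.Icc (fun _ : Fin k => -R) (fun _ => R), g (fun i => r i + v i * γ i) := by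
  set T : (Fin k → ℝ) →L[ℝ] (Fin k → ℝ) := LinearMap.toContinuousLinearMap (Matrix.toLin' (Matrix.diagonal v)) with hT
  have hTa : ∀ γ, T γ = fun i => v i * γ i := by
    intro γ; ext i; simp [hT, Matrix.toLin'_apply, Matrix.mulVec_diagonal]
  have hdet : T.det = ∏ i, v i := by
    rw [hT]; simp [ContinuousLinearMap.det, LinearMap.det_toLin', Matrix.det_diagonal]
  have himg : (fun γ => r + T γ) '' (Set.Icc (fun _ : Fin k => -R) (fun _ => R)) =
      Set.Icc (fun i => r i - v i * R) (fun i => r i + v i * R) := by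
    ext α
    simp only [Set.mem_image, Set.mem_Icc, hTa, Pi.le_def]
    constructor
    · rintro ⟨γ, ⟨h1, h2⟩, rfl⟩
      refine ⟨fun i => ?_, fun i => ?_⟩
      · have := mul_le_mul_of_nonneg_left (h1 i) (hv i).le
        simp only [Pi.add_apply]; linarith
      · have := mul_le_mul_of_nonneg_left (h2 i) (hv i).le
        simp only [Pi.add_apply]; linarith
    · rintro ⟨h1, h2⟩
      refine ⟨fun i => (α i - r i) / v i, ⟨fun i => ?_, fun i => ?_⟩, ?_⟩
      · rw [le_div_iff₀ (hv i)]; linarith [h1 i]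
      · rw [div_le_iff₀ (hv i)]; linarith [h2 i]
      · ext i; simp only [Pi.add_apply]; rw [mul_div_cancel₀ _ (hv i).ne']; ring
  have hinj : Set.InjOn (fun γ => r + T γ) (Set.Icc (fun _ : Fin k => -R) (fun _ => R)) := by
    intro x _ y _ hxy
    simp only [add_right_inj, hTa] at hxy
    ext i
    exact mul_left_cancel₀ (hv i).ne' (congrFun hxy i)
  have := integral_image_eq_integral_abs_det_fderiv_smul volume (measurableSet_Icc (a := fun _ : Fin k => -R) (b := fun _ => R))
    (f := fun γ => r + T γ) (f' := fun _ => T) (fun x _ => (T.hasFDerivAt.const_add r).hasFDerivWithinAt) hinj g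
  rw [himg] at this
  rw [this, hdet, abs_of_pos (prod_pos fun i _ => hv i), ← integral_const_mul]
  simp only [smul_eq_mul, hTa]
  rfl

end Vino

namespace Vino
open Finset MeasureTheory

open Classical in
/-- centres of major arcs -/
noncomputable def Rats (k R : ℕ) : Finset (Fin k → ℝ) :=
  (Icc 1 R).biUnion fun q => (Fintype.piFinset fun _ : Fin k => range q).image (fun a i => (a i : ℝ) / q)

lemma mem_Rats {k R : ℕ} {r : Fin k → ℝ} : r ∈ Rats k R ↔
    ∃ q : ℕ, (1 ≤ q ∧ q ≤ R) ∧ ∃ a : Fin k → ℕ, (∀ i, a i < q) ∧ (fun i => (a i : ℝ) / q) = r := by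
  unfold Rats
  simp only [mem_biUnion, mem_Icc, mem_image, Fintype.mem_piFinset, mem_range]

lemma card_Rats (k R : ℕ) : #(Rats k R) ≤ R ^ (k + 1) := by
  unfold Rats
  refine (card_biUnion_le_card_mul _ _ (R ^ k) fun q hq => card_image_le.trans ?_).trans ?_
  · rw [Fintype.card_piFinset]
    simp only [card_range, prod_const, card_univ, Fintype.card_fin]
    exact Nat.pow_le_pow_left (mem_Icc.mp hq).2 k
  · simp [pow_succ, mul_comm]

lemma sc_pos {k N : ℕ} (hN : 1 ≤ N) (i : Fin k) : 0 < sc k N i := by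
  unfold sc
  have : (0:ℝ) < N := by exact_mod_cast hN
  positivity

lemma sc_le {k N : ℕ} (hN : 1 ≤ N) (i : Fin k) : sc k N i ≤ 1 / N := by
  unfold sc
  have h0 : (1:ℝ) ≤ N := by exact_mod_cast hN
  rw [one_div]
  refine inv_anti₀ (by linarith) ?_
  calc (N:ℝ) = N ^ 1 := (pow_one _).symm
    _ ≤ _ := pow_le_pow_right₀ h0 (by omega)

/-- a major arc box -/
def Bx (k R N : ℕ) (r : Fin k → ℝ) : Set (Fin k → ℝ) :=
  Set.Icc (fun i => r i - sc k N i * R) (fun i => r i + sc k N i * R)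

lemma sc_R {k R N : ℕ} (hR : 1 ≤ R) (hN : 2 * R ^ 3 < N) (i : Fin k) :
    0 ≤ sc k N i * R ∧ sc k N i * R < 1 / (2 * R ^ 2) := by
  have hR0 : (0:ℝ) < R := by exact_mod_cast hR
  have hN' : (2:ℝ) * R ^ 3 < N := by exact_mod_cast hN
  have hN1 : 1 ≤ N := by omega
  have hN0 : (0:ℝ) < N := by exact_mod_cast hN1
  refine ⟨mul_nonneg (sc_pos hN1 i).le hR0.le, ?_⟩
  calc sc k N i * R ≤ 1 / N * R := by gcongr; exact sc_le hN1 i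
    _ < _ := by
      rw [div_mul_eq_mul_div, one_mul, div_lt_div_iff₀ hN0 (by positivity)]
      linarith [show (R:ℝ) * (2 * R ^ 2) = 2 * R ^ 3 by ring]

lemma Bx_sub {k R N : ℕ} (hR : 1 ≤ R) (hN : 2 * R ^ 3 < N) {r : Fin k → ℝ} (hr : r ∈ Rats k R) :
    Bx k R N r ⊆ Set.Icc (fun _ => -(1 / (2 * R : ℝ))) (fun _ => -(1 / (2 * R : ℝ)) + 1) := by
  obtain ⟨q, ⟨hq1, hqR⟩, a, ha, rfl⟩ := mem_Rats.mp hr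
  have hR0 : (1:ℝ) ≤ R := by exact_mod_cast hR
  have hq0 : (0:ℝ) < q := by exact_mod_cast hq1
  have hqR' : (q:ℝ) ≤ R := by exact_mod_cast hqR
  have h2 : 1 / (2 * (R:ℝ) ^ 2) ≤ 1 / (2 * R) := by
    refine one_div_le_one_div_of_le (by linarith) ?_
    nlinarith
  refine Set.Icc_subset_Icc (fun i => ?_) (fun i => ?_)
  · have := sc_R (k := k) hR hN i
    have h1 : (0:ℝ) ≤ (a i : ℝ) / q := by positivity
    simp only; linarith
  · have := sc_R (k := k) hR hN i
    have h1 : (a i : ℝ) / q ≤ 1 - 1 / R := by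
      have h3 : (a i : ℝ) + 1 ≤ q := by exact_mod_cast ha i
      have h4 : 1 / (R:ℝ) ≤ 1 / q := one_div_le_one_div_of_le hq0 hqR'
      have h5 : (a i : ℝ) / q ≤ (q - 1) / q := by gcongr; linarith
      have h6 : ((q:ℝ) - 1) / q = 1 - 1 / q := by field_simp
      linarith
    have h7 : 1 / (R:ℝ) = 1 / (2 * R) + 1 / (2 * R) := by field_simp; norm_num
    simp only; linarith

lemma Bx_disj {k R N : ℕ} (hR : 1 ≤ R) (hN : 2 * R ^ 3 < N) :
    (Rats k R : Set (Fin k → ℝ)).Pairwise (Function.onFun Disjoint (Bx k R N)) := by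
  intro r hr r' hr' hne
  obtain ⟨q, ⟨hq1, hqR⟩, a, ha, rfl⟩ := mem_Rats.mp hr
  obtain ⟨q', ⟨hq1', hqR'⟩, a', ha', rfl⟩ := mem_Rats.mp hr'
  refine Set.disjoint_left.mpr fun α h1 h2 => hne ?_
  have hR0 : (1:ℝ) ≤ R := by exact_mod_cast hR
  have hq0 : (0:ℝ) < q := by exact_mod_cast hq1
  have hq0' : (0:ℝ) < q' := by exact_mod_cast hq1'
  have hqq : (q:ℝ) * q' ≤ R * R := by exact_mod_cast Nat.mul_le_mul hqR hqR'
  funext i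
  have hs := sc_R (k := k) hR hN i
  have b1 := h1.1 i; have b2 := h1.2 i; have b3 := h2.1 i; have b4 := h2.2 i
  simp only at b1 b2 b3 b4
  have h3 : |(a i : ℝ) / q - (a' i : ℝ) / q'| < 1 / (R:ℝ) ^ 2 := by
    have : 1 / (R:ℝ) ^ 2 = 1 / (2 * R ^ 2) + 1 / (2 * R ^ 2) := by field_simp; norm_num
    rw [abs_lt]; constructor <;> linarith
  have h4 : (a i : ℝ) / q - (a' i : ℝ) / q' = (((a i : ℤ) * q' - q * a' i : ℤ) : ℝ) / (q * q') := by
    push_cast; field_simp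
  rw [h4, abs_div, abs_of_pos (mul_pos hq0 hq0'), div_lt_div_iff₀ (by positivity) (by positivity)] at h3
  have h5 : |(((a i : ℤ) * q' - q * a' i : ℤ) : ℝ)| < 1 := by
    by_contra hc
    push Not at hc
    have : 1 * (R:ℝ) ^ 2 ≤ |(((a i : ℤ) * q' - q * a' i : ℤ) : ℝ)| * R ^ 2 := by gcongr
    have h6 : (R:ℝ) ^ 2 = R * R := sq _
    linarith
  have h6 : ((a i : ℤ) * q' - q * a' i : ℤ) = 0 := by
    rw [← Int.cast_abs] at h5
    exact Int.abs_lt_one_iff.mp (by exact_mod_cast h5)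
  rw [h6] at h4
  simp only [Int.cast_zero, zero_div] at h4
  linarith

/-- the Weyl property -/
def WeylP (k A : ℕ) (C : ℝ) : Prop := ∀ (α : Fin k → ℝ) (N : ℕ), 1 ≤ N → ∀ D : ℝ, 1 ≤ D →
  (N:ℝ) / D ≤ ‖S (Icc (1:ℤ) N) (pv k) α‖ → ∃ q : ℕ, 1 ≤ q ∧ (q:ℝ) ≤ C * D ^ A ∧
    ∀ i, ∃ z : ℤ, |(q:ℝ) * α i - z| ≤ C * D ^ A / (N:ℝ) ^ ((i:ℕ) + 1)

lemma minor {k A R N : ℕ} {C D : ℝ} (hW : WeylP k A C) (hD : 1 ≤ D) (hR : 1 ≤ R) (hN : 2 * R ^ 3 < N)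
    (hCR : C * D ^ A ≤ R) {α : Fin k → ℝ}
    (hα : α ∈ Set.Icc (fun _ => -(1 / (2 * R : ℝ))) (fun _ => -(1 / (2 * R : ℝ)) + 1))
    (hn : α ∉ ⋃ r ∈ Rats k R, Bx k R N r) : ‖S (Icc (1:ℤ) N) (pv k) α‖ ≤ N / D := by
  by_contra hc
  push Not at hc
  apply hn
  have hN1 : 1 ≤ N := by omega
  obtain ⟨q, hq1, hqC, hz⟩ := hW α N hN1 D hD hc.le
  choose z hz using hz
  have hR0 : (1:ℝ) ≤ R := by exact_mod_cast hR
  have hq0 : (1:ℝ) ≤ q := by exact_mod_cast hq1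
  have hqR : (q:ℝ) ≤ R := hqC.trans hCR
  have hz' : ∀ i, |(q:ℝ) * α i - z i| ≤ sc k N i * R := by
    intro i
    refine (hz i).trans ?_
    unfold sc
    rw [div_eq_inv_mul]
    gcongr
  have h2 : 1 / (2 * (R:ℝ) ^ 2) ≤ 1 / (2 * R) := by
    refine one_div_le_one_div_of_le (by linarith) ?_
    nlinarith
  have h3 : 1 / (2 * (R:ℝ)) ≤ 1 / 2 := by
    refine one_div_le_one_div_of_le (by linarith) ?_
    linarith
  have h4 : 1 / (2 * (R:ℝ)) ≤ q * (1 / (2 * R)) := le_mul_of_one_le_left (by positivity) hq0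
  have h5 : q * (1 / (2 * (R:ℝ))) ≤ 1 / 2 := by
    rw [mul_one_div, div_le_div_iff₀ (by linarith) (by norm_num)]; linarith
  have hzr : ∀ i, 0 ≤ z i ∧ z i < q := by
    intro i
    have hs := sc_R (k := k) hR hN i
    have b := abs_le.mp (hz' i)
    have c1 := mul_le_mul_of_nonneg_left (hα.1 i) (by linarith : (0:ℝ) ≤ q)
    have c2 := mul_le_mul_of_nonneg_left (hα.2 i) (by linarith : (0:ℝ) ≤ q)
    simp only [mul_neg, mul_add, mul_one] at c1 c2
    constructor
    · have : (-1:ℝ) < z i := by linarith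
      have : (-1:ℤ) < z i := by exact_mod_cast this
      omega
    · have : (z i : ℝ) < q := by linarith
      exact_mod_cast this
  rw [Set.mem_iUnion₂]
  refine ⟨fun i => ((z i).toNat : ℝ) / q, mem_Rats.mpr ⟨q, ⟨hq1, by exact_mod_cast hqR⟩, fun i => (z i).toNat, fun i => ?_, rfl⟩, ?_⟩
  · have := hzr i; show (z i).toNat < q; omega
  · have key : ∀ i, |α i - ((z i).toNat : ℝ) / q| ≤ sc k N i * R := by
      intro i
      have h6 : ((z i).toNat : ℝ) = z i := by exact_mod_cast Int.toNat_of_nonneg (hzr i).1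
      have h7 : α i - ((z i).toNat : ℝ) / q = (q * α i - z i) / q := by rw [h6]; field_simp
      rw [h7, abs_div, abs_of_pos (by linarith : (0:ℝ) < q)]
      exact (div_le_self (abs_nonneg _) hq0).trans (hz' i)
    refine ⟨fun i => ?_, fun i => ?_⟩
    · have := abs_le.mp (key i); simp only; linarith
    · have := abs_le.mp (key i); simp only; linarith

/-- main term -/
noncomputable def Mj (s k R N : ℕ) : ℝ := ∑ r ∈ Rats k R, ∫ γ in Set.Icc (fun _ : Fin k => -(R:ℝ)) (fun _ => (R:ℝ)),
  ‖S (Icc (1:ℤ) N) (pv k) (fun i => r i + sc k N i * γ i) / N‖ ^ (2 * s)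

lemma decomp {k A R N s t : ℕ} {C D : ℝ} (hts : t ≤ s) (hW : WeylP k A C) (hD : 1 ≤ D) (hR : 1 ≤ R) (hN : 2 * R ^ 3 < N)
    (hCR : C * D ^ A ≤ R) :
    |(Jn s k N : ℝ) - (N:ℝ) ^ (2 * s) * (∏ i, sc k N i) * Mj s k R N| ≤ (N / D) ^ (2 * (s - t)) * Jn t k N := by
  have hN1 : 1 ≤ N := by omega
  have hN0 : (0:ℝ) < N := by exact_mod_cast hN1
  obtain ⟨Q, hQ⟩ : ∃ Q, Q = Set.Icc (fun _ : Fin k => -(1 / (2 * R : ℝ))) (fun _ => -(1 / (2 * R : ℝ)) + 1) := ⟨_, rfl⟩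
  obtain ⟨M, hM⟩ : ∃ M, M = ⋃ r ∈ Rats k R, Bx k R N r := ⟨_, rfl⟩
  have hMm : MeasurableSet M := by
    rw [hM]; exact Finset.measurableSet_biUnion _ fun r _ => measurableSet_Icc
  have hMQ : M ⊆ Q := by
    rw [hM, hQ]; exact Set.iUnion₂_subset fun r hr => Bx_sub hR hN hr
  have hQm : MeasurableSet Q := by rw [hQ]; exact measurableSet_Icc
  have hint : ∀ m : ℕ, IntegrableOn (fun α => ‖S (Icc (1:ℤ) N) (pv k) α‖ ^ (2 * m)) Q := by
    intro m
    rw [hQ]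
    exact (by fun_prop : Continuous fun α => ‖S (Icc (1:ℤ) N) (pv k) α‖ ^ (2 * m)).continuousOn.integrableOn_compact isCompact_Icc
  have hJ : ∀ m : ℕ, ∫ α in Q, ‖S (Icc (1:ℤ) N) (pv k) α‖ ^ (2 * m) = Jn m k N := by
    intro m; rw [hQ]; exact Jn_eq m k N _
  have hmaj : ∫ α in M, ‖S (Icc (1:ℤ) N) (pv k) α‖ ^ (2 * s) = (N:ℝ) ^ (2 * s) * (∏ i, sc k N i) * Mj s k R N := by
    rw [hM, integral_biUnion_finset (s := Bx k R N) _ (fun r _ => measurableSet_Icc) (Bx_disj hR hN)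
      (fun r hr => (hint s).mono_set (by rw [hQ]; exact Bx_sub hR hN hr)), Mj, mul_sum]
    refine sum_congr rfl fun r _ => ?_
    unfold Bx
    rw [cov r (sc k N) (sc_pos hN1) R]
    have : ∀ γ : Fin k → ℝ, ‖S (Icc (1:ℤ) N) (pv k) (fun i => r i + sc k N i * γ i)‖ ^ (2 * s) =
        (N:ℝ) ^ (2 * s) * ‖S (Icc (1:ℤ) N) (pv k) (fun i => r i + sc k N i * γ i) / N‖ ^ (2 * s) := by
      intro γ
      rw [norm_div, Complex.norm_natCast, div_pow, mul_div_cancel₀ _ (by positivity)]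
    simp_rw [this]
    rw [integral_const_mul]; ring
  rw [← hmaj, ← hJ s, ← setIntegral_sdiff hMm (hint s) hMQ]
  rw [abs_of_nonneg (integral_nonneg fun α => by positivity), ← hJ t, ← integral_const_mul]
  have hsub : Q \ M ⊆ Q := Set.sdiff_subset
  refine (setIntegral_mono_on ((hint s).mono_set hsub) (((hint t).mono_set hsub).const_mul ((N / D) ^ (2 * (s - t)))) (hQm.diff hMm) fun α hα => ?_).trans
    (setIntegral_mono_set ((hint t).const_mul _) (Filter.Eventually.of_forall fun α => ?_) (Filter.Eventually.of_forall hsub))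
  · have h1 := minor hW hD hR hN hCR (by rw [← hQ]; exact hα.1) (by rw [← hM]; exact hα.2)
    have h2 : 2 * s = 2 * (s - t) + 2 * t := by omega
    rw [h2, pow_add]
    gcongr
  · have : (0:ℝ) ≤ N / D := by positivity
    simp only [Pi.zero_apply]
    positivity

lemma pow_sub_le {x y : ℝ} (hx : 0 ≤ x) (hx1 : x ≤ 1) (hy : 0 ≤ y) (hy1 : y ≤ 1) (n : ℕ) :
    |x ^ n - y ^ n| ≤ n * |x - y| := by
  refine (abs_pow_sub_pow_le _ _ _).trans ?_
  have h2 : max |x| |y| ≤ 1 := by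
    rw [abs_of_nonneg hx, abs_of_nonneg hy]; exact max_le hx1 hy1
  calc |x - y| * n * max |x| |y| ^ (n - 1) ≤ |x - y| * n * 1 := by
        gcongr
        exact pow_le_one₀ (le_max_of_le_left (abs_nonneg _)) h2
    _ = _ := by ring

lemma S_div_le {k N : ℕ} (hN : 1 ≤ N) (α : Fin k → ℝ) : ‖S (Icc (1:ℤ) N) (pv k) α / N‖ ≤ 1 := by
  have hN0 : (0:ℝ) < N := by exact_mod_cast hN
  rw [norm_div, Complex.norm_natCast, div_le_one hN0]
  simpa using norm_S_le (Icc (1:ℤ) N) (pv k) α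

lemma Mj_cmp {s k R N N' : ℕ} (hN : 1 ≤ N) (hN' : 1 ≤ N') :
    |Mj s k R N - Mj s k R N'| ≤ (R:ℝ) ^ (k + 1) *
      (((2 * s : ℕ) : ℝ) * ((20 * (k + 1) ^ 2 * R ^ 2 : ℝ) / N + (20 * (k + 1) ^ 2 * R ^ 2 : ℝ) / N') * (2 * R) ^ k) := by
  unfold Mj
  rw [← sum_sub_distrib]
  have hR0 : (0:ℝ) ≤ R := Nat.cast_nonneg _
  have hc : ∀ (M : ℕ) (r : Fin k → ℝ), Continuous fun γ : Fin k → ℝ =>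
      ‖S (Icc (1:ℤ) M) (pv k) (fun i => r i + sc k M i * γ i) / M‖ ^ (2 * s) := by
    intro M r
    have := continuous_S (Icc (1:ℤ) M) (pv k)
    fun_prop
  refine (abs_sum_le_sum_abs _ _).trans ((sum_le_card_nsmul _ _ (((2 * s : ℕ) : ℝ) * ((20 * (k + 1) ^ 2 * R ^ 2 : ℝ) / N + (20 * (k + 1) ^ 2 * R ^ 2 : ℝ) / N') * (2 * R) ^ k) fun r hr => ?_).trans ?_)
  · rw [← integral_sub ((hc N r).continuousOn.integrableOn_compact isCompact_Icc) ((hc N' r).continuousOn.integrableOn_compact isCompact_Icc)]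
    have hvol : (volume : Measure (Fin k → ℝ)).real (Set.Icc (fun _ => -(R:ℝ)) (fun _ => (R:ℝ))) = (2 * R) ^ k := by
      unfold Measure.real
      rw [Real.volume_Icc_pi_toReal (fun _ => by linarith)]
      simp [two_mul]
    rw [← hvol, ← Real.norm_eq_abs]
    refine norm_setIntegral_le_of_norm_le_const isCompact_Icc.measure_lt_top fun γ hγ => ?_
    rw [Real.norm_eq_abs]
    refine (pow_sub_le (norm_nonneg _) (S_div_le hN _) (norm_nonneg _) (S_div_le hN' _) _).trans ?_
    gcongr
    obtain ⟨q, ⟨hq1, hqR⟩, a, ha, rfl⟩ := mem_Rats.mp hr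
    obtain ⟨m, hm⟩ := approx hq1 hqR (fun i => (a i : ℤ)) γ (fun i => abs_le.mpr ⟨hγ.1 i, hγ.2 i⟩)
    have h1 := hm N hN
    have h2 := hm N' hN'
    simp only [Int.cast_natCast] at h1 h2
    rw [norm_sub_rev] at h2
    refine (abs_norm_sub_norm_le _ _).trans ?_
    refine (norm_sub_le_norm_sub_add_norm_sub _ m _).trans ?_
    linarith
  · rw [nsmul_eq_mul]
    gcongr
    exact_mod_cast card_Rats k R

/-- normalised count -/
noncomputable def Φ (s k N : ℕ) : ℝ := (Jn s k N : ℝ) / ((N:ℝ) ^ (2 * s) * ∏ i, sc k N i)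

lemma Φ_decomp {k A R N s t : ℕ} {C D : ℝ} (hts : t < s) (hW : WeylP k A C) (hD : 1 ≤ D) (hR : 1 ≤ R) (hN : 2 * R ^ 3 < N)
    (hCR : C * D ^ A ≤ R) : |Φ s k N - Mj s k R N| ≤ Φ t k N / D := by
  have h := decomp hts.le hW hD hR hN hCR
  have hN1 : 1 ≤ N := by omega
  have hN0 : (0:ℝ) < N := by exact_mod_cast hN1
  have hP : 0 < ∏ i, sc k N i := prod_pos fun i _ => sc_pos hN1 i
  unfold Φ
  obtain ⟨P, hPd⟩ : ∃ P, P = ∏ i, sc k N i := ⟨_, rfl⟩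
  rw [← hPd] at h hP ⊢
  have h1 : (Jn s k N : ℝ) / ((N:ℝ) ^ (2 * s) * P) - Mj s k R N =
    ((Jn s k N : ℝ) - (N:ℝ) ^ (2 * s) * P * Mj s k R N) / ((N:ℝ) ^ (2 * s) * P) := by field_simp
  rw [h1, abs_div, abs_of_pos (by positivity : 0 < (N:ℝ) ^ (2 * s) * P), div_le_iff₀ (by positivity)]
  refine h.trans ?_
  have h2 : 2 * s = 2 * (s - t) + 2 * t := by omega
  rw [h2, pow_add, div_pow]
  have h3 : D ≤ D ^ (2 * (s - t)) := le_self_pow₀ hD (by omega)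
  have hD0 : 0 < D := by linarith
  calc (N:ℝ) ^ (2 * (s - t)) / D ^ (2 * (s - t)) * Jn t k N ≤ (N:ℝ) ^ (2 * (s - t)) / D * Jn t k N := by gcongr
    _ = _ := by field_simp

lemma Φ_cmp {k A R N N' s t : ℕ} {C D : ℝ} (hts : t < s) (hW : WeylP k A C) (hD : 1 ≤ D) (hR : 1 ≤ R) (hN : 2 * R ^ 3 < N)
    (hNN : N ≤ N') (hCR : C * D ^ A ≤ R) : |Φ s k N - Φ s k N'| ≤ (Φ t k N + Φ t k N') / D +
      (80 * s * (k + 1) ^ 2 * 2 ^ k) * (R:ℝ) ^ (2 * k + 3) / N := by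
  have h1 := Φ_decomp hts hW hD hR hN hCR
  have h2 := Φ_decomp hts hW hD hR (hN.trans_le hNN) hCR
  have h3 := Mj_cmp (s := s) (k := k) (R := R) (show 1 ≤ N by omega) (show 1 ≤ N' by omega)
  have hN0 : (0:ℝ) < N := by exact_mod_cast (show 1 ≤ N by omega)
  have h4 : (20 * (k + 1) ^ 2 * R ^ 2 : ℝ) / N' ≤ (20 * (k + 1) ^ 2 * R ^ 2 : ℝ) / N := by gcongr
  have h5 : |Mj s k R N - Mj s k R N'| ≤ (80 * s * (k + 1) ^ 2 * 2 ^ k) * (R:ℝ) ^ (2 * k + 3) / N := by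
    refine h3.trans ?_
    calc _ ≤ (R:ℝ) ^ (k + 1) * (((2 * s : ℕ) : ℝ) * ((20 * (k + 1) ^ 2 * R ^ 2 : ℝ) / N + (20 * (k + 1) ^ 2 * R ^ 2 : ℝ) / N) * (2 * R) ^ k) := by gcongr
      _ = _ := by
        rw [mul_pow, show 2 * k + 3 = (k + 1) + 2 + k by ring, pow_add, pow_add]
        push_cast; ring
  rw [add_div]
  rw [abs_le] at *
  constructor <;> linarith [h1.1, h1.2, h2.1, h2.2, h5.1, h5.2]

lemma prod_sc (k N : ℕ) (hN : 1 ≤ N) : ∏ i, sc k N i = (N:ℝ) ^ (-((k:ℝ) * (k + 1) / 2)) := by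
  unfold sc
  have hN0 : (0:ℝ) ≤ N := Nat.cast_nonneg _
  have h : ∑ i : Fin k, (((i:ℕ):ℝ) + 1) = (k:ℝ) * (k + 1) / 2 := by
    rw [Fin.sum_univ_eq_sum_range (fun i : ℕ => (i:ℝ) + 1)]
    induction k with
    | zero => simp
    | succ k ih => rw [sum_range_succ, ih]; push_cast; ring
  rw [prod_inv_distrib, prod_pow_eq_pow_sum, Real.rpow_neg hN0, ← h, ← Real.rpow_natCast]
  push_cast
  rfl

lemma Φ_eq {s k N : ℕ} (hN : 1 ≤ N) : Φ s k N = (Jn s k N : ℝ) / (N:ℝ) ^ (2 * (s:ℝ) - k * (k + 1) / 2) := by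
  unfold Φ
  have hN0 : (0:ℝ) < N := by exact_mod_cast hN
  rw [prod_sc k N hN, ← Real.rpow_natCast, ← Real.rpow_add hN0]
  congr 2; push_cast; ring

lemma Φ_t {k : ℕ} {Δ : ℝ} (h : Hyp k Δ) : ∃ C : ℝ, 1 ≤ C ∧ ∀ N : ℕ, 1 ≤ N → Φ (k * (k + 1)) k N ≤ C * (N:ℝ) ^ Δ := by
  obtain ⟨C, hC, h⟩ := h
  refine ⟨C, hC, fun N hN => ?_⟩
  have hN0 : (0:ℝ) < N := by exact_mod_cast hN
  rw [Φ_eq hN, div_le_iff₀ (by positivity), mul_assoc, ← Real.rpow_add hN0]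
  refine (h N hN).trans (le_of_eq ?_)
  congr 2; push_cast; ring

end Vino

namespace Vino
open Finset MeasureTheory

lemma dyadic {φ : ℕ → ℝ} {N0 : ℕ} (hN0 : 1 ≤ N0) {B κ : ℝ} (hB : 0 ≤ B) (hκ : 0 < κ)
    (h : ∀ N N' : ℕ, N0 ≤ N → N ≤ N' → N' ≤ 2 * N → |φ N - φ N'| ≤ B * (N:ℝ) ^ (-κ)) : CauchySeq φ := by
  obtain ⟨θ, hθ⟩ : ∃ θ : ℝ, θ = (2:ℝ) ^ (-κ) := ⟨_, rfl⟩
  have hθ1 : θ < 1 := by rw [hθ]; exact Real.rpow_lt_one_of_one_lt_of_neg (by norm_num) (by linarith)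
  have hθ0 : 0 < θ := by rw [hθ]; positivity
  obtain ⟨E, hE⟩ : ∃ E : ℝ, E = B / (1 - θ) := ⟨_, rfl⟩
  have hE1 : B + E * θ = E := by
    rw [hE]; have : 1 - θ ≠ 0 := by linarith
    field_simp; ring
  have hE0 : 0 ≤ E := by rw [hE]; exact div_nonneg hB (by linarith)
  have hBE : B ≤ E := by nlinarith
  have key : ∀ j : ℕ, ∀ N N' : ℕ, N0 ≤ N → N ≤ N' → N' ≤ 2 ^ j * N → |φ N - φ N'| ≤ E * (N:ℝ) ^ (-κ) := by
    intro j
    induction j with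
    | zero =>
      intro N N' h1 h2 h3
      have : N' = N := by omega
      rw [this, sub_self, abs_zero]; positivity
    | succ j ih =>
      intro N N' h1 h2 h3
      by_cases h4 : N' ≤ 2 * N
      · exact (h N N' h1 h2 h4).trans (by gcongr)
      · have a1 := h N (2 * N) h1 (by omega) le_rfl
        have a2 := ih (2 * N) N' (by omega) (by omega) (by rw [pow_succ] at h3; linarith)
        have a3 : (((2 * N : ℕ) : ℝ)) ^ (-κ) = θ * (N:ℝ) ^ (-κ) := by
          push_cast; rw [Real.mul_rpow (by norm_num) (Nat.cast_nonneg _), hθ]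
        rw [a3] at a2
        calc |φ N - φ N'| ≤ |φ N - φ (2 * N)| + |φ (2 * N) - φ N'| := abs_sub_le _ _ _
          _ ≤ B * (N:ℝ) ^ (-κ) + E * (θ * (N:ℝ) ^ (-κ)) := add_le_add a1 a2
          _ = (B + E * θ) * (N:ℝ) ^ (-κ) := by ring
          _ = _ := by rw [hE1]
  rw [Metric.cauchySeq_iff']
  intro ε hε
  have ht : Filter.Tendsto (fun N : ℕ => E * (N:ℝ) ^ (-κ)) Filter.atTop (nhds (E * 0)) :=
    ((tendsto_rpow_neg_atTop hκ).comp tendsto_natCast_atTop_atTop).const_mul E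
  rw [mul_zero] at ht
  obtain ⟨N, hN1, hN2⟩ := ((ht.eventually (gt_mem_nhds hε)).and (Filter.eventually_ge_atTop N0)).exists
  refine ⟨N, fun n hn => ?_⟩
  rw [dist_comm, Real.dist_eq]
  refine (key n N n hN2 hn ?_).trans_lt hN1
  calc n ≤ 2 ^ n := Nat.lt_two_pow_self.le
    _ ≤ 2 ^ n * N := Nat.le_mul_of_pos_right _ (by omega)

lemma converge {s k : ℕ} (hk : 1 ≤ k) (hs : k * (k + 1) < s) : CauchySeq (fun N : ℕ => Φ s k N) := by
  obtain ⟨A, C, hC, hW⟩ := weyl k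
  have hW : WeylP k A C := hW
  have hk0 : (1:ℝ) ≤ k := by exact_mod_cast hk
  obtain ⟨c, hc⟩ : ∃ c : ℝ, c = 1 / (2 * (2 * k + 3)) := ⟨_, rfl⟩
  have hc0 : 0 < c := by rw [hc]; positivity
  have hc1 : c ≤ 1 / 10 := by rw [hc]; exact one_div_le_one_div_of_le (by norm_num) (by linarith)
  have hck : c * (2 * k + 3) = 1 / 2 := by rw [hc]; field_simp
  obtain ⟨σ, hσ⟩ : ∃ σ : ℝ, σ = c / (2 * (A + 1)) := ⟨_, rfl⟩
  have hA0 : (0:ℝ) ≤ A := Nat.cast_nonneg _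
  have hσ0 : 0 < σ := by rw [hσ]; positivity
  have hσA : σ * A + σ = c / 2 := by rw [hσ]; field_simp
  have hσA1 : σ * A ≤ c / 2 := by linarith
  have hσ1 : σ ≤ 1 := by nlinarith
  obtain ⟨C', hC', hΦ⟩ := Φ_t (vmvt hk (half_pos hσ0))
  obtain ⟨B, hB⟩ : ∃ B : ℝ, B = 80 * s * (k + 1) ^ 2 * 2 ^ k := ⟨_, rfl⟩
  have hB0 : 0 ≤ B := by rw [hB]; positivity
  have e1 : ∀ᶠ N : ℕ in Filter.atTop, C + 1 ≤ (N:ℝ) ^ (c / 2) :=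
    ((tendsto_rpow_atTop (half_pos hc0)).comp tendsto_natCast_atTop_atTop).eventually (Filter.eventually_ge_atTop _)
  have e2 : ∀ᶠ N : ℕ in Filter.atTop, 2 < (N:ℝ) ^ (1 - c * 3) :=
    ((tendsto_rpow_atTop (by linarith)).comp tendsto_natCast_atTop_atTop).eventually (Filter.eventually_gt_atTop _)
  obtain ⟨N0, hN0⟩ := Filter.eventually_atTop.mp (e1.and e2)
  refine dyadic (N0 := N0 + 1) (by omega) (B := 4 * C' + B) (κ := σ / 2) (by linarith) (half_pos hσ0) fun N N' h1 h2 h3 => ?_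
  obtain ⟨g1, g2⟩ := hN0 N (by omega)
  have hN1 : 1 ≤ N := by omega
  have hNr : (1:ℝ) ≤ N := by exact_mod_cast hN1
  have hN00 : (0:ℝ) < N := by linarith
  obtain ⟨R, hR⟩ : ∃ R : ℕ, R = ⌊(N:ℝ) ^ c⌋₊ := ⟨_, rfl⟩
  have hRle : (R:ℝ) ≤ (N:ℝ) ^ c := by rw [hR]; exact Nat.floor_le (by positivity)
  have hRge : (N:ℝ) ^ c - 1 ≤ R := by rw [hR]; linarith [Nat.lt_floor_add_one ((N:ℝ) ^ c)]
  have hx1 : 1 ≤ (N:ℝ) ^ (c / 2) := Real.one_le_rpow hNr (by linarith)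
  have hcc : (N:ℝ) ^ c = (N:ℝ) ^ (c / 2) * (N:ℝ) ^ (c / 2) := by rw [← Real.rpow_add hN00]; congr 1; ring
  have hCR0 : C * (N:ℝ) ^ (c / 2) ≤ R := by
    nlinarith
  have hDA : ((N:ℝ) ^ σ) ^ A = (N:ℝ) ^ (σ * A) := by rw [Real.rpow_mul hN00.le, Real.rpow_natCast]
  have hCR : C * ((N:ℝ) ^ σ) ^ A ≤ R := by
    rw [hDA]
    refine le_trans ?_ hCR0
    gcongr
  have hR1 : 1 ≤ R := by
    have : (1:ℝ) ≤ R := by nlinarith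
    exact_mod_cast this
  have hpow : ∀ n : ℕ, (R:ℝ) ^ n ≤ (N:ℝ) ^ (c * n) := by
    intro n
    rw [Real.rpow_mul hN00.le, Real.rpow_natCast]
    gcongr
  have hRN : 2 * R ^ 3 < N := by
    have h5 := hpow 3
    push_cast at h5
    have : (2:ℝ) * R ^ 3 < N := by
      calc (2:ℝ) * R ^ 3 ≤ 2 * (N:ℝ) ^ (c * 3) := by gcongr
        _ < (N:ℝ) ^ (1 - c * 3) * (N:ℝ) ^ (c * 3) := by gcongr
        _ = N := by rw [← Real.rpow_add hN00]; simp
    exact_mod_cast this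
  have hD : 1 ≤ (N:ℝ) ^ σ := Real.one_le_rpow hNr hσ0.le
  refine (Φ_cmp hs hW hD hR1 hRN h2 hCR).trans ?_
  rw [← hB, add_mul]
  refine add_le_add ?_ ?_
  · have a1 := hΦ N hN1
    have a2 := hΦ N' (by omega)
    have a3 : (N':ℝ) ^ (σ / 2) ≤ 2 * (N:ℝ) ^ (σ / 2) := by
      calc (N':ℝ) ^ (σ / 2) ≤ (2 * N : ℝ) ^ (σ / 2) := by
            gcongr; exact_mod_cast h3
        _ = 2 ^ (σ / 2) * (N:ℝ) ^ (σ / 2) := Real.mul_rpow (by norm_num) hN00.le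
        _ ≤ 2 * (N:ℝ) ^ (σ / 2) := by
          gcongr
          calc (2:ℝ) ^ (σ / 2) ≤ 2 ^ (1:ℝ) := Real.rpow_le_rpow_of_exponent_le (by norm_num) (by linarith)
            _ = 2 := Real.rpow_one _
    have a4 : Φ (k * (k + 1)) k N + Φ (k * (k + 1)) k N' ≤ 4 * C' * (N:ℝ) ^ (σ / 2) := by
      have a5 : C' * (N':ℝ) ^ (σ / 2) ≤ C' * (2 * (N:ℝ) ^ (σ / 2)) := by gcongr
      have a6 : 0 ≤ C' * (N:ℝ) ^ (σ / 2) := by positivity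
      linarith
    rw [div_le_iff₀ (by positivity), mul_assoc, ← Real.rpow_add hN00]
    refine a4.trans (le_of_eq ?_)
    congr 2; ring
  · rw [mul_div_assoc]
    refine mul_le_mul_of_nonneg_left ?_ hB0
    have h5 := hpow (2 * k + 3)
    push_cast at h5
    rw [hck] at h5
    rw [div_le_iff₀ hN00]
    calc (R:ℝ) ^ (2 * k + 3) ≤ (N:ℝ) ^ ((1:ℝ) / 2) := h5
      _ ≤ (N:ℝ) ^ (-(σ / 2) + 1) := by
        gcongr
        linarith
      _ = _ := by rw [Real.rpow_add hN00, Real.rpow_one]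

end Vino

namespace Vino
open Finset MeasureTheory

lemma J_eq (s k : ℕ) {X : ℝ} (hX : 0 ≤ X) : J s k X = Jn s k ⌊X⌋₊ := by
  unfold J Jn cnt
  rw [← Set.ncard_coe_finset]
  congr 1
  ext ⟨x, y⟩
  have hle : ∀ z : ℤ, (z : ℝ) ≤ X ↔ z ≤ (⌊X⌋₊ : ℤ) := by
    intro z
    rw [Int.natCast_floor_eq_floor hX, Int.le_floor]
  simp only [Set.mem_ofPred_eq, coe_filter, mem_product, Fintype.mem_piFinset, mem_Icc, hle, and_assoc]
  refine and_congr_right fun _ => and_congr_right fun _ => ?_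
  constructor
  · intro h
    funext i
    have := h (i + 1) ⟨by omega, by omega⟩
    simpa [pv] using this
  · intro h j hj
    have := congrFun h ⟨j - 1, by omega⟩
    simpa [pv, Nat.sub_add_cancel hj.1] using this

lemma Φ_lower {s k N : ℕ} (hN : 1 ≤ N) : 1 / ((s:ℝ) + 1) ^ k ≤ Φ s k N := by
  have hN0 : (0:ℝ) < N := by exact_mod_cast hN
  obtain ⟨W, hW⟩ : ∃ W : Finset (Fin k → ℤ), W = Fintype.piFinset fun i : Fin k => Icc (1 - 1 : ℤ) ((s * N ^ ((i:ℕ) + 1) : ℕ) : ℤ) := ⟨_, rfl⟩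
  obtain ⟨Ω, hΩ⟩ : ∃ Ω : Finset (Fin s → ℤ), Ω = Fintype.piFinset fun _ : Fin s => Icc (1:ℤ) N := ⟨_, rfl⟩
  have hmem : ∀ x ∈ Ω, ∑ i, pv k (x i) ∈ W := by
    intro x hx
    rw [hΩ, Fintype.mem_piFinset] at hx
    rw [hW, Fintype.mem_piFinset]
    intro j
    rw [mem_Icc, Finset.sum_apply]
    constructor
    · refine sum_nonneg fun i _ => ?_
      have := (mem_Icc.mp (hx i)).1
      unfold pv; positivity
    · refine (sum_le_card_nsmul _ _ ((N:ℤ) ^ ((j:ℕ) + 1)) fun i _ => ?_).trans ?_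
      · have := mem_Icc.mp (hx i)
        unfold pv
        exact pow_le_pow_left₀ (by linarith [this.1]) this.2 _
      · simp
  have h1 := cnt_eq_sum Ω (fun x => ∑ i, pv k (x i)) W hmem
  have h2 : #Ω = ∑ v ∈ W, #{x ∈ Ω | ∑ i, pv k (x i) = v} :=
    card_eq_sum_card_fiberwise hmem
  have h3 := sq_sum_le_card_mul_sum_sq (s := W) (f := fun v => #{x ∈ Ω | ∑ i, pv k (x i) = v})
  rw [← h1, ← h2] at h3
  have hΩc : #Ω = N ^ s := by rw [hΩ, Fintype.card_piFinset]; simp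
  have hJ : cnt Ω (fun x => ∑ i, pv k (x i)) = Jn s k N := by rw [hΩ]; rfl
  rw [hΩc, hJ] at h3
  have hWc : (#W : ℝ) ≤ ((s:ℝ) + 1) ^ k / ∏ i, sc k N i := by
    have : (#W : ℝ) = ∏ i : Fin k, ((s:ℝ) * (N:ℝ) ^ ((i:ℕ) + 1) + 1) := by
      rw [hW, Fintype.card_piFinset]
      push_cast
      refine prod_congr rfl fun i _ => ?_
      rw [Int.card_Icc]
      have h0 : ((s * N ^ ((i:ℕ) + 1) : ℕ) : ℤ) + 1 - (1 - 1) = ((s * N ^ ((i:ℕ) + 1) + 1 : ℕ) : ℤ) := by push_cast; ring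
      push_cast at h0
      rw [h0]
      exact_mod_cast (by rw [Int.toNat_natCast] : ((s * N ^ ((i:ℕ) + 1) + 1 : ℕ) : ℤ).toNat = s * N ^ ((i:ℕ) + 1) + 1)
    rw [this]
    have h5 : ((s:ℝ) + 1) ^ k / ∏ i, sc k N i = ∏ i : Fin k, (((s:ℝ) + 1) * (N:ℝ) ^ ((i:ℕ) + 1)) := by
      unfold sc
      rw [prod_mul_distrib, prod_inv_distrib]; simp
    rw [h5]
    refine prod_le_prod (fun i _ => by positivity) fun i _ => ?_
    have : (1:ℝ) ≤ (N:ℝ) ^ ((i:ℕ) + 1) := one_le_pow₀ (by exact_mod_cast hN)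
    linarith
  have h4 : ((N:ℝ) ^ s) ^ 2 ≤ #W * Jn s k N := by exact_mod_cast h3
  have hP : 0 < ∏ i, sc k N i := prod_pos fun i _ => sc_pos hN i
  unfold Φ
  obtain ⟨P, hPd⟩ : ∃ P, P = ∏ i, sc k N i := ⟨_, rfl⟩
  rw [← hPd] at hP hWc ⊢
  rw [div_le_div_iff₀ (by positivity) (by positivity), one_mul, show 2 * s = s * 2 by ring, pow_mul]
  calc ((N:ℝ) ^ s) ^ 2 * P ≤ (((s:ℝ) + 1) ^ k / P * Jn s k N) * P := by
        gcongr; exact h4.trans (by gcongr)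
    _ = _ := by field_simp

lemma s_large {s k : ℕ} (hk : 1 ≤ k) (h : (s : ℝ) ≥ (k : ℝ) ^ 2 * (2 * Real.log k + Real.log (Real.log k) + 5)) :
    k * (k + 1) < s := by
  have hk0 : (1:ℝ) ≤ k := by exact_mod_cast hk
  have key : (3:ℝ) ≤ 2 * Real.log k + Real.log (Real.log k) + 5 := by
    rcases hk.eq_or_lt with h1 | h1
    · subst h1; simp; norm_num
    · have h2 : (2:ℝ) ≤ k := by exact_mod_cast h1
      have h3 : Real.log 2 ≤ Real.log k := Real.log_le_log (by norm_num) h2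
      have h4 := Real.log_two_gt_d9
      have h5 : 0 < Real.log k := by linarith
      have h6 := Real.one_sub_inv_le_log_of_pos h5
      have h7 : (Real.log k)⁻¹ ≤ 2 := by
        rw [inv_le_comm₀ h5 (by norm_num)]; linarith
      linarith
  have h1 : (k:ℝ) * (k + 1) < s := by
    have : (k:ℝ) ^ 2 * 3 ≤ s := by
      refine le_trans ?_ h
      gcongr
    nlinarith
  exact_mod_cast h1

lemma lim {s k : ℕ} {C : ℝ} (h : Filter.Tendsto (fun N : ℕ => Φ s k N) Filter.atTop (nhds C)) :
    Filter.Tendsto (fun X : ℝ => (J s k X : ℝ) / X ^ (2 * (s : ℝ) - k * (k + 1) / 2))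
        Filter.atTop (nhds C) := by
  obtain ⟨lam, hl⟩ : ∃ lam : ℝ, lam = 2 * (s : ℝ) - k * (k + 1) / 2 := ⟨_, rfl⟩
  have h1 : Filter.Tendsto (fun X : ℝ => ((⌊X⌋₊ : ℝ) / X) ^ lam) Filter.atTop (nhds (1 ^ lam)) :=
    (tendsto_nat_floor_div_atTop (R := ℝ)).rpow_const (Or.inl one_ne_zero)
  have h2 := (h.comp (tendsto_nat_floor_atTop (α := ℝ))).mul h1
  rw [Real.one_rpow, mul_one] at h2
  refine h2.congr' ?_
  filter_upwards [Filter.eventually_ge_atTop (1:ℝ)] with X hX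
  have hf : 1 ≤ ⌊X⌋₊ := Nat.le_floor (by simpa using hX)
  have hf0 : (0:ℝ) < ⌊X⌋₊ := by exact_mod_cast hf
  simp only [Function.comp]
  rw [J_eq s k (by linarith), Φ_eq hf, ← hl, Real.div_rpow hf0.le (by linarith)]
  have : 0 < (⌊X⌋₊ : ℝ) ^ lam := by positivity
  field_simp

lemma Φ_zero (s N : ℕ) (hN : 1 ≤ N) : Φ s 0 N = 1 := by
  have hN0 : (0:ℝ) < N := by exact_mod_cast hN
  have : Jn s 0 N = N ^ (2 * s) := by
    unfold Jn cnt
    rw [filter_true_of_mem (fun z _ => Subsingleton.elim _ _), card_product, Fintype.card_piFinset]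
    simp [two_mul, pow_add]
  unfold Φ
  rw [this]
  simp [hN0.ne']

end Vino

theorem vinogradov_asymptotic_classical (s k : ℕ)
    (h : (s : ℝ) ≥ (k : ℝ) ^ 2 * (2 * Real.log k + Real.log (Real.log k) + 5)) :
    ∃ C : ℝ, C > 0 ∧
      Filter.Tendsto (fun X : ℝ => (J s k X : ℝ) / X ^ (2 * (s : ℝ) - k * (k + 1) / 2))
        Filter.atTop (nhds C) := by
  rcases Nat.eq_zero_or_pos k with hk | hk
  · subst hk
    refine ⟨1, one_pos, Vino.lim ?_⟩
    refine tendsto_const_nhds.congr' ?_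
    filter_upwards [Filter.eventually_ge_atTop 1] with N hN
    exact (Vino.Φ_zero s N hN).symm
  · obtain ⟨C, hC⟩ := cauchySeq_tendsto_of_complete (Vino.converge hk (Vino.s_large hk h))
    refine ⟨C, ?_, Vino.lim hC⟩
    have h1 : 1 / ((s:ℝ) + 1) ^ k ≤ C := by
      refine ge_of_tendsto hC ?_
      filter_upwards [Filter.eventually_ge_atTop 1] with N hN
      exact Vino.Φ_lower hN
    have h2 : 0 < 1 / ((s:ℝ) + 1) ^ k := by positivity
    linarith
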